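/- Let (V, L) be a quantized metric space. Then dist_NC(V, V^c) = 0, where (V^c, L^c) is the closed quantized metric space obtained by extending L_{D_L} to the closure, and also dist_NC((V, L), (V, L_{D_L})) = 0. -/

import Mathlib

open scoped ComplexOrder

noncomputable section

/-- The operator (ℓ² → ℓ²) norm of a complex scalar matrix. -/
noncomputable def scalarOpNorm {m n : Type*} [Fintype m] [Fintype n] [DecidableEq n]
    (γ : Matrix m n ℂ) : ℝ :=
  ‖LinearMap.toContinuousLinearMap (Matrix.toEuclideanLin γ)‖

/-- A matrix order unit space `(V, 1)`: a complex *-vector space with a distinguished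
matrix ordering (given by the graded family of positive cones) and an Archimedean
matrix order unit. -/
structure MOUS : Type 1 where
  carrier : Type
  [acg : AddCommGroup carrier]
  [mod : Module ℂ carrier]
  [sam : StarAddMonoid carrier]
  [sm : StarModule ℂ carrier]
  one : carrier
  pos : ∀ n : ℕ, Set (Matrix (Fin n) (Fin n) carrier)
  pos_add : ∀ n, ∀ v ∈ pos n, ∀ w ∈ pos n, v + w ∈ pos n
  pos_smul : ∀ n (t : ℝ), 0 ≤ t → ∀ v ∈ pos n, (t : ℂ) • v ∈ pos n
  pos_star : ∀ n, ∀ v ∈ pos n, v.conjTranspose = v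
  pos_congr : ∀ n m (γ : Matrix (Fin n) (Fin m) ℂ), ∀ v ∈ pos n,
    (Matrix.of fun i j => ∑ k, ∑ l, (star (γ k i) * γ l j) • v k l) ∈ pos m
  proper : ∀ v : Matrix (Fin 1) (Fin 1) carrier, v ∈ pos 1 → -v ∈ pos 1 → v = 0
  unit_pos : ∀ n, Matrix.diagonal (fun _ => one) ∈ pos n
  orderUnit : ∀ v : carrier, star v = v →
    ∃ t : ℝ, 0 < t ∧
      (Matrix.of fun _ _ => (t : ℂ) • one - v : Matrix (Fin 1) (Fin 1) carrier) ∈ pos 1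
  archimedean : ∀ n (v : Matrix (Fin n) (Fin n) carrier),
    (∀ t : ℝ, 0 < t → v + (t : ℂ) • Matrix.diagonal (fun _ => one) ∈ pos n) → v ∈ pos n

attribute [instance] MOUS.acg MOUS.mod MOUS.sam MOUS.sm

/-- Entrywise application of a linear map to a matrix. -/
def mapMat {V W : Type} [AddCommGroup V] [AddCommGroup W] [Module ℂ V] [Module ℂ W]
    (φ : V →ₗ[ℂ] W) {n : ℕ} (a : Matrix (Fin n) (Fin n) V) : Matrix (Fin n) (Fin n) W :=
  Matrix.of fun i j => φ (a i j)

/-- The direct sum (block diagonal) of two matrices over a vector space. -/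
def dsumMat {V : Type} [AddCommGroup V] {m n : ℕ}
    (v : Matrix (Fin m) (Fin m) V) (w : Matrix (Fin n) (Fin n) V) :
    Matrix (Fin (m + n)) (Fin (m + n)) V :=
  Matrix.reindex finSumFinEquiv finSumFinEquiv (Matrix.fromBlocks v 0 0 w)

/-- The two-sided scalar matrix product `α v β`. -/
def mmulMat {V : Type} [AddCommGroup V] [Module ℂ V] {m n : ℕ}
    (α : Matrix (Fin n) (Fin m) ℂ) (v : Matrix (Fin m) (Fin m) V)
    (β : Matrix (Fin m) (Fin n) ℂ) : Matrix (Fin n) (Fin n) V :=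
  Matrix.of fun i j => ∑ k, ∑ l, (α i k * β l j) • v k l

/-- The unit matrix `1ₙ` in `Mₙ(V)`. -/
def MOUS.unitMat (A : MOUS) (n : ℕ) : Matrix (Fin n) (Fin n) A.carrier :=
  Matrix.diagonal fun _ => A.one

/-- The matrix norm determined by the matrix order:
`‖v‖ = inf { t : [[t1, v], [v*, t1]] ≥ 0 }`. -/
def MOUS.matNorm (A : MOUS) {n : ℕ} (v : Matrix (Fin n) (Fin n) A.carrier) : ℝ :=
  sInf {t : ℝ | (Matrix.reindex finSumFinEquiv finSumFinEquiv
    (Matrix.fromBlocks ((t : ℂ) • A.unitMat n) v v.conjTranspose ((t : ℂ) • A.unitMat n)))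
      ∈ A.pos (n + n)}

/-- A matrix Lipschitz seminorm on a matrix order unit space. -/
structure IsMatrixLipschitzSeminorm (A : MOUS)
    (L : ∀ n : ℕ, Matrix (Fin n) (Fin n) A.carrier → ℝ) : Prop where
  nonneg : ∀ n v, 0 ≤ L n v
  add_le : ∀ n v w, L n (v + w) ≤ L n v + L n w
  smul_eq : ∀ n (c : ℂ) v, L n (c • v) = ‖c‖ * L n v
  null_iff : ∀ n v, L n v = 0 ↔
    ∃ lam : Matrix (Fin n) (Fin n) ℂ, v = Matrix.of fun i j => lam i j • A.one
  dsum_eq : ∀ m n v w, L (m + n) (dsumMat v w) = max (L m v) (L n w)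
  mmul_le : ∀ m n (α : Matrix (Fin n) (Fin m) ℂ) v (β : Matrix (Fin m) (Fin n) ℂ),
    L n (mmulMat α v β) ≤ scalarOpNorm α * L m v * scalarOpNorm β
  star_eq : ∀ n v, L n (Matrix.conjTranspose v) = L n v

/-- A matrix seminorm (finite matrix gauge). -/
structure IsMatrixSeminorm (A : MOUS)
    (N : ∀ n : ℕ, Matrix (Fin n) (Fin n) A.carrier → ℝ) : Prop where
  nonneg : ∀ n v, 0 ≤ N n v
  add_le : ∀ n v w, N n (v + w) ≤ N n v + N n w
  smul_le : ∀ n (c : ℂ) v, N n (c • v) ≤ ‖c‖ * N n v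
  dsum_eq : ∀ m n v w, N (m + n) (dsumMat v w) = max (N m v) (N n w)
  mmul_le : ∀ m n (α : Matrix (Fin n) (Fin m) ℂ) v (β : Matrix (Fin m) (Fin n) ℂ),
    N n (mmulMat α v β) ≤ scalarOpNorm α * N m v * scalarOpNorm β

/-- Linear maps from `V` to `Mₙ(ℂ)`; matrix states live here. -/
abbrev MState (A : MOUS) (n : ℕ) := A.carrier →ₗ[ℂ] Matrix (Fin n) (Fin n) ℂ

/-- The matrix pairing `⟨⟨φ, a⟩⟩ = [φ(a_{ij})] ∈ M_{rn}(ℂ)`. -/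
def mpair {A : MOUS} {n r : ℕ} (φ : MState A n) (a : Matrix (Fin r) (Fin r) A.carrier) :
    Matrix (Fin r × Fin n) (Fin r × Fin n) ℂ :=
  Matrix.of fun p q => φ (a p.1 q.1) p.2 q.2

/-- The `n`-th matrix state space: unital completely positive maps `V → Mₙ(ℂ)`. -/
def CS (A : MOUS) (n : ℕ) : Set (MState A n) :=
  {φ | φ A.one = 1 ∧ ∀ r, ∀ v ∈ A.pos r, (mpair φ v).PosSemidef}

/-- The matrix metric `D_{Lₙ}` on matrix states coming from a matrix Lipschitz seminorm. -/
def Dmet (A : MOUS) (L : ∀ n : ℕ, Matrix (Fin n) (Fin n) A.carrier → ℝ) (n : ℕ)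
    (φ ψ : MState A n) : ℝ :=
  sSup {x | ∃ (r : ℕ) (a : Matrix (Fin r) (Fin r) A.carrier), L r a ≤ 1 ∧
    x = scalarOpNorm (mpair φ a - mpair ψ a)}

/-- The BW (pointwise, weak-*) topology on the space of linear maps `V → Mₙ(ℂ)`. -/
def lmTop (A : MOUS) (n : ℕ) : TopologicalSpace (MState A n) :=
  TopologicalSpace.induced (fun φ => (φ : A.carrier → Matrix (Fin n) (Fin n) ℂ)) inferInstance

/-- The BW topology on the matrix state space. -/
def BWtop (A : MOUS) (n : ℕ) : TopologicalSpace {φ : MState A n // φ ∈ CS A n} :=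
  TopologicalSpace.induced Subtype.val (lmTop A n)

/-- The topology on the matrix state space defined by the matrix metric `D_L`. -/
def Dtop (A : MOUS) (L : ∀ n : ℕ, Matrix (Fin n) (Fin n) A.carrier → ℝ) (n : ℕ) :
    TopologicalSpace {φ : MState A n // φ ∈ CS A n} :=
  TopologicalSpace.generateFrom
    {U | ∃ (φ₀ : {φ : MState A n // φ ∈ CS A n}) (ε : ℝ), 0 < ε ∧
      U = {ψ | Dmet A L n φ₀.1 ψ.1 < ε}}

/-- A matrix Lip-norm: a matrix Lipschitz seminorm for which the `D_L`-topology on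
each matrix state space agrees with the BW-topology. -/
structure IsMatrixLipNorm (A : MOUS)
    (L : ∀ n : ℕ, Matrix (Fin n) (Fin n) A.carrier → ℝ)
    extends IsMatrixLipschitzSeminorm A L : Prop where
  top_eq : ∀ n, Dtop A L n = BWtop A n

/-- A unital completely positive linear map between matrix order unit spaces. -/
structure IsUCP (A B : MOUS) (φ : A.carrier →ₗ[ℂ] B.carrier) : Prop where
  unital : φ A.one = B.one
  cp : ∀ n, ∀ v ∈ A.pos n, mapMat φ v ∈ B.pos n

/-- `L` induces `LB` via the (surjective, UCP) map `φ`: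
`LB` is the corresponding family of quotient seminorms. -/
def Induces (A B : MOUS) (φ : A.carrier →ₗ[ℂ] B.carrier)
    (L : ∀ n : ℕ, Matrix (Fin n) (Fin n) A.carrier → ℝ)
    (LB : ∀ n : ℕ, Matrix (Fin n) (Fin n) B.carrier → ℝ) : Prop :=
  ∀ n (b : Matrix (Fin n) (Fin n) B.carrier),
    LB n b = sInf {x | ∃ a, mapMat φ a = b ∧ x = L n a}

/-- The quotient seminorm of `L` via `φ`. -/
def quotSeminorm (A B : MOUS) (φ : A.carrier →ₗ[ℂ] B.carrier)
    (L : ∀ n : ℕ, Matrix (Fin n) (Fin n) A.carrier → ℝ) (n : ℕ)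
    (b : Matrix (Fin n) (Fin n) B.carrier) : ℝ :=
  sInf {x | ∃ a, mapMat φ a = b ∧ x = L n a}

/-- The operator space (matrix order unit space) direct sum `V₁ ⊕ V₂`. -/
def MOUS.prod (A B : MOUS) : MOUS where
  carrier := A.carrier × B.carrier
  one := (A.one, B.one)
  pos n := {v | (Matrix.of fun i j => (v i j).1) ∈ A.pos n ∧
    (Matrix.of fun i j => (v i j).2) ∈ B.pos n}
  pos_add := by
    rintro n v ⟨hv1, hv2⟩ w ⟨hw1, hw2⟩
    exact ⟨A.pos_add n _ hv1 _ hw1, B.pos_add n _ hv2 _ hw2⟩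
  pos_smul := by
    rintro n t ht v ⟨hv1, hv2⟩
    exact ⟨A.pos_smul n t ht _ hv1, B.pos_smul n t ht _ hv2⟩
  pos_star := by
    rintro n v ⟨hv1, hv2⟩
    have h1 := A.pos_star n _ hv1
    have h2 := B.pos_star n _ hv2
    funext i j
    exact Prod.ext (congrFun (congrFun h1 i) j) (congrFun (congrFun h2 i) j)
  pos_congr := by
    rintro n m γ v ⟨hv1, hv2⟩
    constructor
    · have h1 := A.pos_congr n m γ _ hv1
      convert h1 using 2
      funext i j
      simp [Prod.fst_sum]
    · have h2 := B.pos_congr n m γ _ hv2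
      convert h2 using 2
      funext i j
      simp [Prod.snd_sum]
  proper := by
    rintro v ⟨h1, h2⟩ ⟨h3, h4⟩
    have e1 := A.proper _ h1 h3
    have e2 := B.proper _ h2 h4
    funext i j
    exact Prod.ext (congrFun (congrFun e1 i) j) (congrFun (congrFun e2 i) j)
  unit_pos := by
    intro n
    constructor
    · convert A.unit_pos n using 2
      funext i j
      by_cases hij : i = j <;> simp [Matrix.diagonal_apply, hij]
    · convert B.unit_pos n using 2
      funext i j
      by_cases hij : i = j <;> simp [Matrix.diagonal_apply, hij]
  orderUnit := by
    rintro ⟨a, b⟩ hstar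
    have ha : star a = a := congrArg Prod.fst hstar
    have hb : star b = b := congrArg Prod.snd hstar
    obtain ⟨t₁, ht₁, hp₁⟩ := A.orderUnit a ha
    obtain ⟨t₂, ht₂, hp₂⟩ := B.orderUnit b hb
    have huA : (Matrix.of fun _ _ => A.one : Matrix (Fin 1) (Fin 1) A.carrier) ∈ A.pos 1 := by
      convert A.unit_pos 1 using 2
      funext i j
      simp [Matrix.diagonal_apply, Subsingleton.elim i j]
    have huB : (Matrix.of fun _ _ => B.one : Matrix (Fin 1) (Fin 1) B.carrier) ∈ B.pos 1 := by
      convert B.unit_pos 1 using 2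
      funext i j
      simp [Matrix.diagonal_apply, Subsingleton.elim i j]
    refine ⟨t₁ + t₂, add_pos ht₁ ht₂, ?_, ?_⟩
    · have e : (Matrix.of fun _ _ => ((t₁ + t₂ : ℝ) : ℂ) • A.one - a :
          Matrix (Fin 1) (Fin 1) A.carrier)
          = (Matrix.of fun _ _ => (t₁ : ℂ) • A.one - a) +
            (t₂ : ℂ) • (Matrix.of fun _ _ => A.one) := by
        funext i j
        show ((t₁ + t₂ : ℝ) : ℂ) • A.one - a
          = ((t₁ : ℂ) • A.one - a) + (t₂ : ℂ) • A.one
        push_cast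
        rw [add_smul]
        abel
      exact e ▸ A.pos_add 1 _ hp₁ _ (A.pos_smul 1 t₂ ht₂.le _ huA)
    · have e : (Matrix.of fun _ _ => ((t₁ + t₂ : ℝ) : ℂ) • B.one - b :
          Matrix (Fin 1) (Fin 1) B.carrier)
          = (Matrix.of fun _ _ => (t₂ : ℂ) • B.one - b) +
            (t₁ : ℂ) • (Matrix.of fun _ _ => B.one) := by
        funext i j
        show ((t₁ + t₂ : ℝ) : ℂ) • B.one - b
          = ((t₂ : ℂ) • B.one - b) + (t₁ : ℂ) • B.one
        push_cast
        rw [add_smul]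
        abel
      exact e ▸ B.pos_add 1 _ hp₂ _ (B.pos_smul 1 t₁ ht₁.le _ huB)
  archimedean := by
    rintro n v h
    constructor
    · apply A.archimedean
      intro t ht
      have h1 := (h t ht).1
      have e : (Matrix.of fun i j =>
            (((v + (t : ℂ) • Matrix.diagonal fun _ =>
              ((A.one, B.one) : A.carrier × B.carrier) :
                Matrix (Fin n) (Fin n) (A.carrier × B.carrier))) i j).1)
          = (Matrix.of fun i j => (v i j).1) +
            (t : ℂ) • Matrix.diagonal fun _ => A.one := by
        funext i j
        by_cases hij : i = j <;>
          simp [Matrix.add_apply, Matrix.smul_apply, Matrix.diagonal_apply, hij]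
      rw [e] at h1
      exact h1
    · apply B.archimedean
      intro t ht
      have h2 := (h t ht).2
      have e : (Matrix.of fun i j =>
            (((v + (t : ℂ) • Matrix.diagonal fun _ =>
              ((A.one, B.one) : A.carrier × B.carrier) :
                Matrix (Fin n) (Fin n) (A.carrier × B.carrier))) i j).2)
          = (Matrix.of fun i j => (v i j).2) +
            (t : ℂ) • Matrix.diagonal fun _ => B.one := by
        funext i j
        by_cases hij : i = j <;>
          simp [Matrix.add_apply, Matrix.smul_apply, Matrix.diagonal_apply, hij]
      rw [e] at h2
      exact h2

/-- First coordinate projection `V₁ ⊕ V₂ → V₁`. -/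
def fstL (A B : MOUS) : (A.prod B).carrier →ₗ[ℂ] A.carrier :=
  LinearMap.fst ℂ A.carrier B.carrier

/-- Second coordinate projection `V₁ ⊕ V₂ → V₂`. -/
def sndL (A B : MOUS) : (A.prod B).carrier →ₗ[ℂ] B.carrier :=
  LinearMap.snd ℂ A.carrier B.carrier

/-- `M(L₁, L₂)`: the set of matrix Lip-norms on `V₁ ⊕ V₂` inducing `L₁` and `L₂`
via the coordinate projections. -/
def MSet (A : MOUS) (LA : ∀ n : ℕ, Matrix (Fin n) (Fin n) A.carrier → ℝ)
    (B : MOUS) (LB : ∀ n : ℕ, Matrix (Fin n) (Fin n) B.carrier → ℝ) :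
    Set (∀ n : ℕ, Matrix (Fin n) (Fin n) (A.prod B).carrier → ℝ) :=
  {L | IsMatrixLipNorm (A.prod B) L ∧ Induces (A.prod B) A (fstL A B) L LA ∧
    Induces (A.prod B) B (sndL A B) L LB}

/-- Hausdorff distance between two sets with respect to a distance function. -/
def hDist {X : Type} (d : X → X → ℝ) (s t : Set X) : ℝ :=
  max (sSup ((fun x => sInf ((fun y => d x y) '' t)) '' s))
      (sSup ((fun y => sInf ((fun x => d x y) '' s)) '' t))

/-- The quantized Gromov–Hausdorff distance between two quantized metric spaces. -/
def distNC (A : MOUS) (LA : ∀ n : ℕ, Matrix (Fin n) (Fin n) A.carrier → ℝ)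
    (B : MOUS) (LB : ∀ n : ℕ, Matrix (Fin n) (Fin n) B.carrier → ℝ) : ℝ :=
  sInf {x | ∃ L ∈ MSet A LA B LB, x = ⨆ n : ℕ, ((n : ℝ) ^ 2)⁻¹ *
    hDist (Dmet (A.prod B) L n)
      ((fun φ : MState A n => φ.comp (fstL A B)) '' CS A n)
      ((fun φ : MState B n => φ.comp (sndL A B)) '' CS B n)}

/-- The diameter of a quantized metric space: the diameter of `CS₁(V)` for `D_{L₁}`. -/
def qDiam (A : MOUS) (LA : ∀ n : ℕ, Matrix (Fin n) (Fin n) A.carrier → ℝ) : ℝ :=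
  sSup {x | ∃ φ ∈ CS A 1, ∃ ψ ∈ CS A 1, x = Dmet A LA 1 φ ψ}

/-- Lower semicontinuity of a family of matrix seminorms for the order-unit matrix norms. -/
def IsLSCsem (A : MOUS) (L : ∀ n : ℕ, Matrix (Fin n) (Fin n) A.carrier → ℝ) : Prop :=
  ∀ n (a : Matrix (Fin n) (Fin n) A.carrier) (c : ℝ), c < L n a →
    ∃ δ : ℝ, 0 < δ ∧ ∀ b, A.matNorm (b - a) < δ → c < L n b


/-- The matrix Lip-norm `L_{D_L}` recovered from the matrix metric `D_L`:
`L_{D_{L_n}}(a) = sup ‖⟨⟨φ,a⟩⟩ − ⟨⟨ψ,a⟩⟩‖ / D_{L_r}(φ,ψ)` over distinct matrix states. -/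
def LfromD (A : MOUS) (L : ∀ n : ℕ, Matrix (Fin n) (Fin n) A.carrier → ℝ)
    (n : ℕ) (a : Matrix (Fin n) (Fin n) A.carrier) : ℝ :=
  sSup {x | ∃ (r : ℕ) (φ ψ : MState A r), φ ∈ CS A r ∧ ψ ∈ CS A r ∧ φ ≠ ψ ∧
    x = scalarOpNorm (mpair φ a - mpair ψ a) / Dmet A L r φ ψ}

/-- A family of matrix seminorms is closed if each of its unit balls is closed for the
order-unit matrix norm. -/
def IsClosedLip (A : MOUS) (L : ∀ n : ℕ, Matrix (Fin n) (Fin n) A.carrier → ℝ) : Prop :=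
  ∀ (n : ℕ) (w : Matrix (Fin n) (Fin n) A.carrier),
    (∀ ε : ℝ, 0 < ε → ∃ v, L n v ≤ 1 ∧ A.matNorm (w - v) ≤ ε) → L n w ≤ 1

/-- `(W, Lc, j)` is the closed quantized metric space `(Vᶜ, Lᶜ)` associated to `(V, L)`:
`j` embeds `V` into `W` as a unital complete order embedding with `Lᶜ ∘ j = L_{D_L}`,
`Lᶜ` is a closed matrix Lip-norm, and every element of `M_n(W)` is a norm-limit of
elements of `M_n(j(V))` with controlled Lip-norm. -/
structure IsClosureOf (A : MOUS) (L : ∀ n : ℕ, Matrix (Fin n) (Fin n) A.carrier → ℝ)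
    (W : MOUS) (Lc : ∀ n : ℕ, Matrix (Fin n) (Fin n) W.carrier → ℝ)
    (j : A.carrier →ₗ[ℂ] W.carrier) : Prop where
  ucp : IsUCP A W j
  inj : Function.Injective j
  ordEmb : ∀ (n : ℕ) (a : Matrix (Fin n) (Fin n) A.carrier),
    mapMat j a ∈ W.pos n ↔ a ∈ A.pos n
  lip : IsMatrixLipNorm W Lc
  closed : IsClosedLip W Lc
  extends_eq : ∀ (n : ℕ) (a : Matrix (Fin n) (Fin n) A.carrier),
    Lc n (mapMat j a) = LfromD A L n a
  dense : ∀ (n : ℕ) (w : Matrix (Fin n) (Fin n) W.carrier) (ε : ℝ), 0 < ε →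
    ∃ a, Lc n (mapMat j a) ≤ Lc n w ∧ W.matNorm (w - mapMat j a) < ε

/-- A unital complete order isomorphism between matrix order unit spaces. -/
structure IsCompleteOrderIso (A B : MOUS) (Φ : A.carrier →ₗ[ℂ] B.carrier) : Prop where
  unital : Φ A.one = B.one
  bij : Function.Bijective Φ
  ordIso : ∀ (n : ℕ) (a : Matrix (Fin n) (Fin n) A.carrier),
    mapMat Φ a ∈ B.pos n ↔ a ∈ A.pos n

section OperatorNorm

open scoped Matrix.Norms.L2Operator

variable {m n : Type*} [Fintype m] [Fintype n]

lemma scalarOpNorm_eq_norm [DecidableEq n] (γ : Matrix m n ℂ) : scalarOpNorm γ = ‖γ‖ := rfl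

lemma scalarOpNorm_nonneg [DecidableEq n] (γ : Matrix m n ℂ) : 0 ≤ scalarOpNorm γ :=
  norm_nonneg _

lemma scalarOpNorm_add_le [DecidableEq n] (γ δ : Matrix m n ℂ) :
    scalarOpNorm (γ + δ) ≤ scalarOpNorm γ + scalarOpNorm δ := by
  simpa only [scalarOpNorm_eq_norm] using norm_add_le γ δ

lemma scalarOpNorm_smul [DecidableEq n] (c : ℂ) (γ : Matrix m n ℂ) :
    scalarOpNorm (c • γ) = ‖c‖ * scalarOpNorm γ := by
  simpa only [scalarOpNorm_eq_norm] using norm_smul c γ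

lemma scalarOpNorm_zero [DecidableEq n] : scalarOpNorm (0 : Matrix m n ℂ) = 0 := by
  simp only [scalarOpNorm_eq_norm, norm_zero]

lemma scalarOpNorm_neg [DecidableEq n] (γ : Matrix m n ℂ) :
    scalarOpNorm (-γ) = scalarOpNorm γ := by
  simpa only [scalarOpNorm_eq_norm] using norm_neg γ

lemma scalarOpNorm_conjTranspose [DecidableEq m] [DecidableEq n] (γ : Matrix m n ℂ) :
    scalarOpNorm γ.conjTranspose = scalarOpNorm γ := by
  simpa only [scalarOpNorm_eq_norm] using Matrix.l2_opNorm_conjTranspose γ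

lemma scalarOpNorm_conjTranspose_mul_self [DecidableEq m] [DecidableEq n] (γ : Matrix m n ℂ) :
    scalarOpNorm (γ.conjTranspose * γ) = scalarOpNorm γ * scalarOpNorm γ := by
  simpa only [scalarOpNorm_eq_norm] using Matrix.l2_opNorm_conjTranspose_mul_self γ

/-- The bilinear form of a scalar matrix. -/
def bilin (M : Matrix m n ℂ) (y : m → ℂ) (x : n → ℂ) : ℂ := ∑ i, ∑ j, y i * M i j * x j

/-- The squared Euclidean norm of a scalar vector. -/
def normSum (x : n → ℂ) : ℝ := ∑ i, ‖x i‖ ^ 2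

lemma normSum_nonneg (x : n → ℂ) : 0 ≤ normSum x := Finset.sum_nonneg fun _ _ => by positivity

lemma normSum_smul (c : ℂ) (x : n → ℂ) : normSum (c • x) = ‖c‖ ^ 2 * normSum x := by
  simp [normSum, mul_pow, Finset.mul_sum]

lemma normSum_star (x : n → ℂ) : normSum (star x) = normSum x := by
  simp [normSum]

lemma normSum_eq_zero {x : n → ℂ} (h : normSum x = 0) : x = 0 := by
  funext i
  have := (Finset.sum_eq_zero_iff_of_nonneg (fun i _ => by positivity)).1 h i (Finset.mem_univ _)
  simpa using this

lemma bilin_smul_left (M : Matrix m n ℂ) (c : ℂ) (y : m → ℂ) (x : n → ℂ) :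
    bilin M (c • y) x = c * bilin M y x := by
  simp [bilin, Finset.mul_sum, mul_assoc]

lemma bilin_smul_right (M : Matrix m n ℂ) (c : ℂ) (y : m → ℂ) (x : n → ℂ) :
    bilin M y (c • x) = c * bilin M y x := by
  simp only [bilin, Finset.mul_sum, Pi.smul_apply, smul_eq_mul]
  exact Finset.sum_congr rfl fun i _ => Finset.sum_congr rfl fun j _ => by ring

lemma bilin_eq_dotProduct (M : Matrix m n ℂ) (y : m → ℂ) (x : n → ℂ) :
    bilin M y x = y ⬝ᵥ (M.mulVec x) := by
  simp [bilin, dotProduct, Matrix.mulVec, Finset.mul_sum, mul_assoc]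

lemma bilin_conjTranspose (M : Matrix m n ℂ) (y : n → ℂ) (x : m → ℂ) :
    bilin M.conjTranspose y x = star (bilin M (star x) (star y)) := by
  simp only [bilin, star_sum, Matrix.conjTranspose_apply, star_mul', Pi.star_apply, star_star]
  rw [Finset.sum_comm]
  exact Finset.sum_congr rfl fun i _ => Finset.sum_congr rfl fun j _ => by ring

lemma norm_sq_eq_normSum (x : n → ℂ) : ‖(WithLp.toLp 2 x : EuclideanSpace ℂ n)‖ ^ 2 = normSum x := by
  rw [EuclideanSpace.norm_sq_eq]; rfl

lemma normSum_mulVec_le [DecidableEq n] (M : Matrix m n ℂ) (x : n → ℂ) :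
    normSum (M.mulVec x) ≤ scalarOpNorm M ^ 2 * normSum x := by
  rw [← norm_sq_eq_normSum, ← norm_sq_eq_normSum, ← mul_pow]
  exact pow_le_pow_left₀ (norm_nonneg _)
    (Matrix.l2_opNorm_mulVec M (WithLp.toLp 2 x : EuclideanSpace ℂ n)) 2

lemma norm_dotProduct_sq_le (y x : n → ℂ) : ‖y ⬝ᵥ x‖ ^ 2 ≤ normSum y * normSum x := by
  have h1 : ‖y ⬝ᵥ x‖ ≤ ∑ i, ‖y i‖ * ‖x i‖ := by
    refine (norm_sum_le _ _).trans (le_of_eq ?_)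
    simp
  calc ‖y ⬝ᵥ x‖ ^ 2 ≤ (∑ i, ‖y i‖ * ‖x i‖) ^ 2 := pow_le_pow_left₀ (norm_nonneg _) h1 2
    _ ≤ _ := Finset.sum_mul_sq_le_sq_mul_sq _ _ _

lemma norm_bilin_sq_le [DecidableEq n] (M : Matrix m n ℂ) (y : m → ℂ) (x : n → ℂ) :
    ‖bilin M y x‖ ^ 2 ≤ scalarOpNorm M ^ 2 * (normSum y * normSum x) := by
  rw [bilin_eq_dotProduct]
  calc _ ≤ _ := norm_dotProduct_sq_le _ _
    _ ≤ normSum y * (scalarOpNorm M ^ 2 * normSum x) :=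
      mul_le_mul_of_nonneg_left (normSum_mulVec_le M x) (normSum_nonneg y)
    _ = _ := by ring

lemma norm_bilin_le [DecidableEq n] (M : Matrix m n ℂ) (y : m → ℂ) (x : n → ℂ) :
    ‖bilin M y x‖ ≤ scalarOpNorm M / 2 * (normSum y + normSum x) := by
  have h := norm_bilin_sq_le M y x
  have hM := scalarOpNorm_nonneg M
  have hy := normSum_nonneg y
  have hx := normSum_nonneg x
  refine abs_le_of_sq_le_sq' (h.trans ?_) (by positivity) |>.2
  have : normSum y * normSum x ≤ ((normSum y + normSum x) / 2) ^ 2 := by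
    nlinarith [sq_nonneg (normSum y - normSum x)]
  calc _ ≤ scalarOpNorm M ^ 2 * ((normSum y + normSum x) / 2) ^ 2 := by gcongr
    _ = _ := by ring

lemma bilin_star_mulVec (M : Matrix m n ℂ) (x : n → ℂ) :
    bilin M (star (M.mulVec x)) x = (normSum (M.mulVec x) : ℂ) := by
  rw [bilin_eq_dotProduct, dotProduct, normSum]
  push_cast
  refine Finset.sum_congr rfl fun i _ => ?_
  rw [Pi.star_apply, Complex.star_def, mul_comm, Complex.mul_conj, Complex.normSq_eq_norm_sq]
  push_cast; rfl

/-- The operator norm is characterised by bounds on the real part of the bilinear form. -/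
lemma scalarOpNorm_le_iff [DecidableEq n] {M : Matrix m n ℂ} {c : ℝ} (hc : 0 ≤ c) :
    scalarOpNorm M ≤ c ↔
      ∀ y x, (bilin M y x).re ≤ c / 2 * (normSum y + normSum x) := by
  constructor
  · intro h y x
    refine (Complex.re_le_norm _).trans ((norm_bilin_le M y x).trans ?_)
    have := add_nonneg (normSum_nonneg y) (normSum_nonneg x)
    gcongr
  · intro h
    refine ContinuousLinearMap.opNorm_le_bound _ hc fun x => ?_
    set u := M.mulVec x.ofLp with hu
    have e1 : ‖(LinearMap.toContinuousLinearMap (Matrix.toEuclideanLin M)) x‖ ^ 2 = normSum u := by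
      rw [← norm_sq_eq_normSum]; rfl
    have e2 : ‖x‖ ^ 2 = normSum x.ofLp := by rw [← norm_sq_eq_normSum]
    set b := ‖(LinearMap.toContinuousLinearMap (Matrix.toEuclideanLin M)) x‖
    have hb : 0 ≤ b := norm_nonneg _
    have hx : 0 ≤ ‖x‖ := norm_nonneg _
    have key : ∀ t : ℝ, t * b ^ 2 ≤ c / 2 * (t ^ 2 * b ^ 2 + ‖x‖ ^ 2) := by
      intro t
      have := h ((t : ℂ) • star u) x.ofLp
      rw [bilin_smul_left, bilin_star_mulVec, normSum_smul, normSum_star, ← hu, ← e1, ← e2] at this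
      rw [← Complex.ofReal_mul, Complex.ofReal_re] at this
      simpa using this
    rcases hb.eq_or_lt with h0 | h0
    · rw [← h0]; positivity
    · have := key (‖x‖ / b)
      have e3 : ‖x‖ / b * b ^ 2 = ‖x‖ * b := by field_simp
      have e4 : (‖x‖ / b) ^ 2 * b ^ 2 = ‖x‖ ^ 2 := by field_simp
      rw [e3, e4] at this
      rcases hx.eq_or_lt with h1 | h1
      · have hu0 := key (1 / (c + 1))
        rw [← h1] at hu0
        have hc1 : 0 < c + 1 := by linarith
        have : 1 / (c + 1) * b ^ 2 > c / 2 * ((1 / (c + 1)) ^ 2 * b ^ 2 + 0 ^ 2) := by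
          have : c / 2 * ((1 / (c + 1)) ^ 2 * b ^ 2 + 0 ^ 2) =
            (c / (2 * (c + 1))) * (1 / (c + 1) * b ^ 2) := by field_simp; ring
          rw [this]
          have h3 : c / (2 * (c + 1)) < 1 := by rw [div_lt_one (by positivity)]; linarith
          have h4 : 0 < 1 / (c + 1) * b ^ 2 := by positivity
          nlinarith
        linarith
      · nlinarith

lemma scalarOpNorm_sq_le_sum [DecidableEq n] (M : Matrix m n ℂ) :
    scalarOpNorm M ^ 2 ≤ ∑ i, normSum (M i) := by
  have hS : 0 ≤ ∑ i, normSum (M i) := Finset.sum_nonneg fun _ _ => normSum_nonneg _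
  have : scalarOpNorm M ≤ Real.sqrt (∑ i, normSum (M i)) := by
    refine ContinuousLinearMap.opNorm_le_bound _ (Real.sqrt_nonneg _) fun x => ?_
    have e2 : ‖x‖ ^ 2 = normSum x.ofLp := by rw [← norm_sq_eq_normSum]
    have e1 : ‖(LinearMap.toContinuousLinearMap (Matrix.toEuclideanLin M)) x‖ ^ 2
        = normSum (M.mulVec x.ofLp) := by
      rw [← norm_sq_eq_normSum]; rfl
    refine abs_le_of_sq_le_sq' ?_ (by positivity) |>.2
    rw [e1, mul_pow, Real.sq_sqrt hS, e2, Finset.sum_mul]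
    exact Finset.sum_le_sum fun i _ => norm_dotProduct_sq_le _ _
  calc _ ≤ Real.sqrt (∑ i, normSum (M i)) ^ 2 :=
        pow_le_pow_left₀ (scalarOpNorm_nonneg M) this 2
    _ = _ := Real.sq_sqrt hS

lemma norm_apply_le_scalarOpNorm [DecidableEq m] [DecidableEq n] (M : Matrix m n ℂ) (i : m)
    (j : n) : ‖M i j‖ ≤ scalarOpNorm M := by
  have h := norm_bilin_le M (Pi.single i 1) (Pi.single j 1)
  have e : bilin M (Pi.single i 1) (Pi.single j 1) = M i j := by
    simp [bilin, Pi.single_apply]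
  have e1 : normSum (Pi.single i (1 : ℂ)) = 1 := by
    simp [normSum, Pi.single_apply, apply_ite norm, ite_pow]
  have e2 : normSum (Pi.single j (1 : ℂ)) = 1 := by
    simp [normSum, Pi.single_apply, apply_ite norm, ite_pow]
  rw [e, e1, e2] at h
  linarith

end OperatorNorm

lemma continuous_scalarOpNorm {m n : Type*} [Fintype m] [Fintype n] [DecidableEq n] :
    Continuous (fun M : Matrix m n ℂ => scalarOpNorm M) := by
  unfold scalarOpNorm
  refine continuous_norm.comp ?_
  exact LinearMap.continuous_of_finiteDimensional
    ((Matrix.toEuclideanLin (𝕜 := ℂ) (m := m) (n := n)).trans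
      LinearMap.toContinuousLinearMap).toLinearMap

section PositiveSemidefinite

variable {n : Type*} [Fintype n]

lemma star_dotProduct_mulVec_eq_bilin (M : Matrix n n ℂ) (x : n → ℂ) :
    star x ⬝ᵥ M.mulVec x = bilin M (star x) x := (bilin_eq_dotProduct _ _ _).symm

lemma posSemidef_iff_bilin [DecidableEq n] {M : Matrix n n ℂ} :
    M.PosSemidef ↔ ∀ x, 0 ≤ bilin M (star x) x := by
  constructor
  · intro h x
    rw [← star_dotProduct_mulVec_eq_bilin]
    exact h.dotProduct_mulVec_nonneg x
  · intro h
    rw [← Matrix.isPositive_toEuclideanLin_iff, LinearMap.isPositive_iff_complex]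
    intro x
    have e : inner ℂ (Matrix.toEuclideanLin M x) x = star (bilin M (star x.ofLp) x.ofLp) := by
      rw [← inner_conj_symm, EuclideanSpace.inner_eq_star_dotProduct, bilin_eq_dotProduct,
        dotProduct_comm]
      rfl
    have h1 := h x.ofLp
    rw [e]
    obtain ⟨h2, h3⟩ := Complex.nonneg_iff.1 h1
    refine ⟨?_, by simpa using h2⟩
    apply Complex.ext <;> simp [← h3]

lemma bilin_add_left_arg (M N : Matrix n n ℂ) (y x : n → ℂ) :
    bilin (M + N) y x = bilin M y x + bilin N y x := by
  simp [bilin, mul_add, add_mul, Finset.sum_add_distrib]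

lemma bilin_one [DecidableEq n] (x : n → ℂ) : bilin 1 (star x) x = (normSum x : ℂ) := by
  have := bilin_star_mulVec (1 : Matrix n n ℂ) x
  simpa using this

lemma bilin_smul (c : ℂ) (M : Matrix n n ℂ) (y x : n → ℂ) :
    bilin (c • M) y x = c * bilin M y x := by
  simp only [bilin, Finset.mul_sum, Matrix.smul_apply, smul_eq_mul]
  exact Finset.sum_congr rfl fun i _ => Finset.sum_congr rfl fun j _ => by ring

/-- A Hermitian matrix becomes positive after adding a large multiple of the identity. -/
lemma posSemidef_smul_one_add [DecidableEq n] {C : Matrix n n ℂ} (hC : C.IsHermitian) {c : ℝ}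
    (hc : scalarOpNorm C ≤ c) : ((c : ℂ) • (1 : Matrix n n ℂ) + C).PosSemidef := by
  rw [posSemidef_iff_bilin]
  intro x
  rw [bilin_add_left_arg, bilin_smul, bilin_one]
  have h1 := norm_bilin_le C (star x) x
  rw [normSum_star] at h1
  have h2 : star (bilin C (star x) x) = bilin C (star x) x := by
    have := bilin_conjTranspose C (star x) x
    rw [hC.eq] at this
    simpa using this.symm
  have h3 : (bilin C (star x) x).im = 0 := by
    have := congrArg Complex.im h2
    simp at this
    linarith
  rw [Complex.nonneg_iff]
  refine ⟨?_, by simp [h3]⟩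
  have h4 := Complex.abs_re_le_norm (bilin C (star x) x)
  have h5 := neg_abs_le (bilin C (star x) x).re
  have h6 := mul_le_mul_of_nonneg_right hc (normSum_nonneg x)
  rw [← Complex.ofReal_mul, Complex.add_re, Complex.ofReal_re]
  linarith

open scoped MatrixOrder Matrix.Norms.L2Operator in
lemma posSemidef_eq_conjTranspose_mul_self [DecidableEq n] {C : Matrix n n ℂ}
    (hC : C.PosSemidef) : ∃ B : Matrix n n ℂ, C = B.conjTranspose * B := by
  obtain ⟨B, hB⟩ := CStarAlgebra.nonneg_iff_eq_star_mul_self.mp hC.nonneg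
  exact ⟨B, hB⟩

end PositiveSemidefinite

namespace MOUS

variable (A : MOUS)

lemma zero_mem_pos (n : ℕ) : (0 : Matrix (Fin n) (Fin n) A.carrier) ∈ A.pos n := by
  have := A.pos_smul n 0 le_rfl _ (A.unit_pos n)
  simpa using this

lemma star_one : star A.one = A.one := by
  have := congrFun (congrFun (A.pos_star 1 _ (A.unit_pos 1)) 0) 0
  simpa [Matrix.conjTranspose_apply] using this

/-- The matrix `C ⊗ 1` in `Mₙ(V)`. -/
def scalarMat {n : ℕ} (C : Matrix (Fin n) (Fin n) ℂ) : Matrix (Fin n) (Fin n) A.carrier :=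
  Matrix.of fun i j => C i j • A.one

variable {A}

lemma scalarMat_mem_pos {n : ℕ} {C : Matrix (Fin n) (Fin n) ℂ} (hC : C.PosSemidef) :
    A.scalarMat C ∈ A.pos n := by
  obtain ⟨B, hB⟩ := posSemidef_eq_conjTranspose_mul_self hC
  rw [hB]
  convert A.pos_congr n n B _ (A.unit_pos n) using 1
  ext i j
  simp only [scalarMat, Matrix.of_apply, Matrix.diagonal_apply, smul_ite, smul_zero]
  simp [Matrix.mul_apply, Finset.sum_smul]

variable (A) in
/-- Elements dominated from below by a negative multiple of the unit. -/
def BddBelowUnit (n : ℕ) (h : Matrix (Fin n) (Fin n) A.carrier) : Prop :=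
  ∃ t : ℝ, 0 ≤ t ∧ (t : ℂ) • A.unitMat n + h ∈ A.pos n

lemma BddBelowUnit.add {n : ℕ} {h k : Matrix (Fin n) (Fin n) A.carrier}
    (hh : A.BddBelowUnit n h) (hk : A.BddBelowUnit n k) : A.BddBelowUnit n (h + k) := by
  obtain ⟨s, hs, h1⟩ := hh
  obtain ⟨t, ht, h2⟩ := hk
  refine ⟨s + t, add_nonneg hs ht, ?_⟩
  convert A.pos_add n _ h1 _ h2 using 1
  push_cast
  rw [add_smul]; abel

lemma BddBelowUnit.smul {n : ℕ} {h : Matrix (Fin n) (Fin n) A.carrier}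
    (hh : A.BddBelowUnit n h) {c : ℝ} (hc : 0 ≤ c) : A.BddBelowUnit n ((c : ℂ) • h) := by
  obtain ⟨s, hs, h1⟩ := hh
  refine ⟨c * s, mul_nonneg hc hs, ?_⟩
  convert A.pos_smul n c hc _ h1 using 1
  push_cast
  rw [smul_add, mul_smul]

lemma BddBelowUnit.sum {ι : Type*} (s : Finset ι) {n : ℕ}
    (f : ι → Matrix (Fin n) (Fin n) A.carrier)
    (hf : ∀ i ∈ s, A.BddBelowUnit n (f i)) : A.BddBelowUnit n (∑ i ∈ s, f i) := by
  classical
  induction s using Finset.induction_on with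
  | empty => exact ⟨0, le_rfl, by simpa using A.zero_mem_pos n⟩
  | insert a s ha ih =>
    rw [Finset.sum_insert ha]
    exact (hf a (by simp)).add (ih fun i hi => hf i (by simp [hi]))

/-- The matrix `γ* u γ` for a row vector `γ`. -/
def rankOne {n : ℕ} (γ : Fin n → ℂ) (u : A.carrier) : Matrix (Fin n) (Fin n) A.carrier :=
  Matrix.of fun i j => (star (γ i) * γ j) • u

lemma rankOne_mem_pos {n : ℕ} (γ : Fin n → ℂ) {u : A.carrier}
    (hu : (Matrix.of fun _ _ => u : Matrix (Fin 1) (Fin 1) A.carrier) ∈ A.pos 1) :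
    rankOne γ u ∈ A.pos n := by
  convert A.pos_congr 1 n (Matrix.of fun _ j => γ j) _ hu using 1
  ext i j
  simp [rankOne]

lemma isHermitian_rankOne {n : ℕ} (γ : Fin n → ℂ) :
    (Matrix.of fun i j => star (γ i) * γ j).IsHermitian := by
  ext i j
  simp [Matrix.conjTranspose_apply, mul_comm]

lemma bddBelowUnit_rankOne {n : ℕ} (γ : Fin n → ℂ) {u : A.carrier} (hu : star u = u) :
    A.BddBelowUnit n (rankOne γ u) := by
  obtain ⟨t, ht, h⟩ := A.orderUnit (-u) (by simp [hu])
  have h1 := rankOne_mem_pos γ h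
  set C : Matrix (Fin n) (Fin n) ℂ := -((t : ℂ) • Matrix.of fun i j => star (γ i) * γ j) with hCdef
  have hC : C.IsHermitian := by
    have := isHermitian_rankOne γ
    rw [hCdef, Matrix.IsHermitian, Matrix.conjTranspose_neg, Matrix.conjTranspose_smul, this.eq]
    simp
  have h2 := scalarMat_mem_pos (A := A) (posSemidef_smul_one_add hC le_rfl)
  refine ⟨scalarOpNorm C, scalarOpNorm_nonneg _, ?_⟩
  convert A.pos_add n _ h1 _ h2 using 1
  ext i j
  simp only [rankOne, scalarMat, unitMat, Matrix.add_apply, Matrix.smul_apply, Matrix.of_apply,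
    hCdef, Matrix.neg_apply, Matrix.diagonal_apply, Matrix.one_apply]
  by_cases hij : i = j
  · simp only [hij, if_true]; module
  · simp only [hij, if_false]; module

lemma exists_star_decomp (x : A.carrier) :
    ∃ u v : A.carrier, star u = u ∧ star v = v ∧ x = u + Complex.I • v := by
  refine ⟨(1 / 2 : ℂ) • (x + star x), (-Complex.I / 2) • (x - star x), ?_, ?_, ?_⟩
  · simp [star_smul, add_comm]
  · simp only [star_smul, star_sub, star_star, Complex.star_def, map_div₀, map_neg,
      Complex.conj_I, neg_neg, map_ofNat]
    module
  · rw [smul_smul, show Complex.I * (-Complex.I / 2) = 1 / 2 by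
      rw [mul_div_assoc', mul_neg, Complex.I_mul_I, neg_neg]]
    module

/-- The matrix order unit property: Hermitian matrices are dominated by the unit. -/
lemma bddBelowUnit_of_isHermitian {n : ℕ} {h : Matrix (Fin n) (Fin n) A.carrier}
    (hh : h.conjTranspose = h) : A.BddBelowUnit n h := by
  have key : ∀ (i j : Fin n) (x : A.carrier),
      A.BddBelowUnit n (Matrix.single i j x + Matrix.single j i (star x)) := by
    intro i j x
    obtain ⟨u, v, hu, hv, rfl⟩ := exists_star_decomp x
    have h1 := bddBelowUnit_rankOne (A := A) (Pi.single i 1 + Pi.single j 1 : Fin n → ℂ) hu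
    have h2 := bddBelowUnit_rankOne (A := A) (Pi.single i 1 : Fin n → ℂ) (u := -u) (by simp [hu])
    have h3 := bddBelowUnit_rankOne (A := A) (Pi.single j 1 : Fin n → ℂ) (u := -u) (by simp [hu])
    have h4 := bddBelowUnit_rankOne (A := A)
      (Pi.single i 1 + Complex.I • Pi.single j 1 : Fin n → ℂ) hv
    have h5 := bddBelowUnit_rankOne (A := A) (Pi.single i 1 : Fin n → ℂ) (u := -v) (by simp [hv])
    have h6 := bddBelowUnit_rankOne (A := A) (Pi.single j 1 : Fin n → ℂ) (u := -v) (by simp [hv])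
    convert ((((h1.add h2).add h3).add h4).add h5).add h6 using 1
    ext k l
    have hs : ∀ (i j : Fin n) (w : A.carrier), Matrix.single i j w k l
        = ((Pi.single i 1 : Fin n → ℂ) k * (Pi.single j 1 : Fin n → ℂ) l) • w := by
      intro i j w
      rw [Matrix.single_apply, Pi.single_apply, Pi.single_apply]
      by_cases e1 : i = k <;> by_cases e2 : j = l <;> simp [e1, e2, Ne.symm]
    have hst : ∀ i k : Fin n, star ((Pi.single i 1 : Fin n → ℂ) k)
        = (Pi.single i 1 : Fin n → ℂ) k := by
      intro i k
      rw [Pi.single_apply]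
      split_ifs <;> simp
    simp only [rankOne, Matrix.add_apply, Matrix.of_apply, hs, Pi.add_apply,
      Pi.smul_apply, star_add, hu, hv, star_smul, hst, smul_eq_mul, star_mul']
    generalize (Pi.single i 1 : Fin n → ℂ) k = a
    generalize (Pi.single i 1 : Fin n → ℂ) l = a'
    generalize (Pi.single j 1 : Fin n → ℂ) k = b
    generalize (Pi.single j 1 : Fin n → ℂ) l = b'
    have e : (a + star Complex.I * b) * (a' + Complex.I * b')
        = a * a' + Complex.I * (a * b') - Complex.I * (b * a') + b * b' := by
      simp only [Complex.star_def, Complex.conj_I]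
      linear_combination (-(b * b')) * Complex.I_mul_I
    rw [e]
    simp only [Complex.star_def, Complex.conj_I]
    module
  have e : h = ((1 / 2 : ℝ) : ℂ) • ∑ i, ∑ j,
      (Matrix.single i j (h i j) + Matrix.single j i (star (h i j))) := by
    simp only [Finset.sum_add_distrib]
    rw [Finset.sum_comm (f := fun i j => Matrix.single j i (star (h i j)))]
    have e1 : ∀ i j, star (h i j) = h j i := fun i j => by
      conv_rhs => rw [← hh]
      rfl
    simp only [e1]
    rw [← Matrix.matrix_eq_sum_single h]
    ext i j
    simp only [Matrix.smul_apply, Matrix.add_apply]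
    push_cast
    module
  rw [e]
  exact (BddBelowUnit.sum _ _ fun i _ => BddBelowUnit.sum _ _ fun j _ => key i j _).smul
    (by norm_num)

end MOUS

lemma scalarOpNorm_le_of_norm_bilin_sq_le {m n : Type*} [Fintype m] [Fintype n] [DecidableEq n]
    {M : Matrix m n ℂ} {c : ℝ} (hc : 0 ≤ c)
    (h : ∀ y x, ‖bilin M y x‖ ^ 2 ≤ c ^ 2 * (normSum y * normSum x)) : scalarOpNorm M ≤ c := by
  rw [scalarOpNorm_le_iff hc]
  intro y x
  refine (Complex.re_le_norm _).trans (abs_le_of_sq_le_sq' ((h y x).trans ?_) ?_).2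
  · nlinarith [mul_nonneg (sq_nonneg c) (sq_nonneg (normSum y - normSum x))]
  · have := normSum_nonneg y
    have := normSum_nonneg x
    positivity

section Pairing

variable {A : MOUS} {n k : ℕ}

lemma mpair_add (θ : MState A k) (a b : Matrix (Fin n) (Fin n) A.carrier) :
    mpair θ (a + b) = mpair θ a + mpair θ b := by
  ext p q; simp [mpair]

lemma mpair_sub (θ : MState A k) (a b : Matrix (Fin n) (Fin n) A.carrier) :
    mpair θ (a - b) = mpair θ a - mpair θ b := by
  ext p q; simp [mpair]

lemma mpair_smul (θ : MState A k) (c : ℂ) (a : Matrix (Fin n) (Fin n) A.carrier) :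
    mpair θ (c • a) = c • mpair θ a := by
  ext p q; simp [mpair]

lemma mpair_sub_left (φ ψ : MState A k) (a : Matrix (Fin n) (Fin n) A.carrier) :
    mpair (φ - ψ) a = mpair φ a - mpair ψ a := by
  ext p q; simp [mpair]

lemma mpair_add_left (φ ψ : MState A k) (a : Matrix (Fin n) (Fin n) A.carrier) :
    mpair (φ + ψ) a = mpair φ a + mpair ψ a := by
  ext p q; simp [mpair]

lemma mpair_smul_left (c : ℂ) (φ : MState A k) (a : Matrix (Fin n) (Fin n) A.carrier) :
    mpair (c • φ) a = c • mpair φ a := by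
  ext p q; simp [mpair]

lemma mpair_conjTranspose {θ : MState A k} (hθ : ∀ x, θ (star x) = (θ x).conjTranspose)
    (a : Matrix (Fin n) (Fin n) A.carrier) :
    mpair θ a.conjTranspose = (mpair θ a).conjTranspose := by
  ext p q; simp [mpair, hθ, Matrix.conjTranspose_apply]

lemma bilin_mpair (θ : MState A k) (a : Matrix (Fin n) (Fin n) A.carrier)
    (y x : Fin n × Fin k → ℂ) :
    bilin (mpair θ a) y x =
      ∑ p, ∑ q, bilin (θ (a p q)) (fun i => y (p, i)) (fun j => x (q, j)) := by
  simp only [bilin, Fintype.sum_prod_type, mpair, Matrix.of_apply]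
  exact Finset.sum_congr rfl fun p _ => Finset.sum_comm

lemma normSum_prod (x : Fin n × Fin k → ℂ) : normSum x = ∑ p, normSum fun i => x (p, i) := by
  simp only [normSum, Fintype.sum_prod_type]

lemma normSum_prod' (x : Fin n × Fin k → ℂ) : normSum x = ∑ i, normSum fun p => x (p, i) := by
  simp only [normSum, Fintype.sum_prod_type]
  exact Finset.sum_comm

lemma normSum_slice_le (x : Fin n × Fin k → ℂ) (p : Fin n) :
    normSum (fun i => x (p, i)) ≤ normSum x := by
  rw [normSum_prod x]
  exact Finset.single_le_sum (f := fun p => normSum fun i => x (p, i))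
    (fun _ _ => normSum_nonneg _) (Finset.mem_univ p)

lemma scalarOpNorm_mpair_le_sum (θ : MState A k) (a : Matrix (Fin n) (Fin n) A.carrier) :
    scalarOpNorm (mpair θ a) ≤ ∑ p, ∑ q, scalarOpNorm (θ (a p q)) := by
  rw [scalarOpNorm_le_iff (Finset.sum_nonneg fun _ _ => Finset.sum_nonneg fun _ _ =>
    scalarOpNorm_nonneg _)]
  intro y x
  rw [bilin_mpair, Complex.re_sum, Finset.sum_div, Finset.sum_mul]
  refine Finset.sum_le_sum fun p _ => ?_
  rw [Complex.re_sum, Finset.sum_div, Finset.sum_mul]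
  refine Finset.sum_le_sum fun q _ => ?_
  refine ((scalarOpNorm_le_iff (scalarOpNorm_nonneg _)).1 le_rfl _ _).trans ?_
  have h1 := normSum_slice_le y p
  have h2 := normSum_slice_le x q
  have := scalarOpNorm_nonneg (θ (a p q))
  gcongr

lemma norm_apply_le_scalarOpNorm_mpair (θ : MState A k) (a : Matrix (Fin n) (Fin n) A.carrier)
    (p q : Fin n) (i j : Fin k) : ‖θ (a p q) i j‖ ≤ scalarOpNorm (mpair θ a) :=
  norm_apply_le_scalarOpNorm (mpair θ a) (p, i) (q, j)

lemma bilin_mpair_mmulMat {m : ℕ} (θ : MState A k) (α : Matrix (Fin n) (Fin m) ℂ)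
    (v : Matrix (Fin m) (Fin m) A.carrier) (β : Matrix (Fin m) (Fin n) ℂ)
    (y x : Fin n × Fin k → ℂ) :
    bilin (mpair θ (mmulMat α v β)) y x = bilin (mpair θ v)
      (fun p => ∑ i, y (i, p.2) * α i p.1) (fun q => ∑ j, β q.1 j * x (j, q.2)) := by
  have e : mpair θ (mmulMat α v β) = Matrix.kroneckerMap (· * ·) α (1 : Matrix (Fin k) (Fin k) ℂ)
      * (mpair θ v * Matrix.kroneckerMap (· * ·) β (1 : Matrix (Fin k) (Fin k) ℂ)) := by
    ext p q
    simp [mpair, mmulMat, Matrix.mul_apply, Fintype.sum_prod_type, Matrix.one_apply, map_sum,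
      Matrix.sum_apply, Finset.mul_sum]
    exact Finset.sum_congr rfl fun i _ => Finset.sum_congr rfl fun j _ => by ring
  rw [e, bilin_eq_dotProduct, ← Matrix.mulVec_mulVec, ← Matrix.mulVec_mulVec,
    Matrix.dotProduct_mulVec, ← bilin_eq_dotProduct]
  congr 1
  · ext p
    simp [Matrix.vecMul, dotProduct, Fintype.sum_prod_type, Matrix.one_apply]
  · ext p
    simp [Matrix.mulVec, dotProduct, Fintype.sum_prod_type, Matrix.one_apply]

lemma normSum_mul_slice_le {m : ℕ} (β : Matrix (Fin m) (Fin n) ℂ) (x : Fin n × Fin k → ℂ) :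
    normSum (fun q : Fin m × Fin k => ∑ j, β q.1 j * x (j, q.2))
      ≤ scalarOpNorm β ^ 2 * normSum x := by
  rw [normSum_prod', normSum_prod' x, Finset.mul_sum]
  exact Finset.sum_le_sum fun i _ => normSum_mulVec_le β fun j => x (j, i)

lemma normSum_slice_mul_le {m : ℕ} (α : Matrix (Fin n) (Fin m) ℂ) (y : Fin n × Fin k → ℂ) :
    normSum (fun q : Fin m × Fin k => ∑ j, y (j, q.2) * α j q.1)
      ≤ scalarOpNorm α ^ 2 * normSum y := by
  have h := normSum_mul_slice_le α.conjTranspose (star y)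
  rw [scalarOpNorm_conjTranspose, normSum_star] at h
  refine le_trans (le_of_eq ?_) h
  rw [← normSum_star]
  congr 1
  ext q
  simp [Matrix.conjTranspose_apply, mul_comm]

lemma scalarOpNorm_mpair_mmulMat_le {m : ℕ} (θ : MState A k) (α : Matrix (Fin n) (Fin m) ℂ)
    (v : Matrix (Fin m) (Fin m) A.carrier) (β : Matrix (Fin m) (Fin n) ℂ) :
    scalarOpNorm (mpair θ (mmulMat α v β))
      ≤ scalarOpNorm α * scalarOpNorm (mpair θ v) * scalarOpNorm β := by
  have hα := scalarOpNorm_nonneg α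
  have hβ := scalarOpNorm_nonneg β
  have hv := scalarOpNorm_nonneg (mpair θ v)
  refine scalarOpNorm_le_of_norm_bilin_sq_le (by positivity) fun y x => ?_
  rw [bilin_mpair_mmulMat]
  refine (norm_bilin_sq_le _ _ _).trans ?_
  have h1 := normSum_slice_mul_le α y
  have h2 := normSum_mul_slice_le β x
  have h3 := mul_le_mul h1 h2 (normSum_nonneg _)
    (mul_nonneg (sq_nonneg _) (normSum_nonneg _))
  have h4 := mul_le_mul_of_nonneg_left h3 (sq_nonneg (scalarOpNorm (mpair θ v)))
  nlinarith [h4]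

lemma bilin_mpair_dsumMat {m : ℕ} (θ : MState A k) (v : Matrix (Fin m) (Fin m) A.carrier)
    (w : Matrix (Fin n) (Fin n) A.carrier) (y x : Fin (m + n) × Fin k → ℂ) :
    bilin (mpair θ (dsumMat v w)) y x =
      bilin (mpair θ v) (fun p => y (Fin.castAdd n p.1, p.2)) (fun p => x (Fin.castAdd n p.1, p.2))
      + bilin (mpair θ w) (fun p => y (Fin.natAdd m p.1, p.2))
        (fun p => x (Fin.natAdd m p.1, p.2)) := by
  have h0 : ∀ y x : Fin k → ℂ, bilin (0 : Matrix (Fin k) (Fin k) ℂ) y x = 0 := by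
    intro y x; simp [bilin]
  simp only [bilin_mpair, Fin.sum_univ_add, dsumMat, Matrix.reindex_apply, Matrix.submatrix_apply,
    finSumFinEquiv_symm_apply_castAdd, finSumFinEquiv_symm_apply_natAdd,
    Matrix.fromBlocks_apply₁₁, Matrix.fromBlocks_apply₁₂, Matrix.fromBlocks_apply₂₁,
    Matrix.fromBlocks_apply₂₂, Matrix.zero_apply, map_zero, h0, Finset.sum_const_zero,
    add_zero, zero_add]

lemma normSum_add_index {m : ℕ} (x : Fin (m + n) × Fin k → ℂ) :
    normSum x = normSum (fun p : Fin m × Fin k => x (Fin.castAdd n p.1, p.2))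
      + normSum (fun p : Fin n × Fin k => x (Fin.natAdd m p.1, p.2)) := by
  simp only [normSum_prod, Fin.sum_univ_add]

lemma scalarOpNorm_mpair_dsumMat {m : ℕ} (θ : MState A k) (v : Matrix (Fin m) (Fin m) A.carrier)
    (w : Matrix (Fin n) (Fin n) A.carrier) :
    scalarOpNorm (mpair θ (dsumMat v w)) =
      max (scalarOpNorm (mpair θ v)) (scalarOpNorm (mpair θ w)) := by
  have hv := scalarOpNorm_nonneg (mpair θ v)
  have hd := scalarOpNorm_nonneg (mpair θ (dsumMat v w))
  apply le_antisymm
  · rw [scalarOpNorm_le_iff (le_max_of_le_left hv)]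
    intro y x
    rw [bilin_mpair_dsumMat, Complex.add_re, normSum_add_index y, normSum_add_index x]
    have h1 := (scalarOpNorm_le_iff (le_max_of_le_left hv)).1
      (le_max_left (scalarOpNorm (mpair θ v)) (scalarOpNorm (mpair θ w)))
      (fun p => y (Fin.castAdd n p.1, p.2)) (fun p => x (Fin.castAdd n p.1, p.2))
    have h2 := (scalarOpNorm_le_iff (le_max_of_le_left hv)).1
      (le_max_right (scalarOpNorm (mpair θ v)) (scalarOpNorm (mpair θ w)))
      (fun p => y (Fin.natAdd m p.1, p.2)) (fun p => x (Fin.natAdd m p.1, p.2))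
    linarith
  · apply max_le
    · rw [scalarOpNorm_le_iff hd]
      intro y x
      have h := (scalarOpNorm_le_iff hd).1 le_rfl
        (fun p => Fin.addCases (fun i => y (i, p.2)) (fun _ => 0) p.1)
        (fun p => Fin.addCases (fun i => x (i, p.2)) (fun _ => 0) p.1)
      rw [bilin_mpair_dsumMat, normSum_add_index, normSum_add_index] at h
      simpa [bilin, normSum] using h
    · rw [scalarOpNorm_le_iff hd]
      intro y x
      have h := (scalarOpNorm_le_iff hd).1 le_rfl
        (fun p => Fin.addCases (fun _ => 0) (fun i => y (i, p.2)) p.1)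
        (fun p => Fin.addCases (fun _ => 0) (fun i => x (i, p.2)) p.1)
      rw [bilin_mpair_dsumMat, normSum_add_index, normSum_add_index] at h
      simpa [bilin, normSum] using h

/-- The compression `y v x` of a matrix by a row and a column. -/
def compress (y : Fin n → ℂ) (v : Matrix (Fin n) (Fin n) A.carrier) (x : Fin n → ℂ) :
    Matrix (Fin 1) (Fin 1) A.carrier :=
  mmulMat (Matrix.of fun _ i => y i) v (Matrix.of fun i _ => x i)

lemma bilin_mpair_eq_sum_compress (θ : MState A k) (a : Matrix (Fin n) (Fin n) A.carrier)
    (y x : Fin n × Fin k → ℂ) :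
    bilin (mpair θ a) y x =
      ∑ i, ∑ j, θ (compress (fun p => y (p, i)) a (fun q => x (q, j)) 0 0) i j := by
  have e : ∀ i j, θ (compress (fun p => y (p, i)) a (fun q => x (q, j)) 0 0) i j
      = ∑ p, ∑ q, y (p, i) * x (q, j) * θ (a p q) i j := by
    intro i j
    simp [compress, mmulMat, map_sum, Matrix.sum_apply]
  simp only [e]
  simp only [bilin, Fintype.sum_prod_type, mpair, Matrix.of_apply]
  rw [Finset.sum_comm]
  refine Finset.sum_congr rfl fun i _ => ?_
  conv_rhs => rw [Finset.sum_comm]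
  refine Finset.sum_congr rfl fun p _ => ?_
  rw [Finset.sum_comm]
  exact Finset.sum_congr rfl fun j _ => Finset.sum_congr rfl fun q _ => by ring

end Pairing

section SupNorm

variable {A : MOUS}

/-- The matrix seminorm determined by a family of linear maps to matrix algebras. -/
def supNorm (T : ∀ k, Set (MState A k)) (n : ℕ) (a : Matrix (Fin n) (Fin n) A.carrier) : ℝ :=
  sSup {x | ∃ k, ∃ θ ∈ T k, x = scalarOpNorm (mpair θ a)}

/-- Pointwise boundedness of a family of linear maps to matrix algebras. -/
def PtBdd (T : ∀ k, Set (MState A k)) : Prop :=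
  ∀ (n : ℕ) (a : Matrix (Fin n) (Fin n) A.carrier),
    BddAbove {x | ∃ k, ∃ θ ∈ T k, x = scalarOpNorm (mpair θ a)}

variable {T : ∀ k, Set (MState A k)}

lemma supNorm_nonneg (n : ℕ) (a : Matrix (Fin n) (Fin n) A.carrier) : 0 ≤ supNorm T n a := by
  refine Real.sSup_nonneg ?_
  rintro _ ⟨k, θ, -, rfl⟩
  exact scalarOpNorm_nonneg _

lemma supNorm_le {n : ℕ} {a : Matrix (Fin n) (Fin n) A.carrier} {c : ℝ} (hc : 0 ≤ c)
    (h : ∀ k, ∀ θ ∈ T k, scalarOpNorm (mpair θ a) ≤ c) : supNorm T n a ≤ c := by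
  refine Real.sSup_le ?_ hc
  rintro _ ⟨k, θ, hθ, rfl⟩
  exact h k θ hθ

lemma le_supNorm (hT : PtBdd T) {n k : ℕ} (a : Matrix (Fin n) (Fin n) A.carrier)
    {θ : MState A k} (hθ : θ ∈ T k) : scalarOpNorm (mpair θ a) ≤ supNorm T n a :=
  le_csSup (hT n a) ⟨k, θ, hθ, rfl⟩

lemma ptBdd_of_forall (h : ∀ x : A.carrier, ∃ C, ∀ k, ∀ θ ∈ T k, scalarOpNorm (θ x) ≤ C) :
    PtBdd T := by
  intro n a
  choose C hC using h
  refine ⟨∑ p, ∑ q, C (a p q), ?_⟩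
  rintro _ ⟨k, θ, hθ, rfl⟩
  exact (scalarOpNorm_mpair_le_sum θ a).trans
    (Finset.sum_le_sum fun p _ => Finset.sum_le_sum fun q _ => hC _ k θ hθ)

lemma supNorm_add_le (hT : PtBdd T) (n : ℕ) (v w : Matrix (Fin n) (Fin n) A.carrier) :
    supNorm T n (v + w) ≤ supNorm T n v + supNorm T n w := by
  refine supNorm_le (add_nonneg (supNorm_nonneg _ _) (supNorm_nonneg _ _)) fun k θ hθ => ?_
  rw [mpair_add]
  exact (scalarOpNorm_add_le _ _).trans (add_le_add (le_supNorm hT v hθ) (le_supNorm hT w hθ))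

lemma supNorm_smul_le (hT : PtBdd T) (n : ℕ) (c : ℂ) (v : Matrix (Fin n) (Fin n) A.carrier) :
    supNorm T n (c • v) ≤ ‖c‖ * supNorm T n v := by
  refine supNorm_le (mul_nonneg (norm_nonneg _) (supNorm_nonneg _ _)) fun k θ hθ => ?_
  rw [mpair_smul, scalarOpNorm_smul]
  exact mul_le_mul_of_nonneg_left (le_supNorm hT v hθ) (norm_nonneg _)

lemma supNorm_smul (hT : PtBdd T) (n : ℕ) (c : ℂ) (v : Matrix (Fin n) (Fin n) A.carrier) :
    supNorm T n (c • v) = ‖c‖ * supNorm T n v := by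
  refine le_antisymm (supNorm_smul_le hT n c v) ?_
  rcases eq_or_ne c 0 with rfl | hc
  · simpa using supNorm_nonneg n _
  · have h := supNorm_smul_le hT n c⁻¹ (c • v)
    rw [inv_smul_smul₀ hc, norm_inv] at h
    rwa [inv_mul_eq_div, le_div_iff₀ (norm_pos_iff.2 hc), mul_comm] at h

lemma supNorm_dsumMat (hT : PtBdd T) (m n : ℕ) (v : Matrix (Fin m) (Fin m) A.carrier)
    (w : Matrix (Fin n) (Fin n) A.carrier) :
    supNorm T (m + n) (dsumMat v w) = max (supNorm T m v) (supNorm T n w) := by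
  apply le_antisymm
  · refine supNorm_le (le_max_of_le_left (supNorm_nonneg _ _)) fun k θ hθ => ?_
    rw [scalarOpNorm_mpair_dsumMat]
    exact max_le_max (le_supNorm hT v hθ) (le_supNorm hT w hθ)
  · refine max_le (supNorm_le (supNorm_nonneg _ _) fun k θ hθ => ?_)
      (supNorm_le (supNorm_nonneg _ _) fun k θ hθ => ?_)
    all_goals
      refine le_trans ?_ (le_supNorm hT _ hθ)
      rw [scalarOpNorm_mpair_dsumMat]
    · exact le_max_left _ _
    · exact le_max_right _ _

lemma supNorm_mmulMat_le (hT : PtBdd T) (m n : ℕ) (α : Matrix (Fin n) (Fin m) ℂ)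
    (v : Matrix (Fin m) (Fin m) A.carrier) (β : Matrix (Fin m) (Fin n) ℂ) :
    supNorm T n (mmulMat α v β) ≤ scalarOpNorm α * supNorm T m v * scalarOpNorm β := by
  have hα := scalarOpNorm_nonneg α
  have hβ := scalarOpNorm_nonneg β
  refine supNorm_le (mul_nonneg (mul_nonneg hα (supNorm_nonneg _ _)) hβ) fun k θ hθ => ?_
  refine (scalarOpNorm_mpair_mmulMat_le θ α v β).trans ?_
  have := le_supNorm hT v hθ
  gcongr

lemma supNorm_conjTranspose (hs : ∀ k, ∀ θ ∈ T k, ∀ x, θ (star x) = (θ x).conjTranspose)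
    (n : ℕ) (v : Matrix (Fin n) (Fin n) A.carrier) :
    supNorm T n v.conjTranspose = supNorm T n v := by
  unfold supNorm
  congr 1
  ext x
  refine exists_congr fun k => exists_congr fun θ => and_congr_right fun hθ => ?_
  rw [mpair_conjTranspose (hs k θ hθ), scalarOpNorm_conjTranspose]

end SupNorm

section Twist

variable {A : MOUS} {n k m : ℕ}

/-- The linear map `c ↦ P θ(c) Q`. -/
def twist (P : Matrix (Fin m) (Fin k) ℂ) (θ : MState A k) (Q : Matrix (Fin k) (Fin m) ℂ) :
    MState A m where
  toFun c := P * θ c * Q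
  map_add' a b := by simp [Matrix.mul_add, Matrix.add_mul]
  map_smul' c a := by simp

lemma twist_apply (P : Matrix (Fin m) (Fin k) ℂ) (θ : MState A k) (Q : Matrix (Fin k) (Fin m) ℂ)
    (c : A.carrier) : twist P θ Q c = P * θ c * Q := rfl

lemma bilin_mul_mul {l m n k : Type*} [Fintype l] [Fintype m] [Fintype n] [Fintype k]
    (P : Matrix m l ℂ) (M : Matrix l n ℂ) (Q : Matrix n k ℂ) (y : m → ℂ) (x : k → ℂ) :
    bilin (P * M * Q) y x = bilin M (Matrix.vecMul y P) (Q.mulVec x) := by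
  rw [bilin_eq_dotProduct, Matrix.mul_assoc, ← Matrix.mulVec_mulVec, ← Matrix.mulVec_mulVec,
    Matrix.dotProduct_mulVec, ← bilin_eq_dotProduct]

lemma bilin_mpair_twist (P : Matrix (Fin m) (Fin k) ℂ) (θ : MState A k)
    (Q : Matrix (Fin k) (Fin m) ℂ) (a : Matrix (Fin n) (Fin n) A.carrier)
    (y x : Fin n × Fin m → ℂ) :
    bilin (mpair (twist P θ Q) a) y x = bilin (mpair θ a)
      (fun p => Matrix.vecMul (fun i => y (p.1, i)) P p.2)
      (fun q => Q.mulVec (fun j => x (q.1, j)) q.2) := by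
  simp only [bilin_mpair, twist_apply, bilin_mul_mul]

end Twist

/-- Complete positivity of a linear map into a matrix algebra. -/
def IsCPMap {A : MOUS} {k : ℕ} (θ : MState A k) : Prop :=
  ∀ r, ∀ v ∈ A.pos r, (mpair θ v).PosSemidef

section CompletelyPositive

variable {A : MOUS} {n k m : ℕ}

lemma IsCPMap.twist {θ : MState A k} (h : IsCPMap θ) (P : Matrix (Fin k) (Fin m) ℂ) :
    IsCPMap (twist P.conjTranspose θ P) := by
  intro r v hv
  rw [posSemidef_iff_bilin]
  intro x
  rw [bilin_mpair_twist]
  convert posSemidef_iff_bilin.1 (h r v hv) (fun q => P.mulVec (fun j => x (q.1, j)) q.2) using 1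
  congr 1
  ext p
  simp [Matrix.vecMul, Matrix.mulVec, dotProduct, Matrix.conjTranspose_apply, mul_comm]

lemma IsCPMap.posSemidef_apply {θ : MState A k} (h : IsCPMap θ) {x : A.carrier}
    (hx : (Matrix.of fun _ _ => x : Matrix (Fin 1) (Fin 1) A.carrier) ∈ A.pos 1) :
    (θ x).PosSemidef := (h 1 _ hx).submatrix (fun i => ((0 : Fin 1), i))

lemma MOUS.of_one_mem_pos (A : MOUS) :
    (Matrix.of fun _ _ => A.one : Matrix (Fin 1) (Fin 1) A.carrier) ∈ A.pos 1 := by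
  convert A.unit_pos 1 using 2
  funext i j
  simp [Subsingleton.elim i j]

lemma IsCPMap.map_star {θ : MState A k} (h : IsCPMap θ) (x : A.carrier) :
    θ (star x) = (θ x).conjTranspose := by
  have sa : ∀ u : A.carrier, star u = u → (θ u).conjTranspose = θ u := by
    intro u hu
    obtain ⟨t, -, ht⟩ := A.orderUnit u hu
    have h1 := (h.posSemidef_apply ht).1.eq
    have h2 := (h.posSemidef_apply A.of_one_mem_pos).1.eq
    rw [map_sub, map_smul, Matrix.conjTranspose_sub, Matrix.conjTranspose_smul, h2] at h1
    simpa using h1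
  obtain ⟨u, v, hu, hv, rfl⟩ := MOUS.exists_star_decomp x
  simp [hu, hv, sa u hu, sa v hv, star_smul]

lemma mem_CS_iff {φ : MState A k} : φ ∈ CS A k ↔ φ A.one = 1 ∧ IsCPMap φ := Iff.rfl

lemma mpair_unitMat {φ : MState A k} (h : φ A.one = 1) : mpair φ (A.unitMat n) = 1 := by
  ext p q
  simp only [mpair, MOUS.unitMat, Matrix.of_apply, Matrix.diagonal_apply, Matrix.one_apply,
    Prod.ext_iff]
  by_cases hpq : p.1 = q.1 <;> simp [hpq, h, Matrix.one_apply]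

/-- The block matrix `[[t1, v], [v*, t1]]`. -/
def normBlock (t : ℝ) (v : Matrix (Fin n) (Fin n) A.carrier) :
    Matrix (Fin (n + n)) (Fin (n + n)) A.carrier :=
  Matrix.reindex finSumFinEquiv finSumFinEquiv
    (Matrix.fromBlocks ((t : ℂ) • A.unitMat n) v v.conjTranspose ((t : ℂ) • A.unitMat n))

lemma bilin_mpair_normBlock (θ : MState A k) (t : ℝ) (v : Matrix (Fin n) (Fin n) A.carrier)
    (y x : Fin (n + n) × Fin k → ℂ) :
    bilin (mpair θ (normBlock t v)) y x =
      bilin (mpair θ ((t : ℂ) • A.unitMat n)) (fun p => y (Fin.castAdd n p.1, p.2))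
        (fun p => x (Fin.castAdd n p.1, p.2))
      + bilin (mpair θ v) (fun p => y (Fin.castAdd n p.1, p.2))
        (fun p => x (Fin.natAdd n p.1, p.2))
      + (bilin (mpair θ v.conjTranspose) (fun p => y (Fin.natAdd n p.1, p.2))
        (fun p => x (Fin.castAdd n p.1, p.2))
      + bilin (mpair θ ((t : ℂ) • A.unitMat n)) (fun p => y (Fin.natAdd n p.1, p.2))
        (fun p => x (Fin.natAdd n p.1, p.2))) := by
  simp only [bilin_mpair, Fin.sum_univ_add, normBlock, Matrix.reindex_apply,
    Matrix.submatrix_apply,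
    finSumFinEquiv_symm_apply_castAdd, finSumFinEquiv_symm_apply_natAdd,
    Matrix.fromBlocks_apply₁₁, Matrix.fromBlocks_apply₁₂, Matrix.fromBlocks_apply₂₁,
    Matrix.fromBlocks_apply₂₂, Finset.sum_add_distrib]
  ring

lemma scalarOpNorm_mpair_le_of_normBlock {φ : MState A k} (hφ : φ ∈ CS A k) {t : ℝ} (ht : 0 ≤ t)
    {v : Matrix (Fin n) (Fin n) A.carrier} (hv : normBlock t v ∈ A.pos (n + n)) :
    scalarOpNorm (mpair φ v) ≤ t := by
  rw [scalarOpNorm_le_iff ht]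
  intro y x
  have h := posSemidef_iff_bilin.1 (hφ.2 _ _ hv)
    (fun p => Fin.addCases (fun i => -star (y (i, p.2))) (fun i => x (i, p.2)) p.1)
  rw [bilin_mpair_normBlock, mpair_smul, mpair_unitMat hφ.1,
    mpair_conjTranspose (IsCPMap.map_star hφ.2), bilin_conjTranspose, bilin_smul, bilin_smul] at h
  simp only [Pi.star_apply, Fin.addCases_left, Fin.addCases_right, star_neg, star_star] at h
  have e1 := bilin_one (fun p : Fin n × Fin k => -star (y (p.1, p.2)))
  have e2 := bilin_one (fun p : Fin n × Fin k => x (p.1, p.2))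
  have e3 : normSum (fun p : Fin n × Fin k => -star (y (p.1, p.2))) = normSum y := by
    simp [normSum]
  have e4 : bilin (mpair φ v) (fun p => -y (p.1, p.2)) (fun p => x (p.1, p.2))
      = - bilin (mpair φ v) y x := by
    simp [bilin]
  have e5 : (star fun p : Fin n × Fin k => -star (y (p.1, p.2))) = fun p => -y (p.1, p.2) := by
    ext p; simp
  have e6 : (star fun p : Fin n × Fin k => star (x (p.1, p.2))) = fun p => x (p.1, p.2) := by
    ext p; simp
  have e7 : (star fun p : Fin n × Fin k => (x (p.1, p.2))) = fun p => star (x (p.1, p.2)) := by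
    ext p; simp
  rw [e5] at e1
  rw [e7] at e2
  rw [e5, e6, e1, e2, e3, e4] at h
  have h1 := (Complex.nonneg_iff.1 h).1
  simp only [Complex.add_re, ← Complex.ofReal_mul, Complex.ofReal_re, Complex.neg_re,
    Complex.star_def, Complex.conj_re, map_neg] at h1
  have e8 : normSum (fun p : Fin n × Fin k => x (p.1, p.2)) = normSum x := rfl
  rw [e8] at h1
  linarith

lemma normBlock_add (s t : ℝ) (v : Matrix (Fin n) (Fin n) A.carrier) :
    normBlock (s + t) v = (t : ℂ) • A.unitMat (n + n) + normBlock s v := by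
  ext i j
  obtain ⟨i, rfl⟩ := finSumFinEquiv.surjective i
  obtain ⟨j, rfl⟩ := finSumFinEquiv.surjective j
  simp only [normBlock, MOUS.unitMat, Matrix.add_apply, Matrix.smul_apply, Matrix.reindex_apply,
    Matrix.submatrix_apply, Equiv.symm_apply_apply, Matrix.diagonal_apply,
    EmbeddingLike.apply_eq_iff_eq]
  rcases i with i | i <;> rcases j with j | j
  · simp only [Matrix.fromBlocks_apply₁₁, Matrix.smul_apply, Matrix.diagonal_apply,
      Sum.inl.injEq]
    split_ifs
    · push_cast; module
    · simp
  · simp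
  · simp
  · simp only [Matrix.fromBlocks_apply₂₂, Matrix.smul_apply, Matrix.diagonal_apply,
      Sum.inr.injEq]
    split_ifs
    · push_cast; module
    · simp

lemma normBlock_mono {s t : ℝ} (hst : s ≤ t) {v : Matrix (Fin n) (Fin n) A.carrier}
    (hv : normBlock s v ∈ A.pos (n + n)) : normBlock t v ∈ A.pos (n + n) := by
  have h := A.pos_smul _ (t - s) (by linarith) _ (A.unit_pos (n + n))
  have e := normBlock_add s (t - s) v
  rw [add_sub_cancel] at e
  rw [e]
  exact A.pos_add _ _ h _ hv

lemma exists_normBlock_mem (v : Matrix (Fin n) (Fin n) A.carrier) :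
    ∃ t : ℝ, 0 ≤ t ∧ normBlock t v ∈ A.pos (n + n) := by
  obtain ⟨t, ht, h⟩ := MOUS.bddBelowUnit_of_isHermitian (h := normBlock 0 v) (by
    rw [normBlock, Matrix.conjTranspose_reindex, Matrix.fromBlocks_conjTranspose]
    simp)
  refine ⟨t, ht, ?_⟩
  rwa [← normBlock_add, zero_add] at h

lemma scalarOpNorm_mpair_le_of_matNorm_lt {φ : MState A k} (hφ : φ ∈ CS A k) {ε : ℝ} (hε : 0 ≤ ε)
    {v : Matrix (Fin n) (Fin n) A.carrier} (hv : A.matNorm v < ε) :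
    scalarOpNorm (mpair φ v) ≤ ε := by
  obtain ⟨t, -, ht⟩ := exists_normBlock_mem v
  obtain ⟨s, hs, hsε⟩ := exists_lt_of_csInf_lt ⟨t, ht⟩ hv
  exact scalarOpNorm_mpair_le_of_normBlock hφ hε (normBlock_mono hsε.le hs)

lemma scalarOpNorm_apply_le_mpair (θ : MState A k) (x : A.carrier) :
    scalarOpNorm (θ x) ≤
      scalarOpNorm (mpair θ (Matrix.of fun _ _ => x : Matrix (Fin 1) (Fin 1) A.carrier)) := by
  rw [scalarOpNorm_le_iff (scalarOpNorm_nonneg _)]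
  intro y z
  have h := (scalarOpNorm_le_iff (scalarOpNorm_nonneg (mpair θ (Matrix.of fun _ _ => x :
    Matrix (Fin 1) (Fin 1) A.carrier)))).1 le_rfl (fun p => y p.2) (fun p => z p.2)
  rw [bilin_mpair] at h
  simpa [normSum_prod] using h

/-- Matrix states are uniformly bounded at each point. -/
lemma exists_bound_CS (x : A.carrier) :
    ∃ C : ℝ, 0 ≤ C ∧ ∀ k, ∀ φ ∈ CS A k, scalarOpNorm (φ x) ≤ C := by
  obtain ⟨t, ht, h⟩ := exists_normBlock_mem
    (Matrix.of fun _ _ => x : Matrix (Fin 1) (Fin 1) A.carrier)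
  exact ⟨t, ht, fun k φ hφ => (scalarOpNorm_apply_le_mpair φ x).trans
    (scalarOpNorm_mpair_le_of_normBlock hφ ht h)⟩

lemma IsCPMap.one_apply_nonneg {f : MState A 1} (hf : IsCPMap f) :
    0 ≤ (f A.one 0 0).re ∧ (f A.one 0 0).im = 0 := by
  have h := (hf.posSemidef_apply A.of_one_mem_pos).diag_nonneg (i := 0)
  exact ⟨(Complex.nonneg_iff.1 h).1, (Complex.nonneg_iff.1 h).2.symm⟩

lemma IsCPMap.smul {θ : MState A k} (h : IsCPMap θ) {c : ℝ} (hc : 0 ≤ c) :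
    IsCPMap ((c : ℂ) • θ) := by
  intro r v hv
  rw [mpair_smul_left]
  exact (h r v hv).smul (by exact_mod_cast hc)

lemma IsCPMap.add {θ η : MState A k} (h : IsCPMap θ) (h' : IsCPMap η) : IsCPMap (θ + η) := by
  intro r v hv
  rw [mpair_add_left]
  exact (h r v hv).add (h' r v hv)

lemma IsCPMap.norm_apply_le {f : MState A 1} (hf : IsCPMap f) {x : A.carrier} {ε : ℝ}
    (hx : ∀ s ∈ CS A 1, ‖s x 0 0‖ ≤ ε) : ‖f x 0 0‖ ≤ ε * (f A.one 0 0).re := by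
  obtain ⟨h0, him⟩ := hf.one_apply_nonneg
  have h1 : f A.one 0 0 = ((f A.one 0 0).re : ℂ) := by apply Complex.ext <;> simp [him]
  rcases h0.eq_or_lt with h0 | h0
  · have h2 : f A.one 0 0 = 0 := by rw [h1, ← h0]; simp
    have sa : ∀ u : A.carrier, star u = u → 0 ≤ -f u 0 0 := by
      intro u hu
      obtain ⟨t, -, ht⟩ := A.orderUnit u hu
      have h3 := (hf.posSemidef_apply ht).diag_nonneg (i := 0)
      simpa [map_sub, h2] using h3
    have sa' : ∀ u : A.carrier, star u = u → f u 0 0 = 0 := by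
      intro u hu
      have a1 := sa u hu
      have a2 := sa (-u) (by simp [hu])
      simp only [map_neg, Matrix.neg_apply, neg_neg] at a1 a2
      exact le_antisymm (neg_nonneg.1 a1) a2
    obtain ⟨u, v, hu, hv, rfl⟩ := MOUS.exists_star_decomp x
    simp [sa' u hu, sa' v hv, ← h0]
  · set c := (f A.one 0 0).re with hc
    have hs : ((c⁻¹ : ℝ) : ℂ) • f ∈ CS A 1 := by
      refine ⟨?_, hf.smul (inv_nonneg.2 h0.le)⟩
      ext i j
      rw [Subsingleton.elim i 0, Subsingleton.elim j 0, LinearMap.smul_apply, Matrix.smul_apply, h1]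
      simp [h0.ne']
    have h3 := hx _ hs
    rw [LinearMap.smul_apply, Matrix.smul_apply, norm_smul, Complex.norm_real, norm_inv,
      Real.norm_of_nonneg h0.le, inv_mul_le_iff₀ h0] at h3
    linarith

/-- The numerical radius estimate. -/
lemma scalarOpNorm_apply_le_of_states {φ : MState A k} (hφ : φ ∈ CS A k) {x : A.carrier} {ε : ℝ}
    (hε : 0 ≤ ε) (hx : ∀ s ∈ CS A 1, ‖s x 0 0‖ ≤ ε) : scalarOpNorm (φ x) ≤ 2 * ε := by
  have vec : ∀ ξ : Fin k → ℂ, ‖bilin (φ x) (star ξ) ξ‖ ≤ ε * normSum ξ := by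
    intro ξ
    have h := (IsCPMap.twist hφ.2 (Matrix.of fun i (_ : Fin 1) => ξ i)).norm_apply_le hx
    have e : ∀ c, (twist (Matrix.of fun i (_ : Fin 1) => ξ i).conjTranspose φ
        (Matrix.of fun i (_ : Fin 1) => ξ i)) c 0 0 = bilin (φ c) (star ξ) ξ := by
      intro c
      have h2 := bilin_mul_mul (Matrix.of fun i (_ : Fin 1) => ξ i).conjTranspose (φ c)
        (Matrix.of fun i (_ : Fin 1) => ξ i) 1 1
      rw [twist_apply]
      simp only [bilin, Finset.univ_unique, Finset.sum_singleton, Pi.one_apply, one_mul,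
        mul_one] at h2
      refine h2.trans ?_
      simp [bilin, Matrix.vecMul, Matrix.mulVec, dotProduct, Matrix.conjTranspose_apply]
    rw [e, e, hφ.1, bilin_one, Complex.ofReal_re] at h
    exact h
  rw [scalarOpNorm_le_iff (by positivity)]
  intro y z
  obtain ⟨u, rfl⟩ : ∃ u, y = star u := ⟨star y, by simp⟩
  have pol : (4 : ℂ) * bilin (φ x) (star u) z =
      bilin (φ x) (star (z + u)) (z + u) - bilin (φ x) (star (z - u)) (z - u)
      + Complex.I * (bilin (φ x) (star (z + Complex.I • u)) (z + Complex.I • u)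
        - bilin (φ x) (star (z - Complex.I • u)) (z - Complex.I • u)) := by
    simp only [bilin, ← Finset.sum_sub_distrib, ← Finset.sum_add_distrib, Finset.mul_sum]
    refine Finset.sum_congr rfl fun i _ => Finset.sum_congr rfl fun j _ => ?_
    simp only [Pi.star_apply, Pi.add_apply, Pi.sub_apply, Pi.smul_apply, smul_eq_mul, star_add,
      star_sub, star_mul', Complex.star_def, Complex.conj_I]
    linear_combination (-2 * (starRingEnd ℂ (z i)) * (φ x i j) * u j
      + 2 * (starRingEnd ℂ (u i)) * (φ x i j) * z j) * Complex.I_mul_I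
  have h1 := vec (z + u)
  have h2 := vec (z - u)
  have h3 := vec (z + Complex.I • u)
  have h4 := vec (z - Complex.I • u)
  have par : ∀ w : Fin k → ℂ, normSum (z + w) + normSum (z - w) = 2 * (normSum z + normSum w) := by
    intro w
    simp only [normSum, ← Finset.sum_add_distrib, Finset.mul_sum, Pi.add_apply, Pi.sub_apply]
    refine Finset.sum_congr rfl fun i _ => ?_
    have := parallelogram_law_with_norm ℝ (z i) (w i)
    nlinarith
  have p1 := par u
  have p2 := par (Complex.I • u)
  rw [normSum_smul, Complex.norm_I, one_pow, one_mul] at p2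
  have h5 : ‖(4 : ℂ) * bilin (φ x) (star u) z‖ ≤ 4 * ε * (normSum z + normSum u) := by
    rw [pol]
    refine (norm_add_le _ _).trans ?_
    rw [norm_mul, Complex.norm_I, one_mul]
    have a1 := norm_sub_le (bilin (φ x) (star (z + u)) (z + u))
      (bilin (φ x) (star (z - u)) (z - u))
    have a2 := norm_sub_le (bilin (φ x) (star (z + Complex.I • u)) (z + Complex.I • u))
      (bilin (φ x) (star (z - Complex.I • u)) (z - Complex.I • u))
    have q1 : ε * (normSum (z + u) + normSum (z - u)) = ε * (2 * (normSum z + normSum u)) := by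
      rw [p1]
    have q2 : ε * (normSum (z + Complex.I • u) + normSum (z - Complex.I • u))
        = ε * (2 * (normSum z + normSum u)) := by
      rw [p2]
    nlinarith
  rw [norm_mul] at h5
  have h6 := Complex.re_le_norm (bilin (φ x) (star u) z)
  have h7 : ‖(4 : ℂ)‖ = 4 := by simp
  rw [h7] at h5
  rw [normSum_star]
  linarith

lemma scalarOpNorm_mpair_le_of_states {φ : MState A k} (hφ : φ ∈ CS A k)
    {v : Matrix (Fin n) (Fin n) A.carrier} {ε : ℝ} (hε : 0 ≤ ε)
    (hv : ∀ s ∈ CS A 1, ∀ p q, ‖s (v p q) 0 0‖ ≤ ε) :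
    scalarOpNorm (mpair φ v) ≤ n * (n * (2 * ε)) := by
  refine (scalarOpNorm_mpair_le_sum φ v).trans ?_
  refine (Finset.sum_le_sum fun p _ => Finset.sum_le_sum fun q _ =>
    scalarOpNorm_apply_le_of_states hφ hε fun s hs => hv s hs p q).trans ?_
  simp

end CompletelyPositive

section Extension

/-- Krein–Riesz extension along an injective linear map. -/
lemma exists_nonneg_extension {F E : Type*} [AddCommGroup F] [Module ℝ F] [AddCommGroup E]
    [Module ℝ E] (J : F →ₗ[ℝ] E) (hJ : Function.Injective J) (h : F →ₗ[ℝ] ℝ) (s : PointedCone ℝ E)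
    (nonneg : ∀ a, J a ∈ s → 0 ≤ h a) (dense : ∀ y, ∃ a, J a + y ∈ s) :
    ∃ g : E →ₗ[ℝ] ℝ, (∀ a, g (J a) = h a) ∧ ∀ x ∈ s, 0 ≤ g x := by
  obtain ⟨g, hg, hs⟩ := riesz_extension s
    ⟨LinearMap.range J, h.comp (LinearEquiv.ofInjective J hJ).symm.toLinearMap⟩ (by
      rintro ⟨_, a, rfl⟩ hx
      have e : (LinearEquiv.ofInjective J hJ).symm ⟨J a, a, rfl⟩ = a := by
        rw [LinearEquiv.symm_apply_eq]; rfl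
      show 0 ≤ h ((LinearEquiv.ofInjective J hJ).symm ⟨J a, a, rfl⟩)
      rw [e]
      exact nonneg a hx) (fun y => by
      obtain ⟨a, ha⟩ := dense y
      exact ⟨⟨J a, a, rfl⟩, ha⟩)
  refine ⟨g, fun a => ?_, hs⟩
  have e : (LinearEquiv.ofInjective J hJ).symm ⟨J a, a, rfl⟩ = a := by
    rw [LinearEquiv.symm_apply_eq]; rfl
  have := hg ⟨J a, a, rfl⟩
  rw [this]
  show h ((LinearEquiv.ofInjective J hJ).symm ⟨J a, a, rfl⟩) = h a
  rw [e]

variable {W : MOUS} {n : ℕ}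

/-- A real functional on `Mₙ(W)` nonnegative on elements with positive real part comes from a
completely positive map `W → Mₙ`. -/
lemma exists_isCPMap_of_functional (g : Matrix (Fin n) (Fin n) W.carrier → ℝ)
    (hadd : ∀ a b, g (a + b) = g a + g b) (hsmul : ∀ (t : ℝ) a, g ((t : ℂ) • a) = t * g a)
    (hpos : ∀ w, w + w.conjTranspose ∈ W.pos n → 0 ≤ g w) :
    ∃ ψ : MState W n, IsCPMap ψ ∧ ∀ w, (∑ i, ∑ j, ψ (w i j) i j).re = g w := by
  have hneg : ∀ a, g (-a) = - g a := by
    intro a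
    have := hsmul (-1) a
    simpa using this
  set G : Matrix (Fin n) (Fin n) W.carrier → ℂ := fun w => g w - Complex.I * g (Complex.I • w)
    with hG
  have Gadd : ∀ a b, G (a + b) = G a + G b := by
    intro a b
    simp only [hG, smul_add, hadd]; push_cast; ring
  have Gsmul : ∀ (c : ℂ) a, G (c • a) = c * G a := by
    intro c a
    have e1 : c • a = (c.re : ℂ) • a + (c.im : ℂ) • (Complex.I • a) := by
      rw [smul_smul, ← add_smul, Complex.re_add_im]
    have e2 : Complex.I • (c • a) = (c.re : ℂ) • (Complex.I • a) + (c.im : ℂ) • (-a) := by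
      rw [e1, smul_add, smul_comm, smul_comm Complex.I (c.im : ℂ), smul_smul Complex.I Complex.I,
        Complex.I_mul_I, neg_one_smul]
    simp only [hG]
    rw [e2, hadd, hsmul, hsmul, hneg, e1, hadd, hsmul, hsmul]
    conv_rhs => rw [← Complex.re_add_im c]
    push_cast
    linear_combination ((c.im : ℂ) * g (Complex.I • a)) * Complex.I_mul_I
  have Gpos : ∀ w ∈ W.pos n, 0 ≤ G w := by
    intro w hw
    have hst := W.pos_star n w hw
    have h0 : ∀ x : Matrix (Fin n) (Fin n) W.carrier, x.conjTranspose = -x → 0 ≤ g x := by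
      intro x hx
      apply hpos
      rw [hx, add_neg_cancel]
      exact W.zero_mem_pos n
    have h1 : (Complex.I • w).conjTranspose = -(Complex.I • w) := by
      rw [Matrix.conjTranspose_smul, hst]; simp
    have h2 : g (Complex.I • w) = 0 := by
      have a1 := h0 _ h1
      have a2 := h0 (-(Complex.I • w)) (by rw [Matrix.conjTranspose_neg, h1])
      rw [hneg] at a2
      linarith
    have h3 : 0 ≤ g w := hpos w (by rw [hst]; exact W.pos_add n _ hw _ hw)
    simp only [hG, h2]
    simpa using h3
  have Gzero : G 0 = 0 := by simpa using Gsmul 0 0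
  have Gsum : ∀ (f : Fin n → Matrix (Fin n) (Fin n) W.carrier), G (∑ i, f i) = ∑ i, G (f i) :=
    fun f => map_sum (⟨⟨G, Gzero⟩, Gadd⟩ : Matrix (Fin n) (Fin n) W.carrier →+ ℂ) f _
  let ψ : MState W n :=
    { toFun := fun x => Matrix.of fun i j => G (Matrix.single i j x)
      map_add' := by
        intro x y; ext i j
        simp [Matrix.single_add, Gadd]
      map_smul' := by
        intro c x; ext i j
        simp [← Matrix.smul_single, Gsmul] }
  have hψ : ∀ w : Matrix (Fin n) (Fin n) W.carrier, ∑ i, ∑ j, ψ (w i j) i j = G w := by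
    intro w
    conv_rhs => rw [Matrix.matrix_eq_sum_single w]
    simp only [Gsum]
    rfl
  refine ⟨ψ, ?_, ?_⟩
  · intro r v hv
    rw [posSemidef_iff_bilin]
    intro x
    rw [bilin_mpair_eq_sum_compress]
    have := Gpos _ (W.pos_congr r n (Matrix.of fun p i => x (p, i)) v hv)
    rw [← hψ] at this
    simpa [compress, mmulMat] using this
  · intro w
    rw [hψ]
    simp [hG]

lemma IsUCP.map_star {A B : MOUS} {j : A.carrier →ₗ[ℂ] B.carrier} (h : IsUCP A B j)
    (x : A.carrier) : j (star x) = star (j x) := by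
  have sa : ∀ u : A.carrier, star u = u → star (j u) = j u := by
    intro u hu
    obtain ⟨t, -, ht⟩ := A.orderUnit u hu
    have h1 := congrFun (congrFun (B.pos_star _ _ (h.cp _ _ ht)) 0) 0
    simp only [Matrix.conjTranspose_apply, mapMat, Matrix.of_apply, map_sub, map_smul, h.unital,
      star_sub, star_smul, B.star_one] at h1
    simpa using h1
  obtain ⟨u, v, hu, hv, rfl⟩ := MOUS.exists_star_decomp x
  simp [hu, hv, sa u hu, sa v hv, star_smul]

/-- The cone of matrices with positive real part. -/
def rePosCone (W : MOUS) (n : ℕ) : PointedCone ℝ (Matrix (Fin n) (Fin n) W.carrier) where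
  carrier := {w | w + w.conjTranspose ∈ W.pos n}
  add_mem' := by
    intro a b ha hb
    have := W.pos_add n _ ha _ hb
    show _ + _ ∈ W.pos n
    rw [Matrix.conjTranspose_add]
    convert this using 1
    abel
  zero_mem' := by simpa using W.zero_mem_pos n
  smul_mem' := by
    rintro ⟨c, hc⟩ a ha
    have := W.pos_smul n c hc _ ha
    show _ + _ ∈ W.pos n
    convert this using 1
    ext i j
    simp [Matrix.conjTranspose_apply]

lemma exists_unit_add_mem_rePosCone (y : Matrix (Fin n) (Fin n) W.carrier) :
    ∃ t : ℝ, (t : ℂ) • W.unitMat n + y ∈ rePosCone W n := by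
  obtain ⟨t, ht, h⟩ := MOUS.bddBelowUnit_of_isHermitian (h := y + y.conjTranspose)
    (by rw [Matrix.conjTranspose_add, Matrix.conjTranspose_conjTranspose, add_comm])
  refine ⟨t / 2, ?_⟩
  show _ + _ ∈ W.pos n
  convert h using 1
  have := W.pos_star n _ (W.unit_pos n)
  rw [Matrix.conjTranspose_add, Matrix.conjTranspose_smul, MOUS.unitMat, this]
  simp only [Complex.star_def, Complex.conj_ofReal]
  push_cast
  module

lemma re_sum_nonneg {A : MOUS} {φ : MState A n} (hφ : IsCPMap φ)
    {a : Matrix (Fin n) (Fin n) A.carrier} (ha : a + a.conjTranspose ∈ A.pos n) :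
    0 ≤ (∑ i, ∑ j, φ (a i j) i j).re := by
  have h := posSemidef_iff_bilin.1 (hφ n _ ha) (fun p => if p.1 = p.2 then 1 else 0)
  have e : ∀ c : Matrix (Fin n) (Fin n) A.carrier,
      bilin (mpair φ c) (star fun p : Fin n × Fin n => if p.1 = p.2 then 1 else 0)
        (fun p => if p.1 = p.2 then 1 else 0) = ∑ i, ∑ j, φ (c i j) i j := by
    intro c
    rw [bilin_mpair]
    simp [bilin]
  rw [e] at h
  have e2 : ∑ i, ∑ j, φ (a.conjTranspose i j) i j = star (∑ i, ∑ j, φ (a i j) i j) := by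
    rw [Finset.sum_comm]
    simp [Matrix.conjTranspose_apply, hφ.map_star]
  simp only [Matrix.add_apply, map_add, Finset.sum_add_distrib, e2] at h
  have := (Complex.nonneg_iff.1 h).1
  simp only [Complex.add_re, Complex.star_def, Complex.conj_re] at this
  linarith

/-- Matrix states extend along unital complete order embeddings. -/
lemma exists_CS_extension {A W : MOUS} {j : A.carrier →ₗ[ℂ] W.carrier} (hj : IsUCP A W j)
    (hinj : Function.Injective j)
    (hord : ∀ n (a : Matrix (Fin n) (Fin n) A.carrier), mapMat j a ∈ W.pos n → a ∈ A.pos n)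
    {n : ℕ} {φ : MState A n} (hφ : φ ∈ CS A n) : ∃ ψ ∈ CS W n, ψ.comp j = φ := by
  let J : Matrix (Fin n) (Fin n) A.carrier →ₗ[ℝ] Matrix (Fin n) (Fin n) W.carrier :=
    { toFun := mapMat j
      map_add' := fun a b => by ext p q; simp [mapMat]
      map_smul' := fun c a => by ext p q; simp [mapMat] }
  let h : Matrix (Fin n) (Fin n) A.carrier →ₗ[ℝ] ℝ :=
    { toFun := fun a => (∑ p, ∑ q, φ (a p q) p q).re
      map_add' := fun a b => by simp [Finset.sum_add_distrib]
      map_smul' := fun c a => by simp [Finset.mul_sum] }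
  obtain ⟨g, hg, hs⟩ := exists_nonneg_extension J
    (fun a b hab => by
      ext p q
      exact hinj (congrFun (congrFun hab p) q)) h (rePosCone W n)
    (fun a ha => re_sum_nonneg hφ.2 (hord n _ (by
      have ha' : mapMat j a + (mapMat j a).conjTranspose ∈ W.pos n := ha
      convert ha' using 1
      ext p q
      simp [mapMat, Matrix.conjTranspose_apply, hj.map_star])))
    (fun y => by
      obtain ⟨t, ht⟩ := exists_unit_add_mem_rePosCone y
      refine ⟨(t : ℂ) • A.unitMat n, ?_⟩
      convert ht using 2
      ext p q
      simp only [J, mapMat, MOUS.unitMat, LinearMap.coe_mk, AddHom.coe_mk, Matrix.of_apply,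
        Matrix.smul_apply, Matrix.diagonal_apply, map_smul]
      split_ifs <;> simp [hj.unital])
  obtain ⟨ψ, hψ, hre⟩ := exists_isCPMap_of_functional (fun w => g w) (fun a b => map_add g a b)
    (fun t a => by
      have e : (t : ℂ) • a = t • a := by ext p q; simp
      rw [e, map_smul, smul_eq_mul]) (fun w hw => hs w hw)
  have key : ψ.comp j = φ := by
    have re_eq : ∀ x p q, (ψ (j x) p q).re = (φ x p q).re := by
      intro x p q
      have h1 := hre (J (Matrix.single p q x))
      have h2 := hg (Matrix.single p q x)
      rw [h2] at h1
      have e : ∀ {B : MOUS} (θ : MState B n) (f : A.carrier →ₗ[ℂ] B.carrier),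
          ∑ i, ∑ k, θ (f (Matrix.single p q x i k)) i k = θ (f x) p q := by
        intro B θ f
        rw [Finset.sum_eq_single p, Finset.sum_eq_single q]
        · simp
        · intro b _ hb
          simp [Ne.symm hb]
        · simp
        · intro b _ hb
          simp [Ne.symm hb]
        · simp
      have e1 := e ψ j
      have e2 := e φ LinearMap.id
      simp only [LinearMap.id_apply] at e2
      rw [← e1, ← e2]
      exact h1
    ext x p q
    apply Complex.ext
    · exact re_eq x p q
    · have := re_eq (Complex.I • x) p q
      simpa using this
  refine ⟨ψ, ⟨?_, hψ⟩, key⟩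
  rw [← hj.unital, ← hφ.1, ← key]
  rfl

lemma one_ne_zero_of_not_mem {v : Matrix (Fin 1) (Fin 1) W.carrier}
    (hv : star (v 0 0) = v 0 0) (h : v ∉ W.pos 1) : W.one ≠ 0 := by
  intro h1
  obtain ⟨t, -, ht⟩ := W.orderUnit (-(v 0 0)) (by simp [hv])
  apply h
  convert ht using 1
  ext i k
  simp [Subsingleton.elim i 0, Subsingleton.elim k 0, h1]

/-- The states detect positivity. -/
lemma mem_pos_of_states {v : Matrix (Fin 1) (Fin 1) W.carrier} (hv : star (v 0 0) = v 0 0)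
    (h : ∀ s ∈ CS W 1, 0 ≤ (s (v 0 0) 0 0).re) : v ∈ W.pos 1 := by
  by_contra hmem
  have hone := one_ne_zero_of_not_mem hv hmem
  obtain ⟨t, ht, hnot⟩ : ∃ t : ℝ, 0 < t ∧ v + (t : ℂ) • W.unitMat 1 ∉ W.pos 1 := by
    by_contra! hcon
    exact hmem (W.archimedean 1 v hcon)
  set u := v + (t : ℂ) • W.unitMat 1 with hu
  have hvstar : v.conjTranspose = v := by
    ext i k
    simp [Subsingleton.elim i 0, Subsingleton.elim k 0, hv]
  have hustar : (W.unitMat 1).conjTranspose = W.unitMat 1 := W.pos_star _ _ (W.unit_pos 1)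
  have hus : u.conjTranspose = u := by
    rw [hu, Matrix.conjTranspose_add, Matrix.conjTranspose_smul, hvstar, hustar]
    simp
  have hunit : W.unitMat 1 ≠ 0 := by
    intro h0
    apply hone
    have := congrFun (congrFun h0 0) 0
    simpa [MOUS.unitMat] using this
  let s : PointedCone ℝ (Matrix (Fin 1) (Fin 1) W.carrier) :=
    { carrier := {w | ∃ l : ℝ, 0 ≤ l ∧ w + w.conjTranspose + (l : ℂ) • u ∈ W.pos 1}
      add_mem' := by
        rintro a b ⟨l, hl, ha⟩ ⟨m, hm, hb⟩
        refine ⟨l + m, add_nonneg hl hm, ?_⟩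
        convert W.pos_add 1 _ ha _ hb using 1
        rw [Matrix.conjTranspose_add]
        push_cast
        module
      zero_mem' := ⟨0, le_rfl, by simpa using W.zero_mem_pos 1⟩
      smul_mem' := by
        rintro ⟨c, hc⟩ a ⟨l, hl, ha⟩
        refine ⟨c * l, mul_nonneg hc hl, ?_⟩
        convert W.pos_smul 1 c hc _ ha using 1
        ext i k
        simp [Matrix.conjTranspose_apply, mul_smul] }
  let J : ℝ →ₗ[ℝ] Matrix (Fin 1) (Fin 1) W.carrier :=
    { toFun := fun α => (α : ℂ) • W.unitMat 1
      map_add' := fun a b => by push_cast; rw [add_smul]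
      map_smul' := fun a b => by ext; simp [mul_smul] }
  obtain ⟨g, hg, hs⟩ := exists_nonneg_extension J
    (fun a b hab => by
      have h1 : (a : ℂ) • W.unitMat 1 = (b : ℂ) • W.unitMat 1 := hab
      by_contra hne
      apply hunit
      have h2 : ((a : ℂ) - b) • W.unitMat 1 = 0 := by rw [sub_smul, h1, sub_self]
      refine (smul_eq_zero.1 h2).resolve_left ?_
      intro h3
      exact hne (by exact_mod_cast sub_eq_zero.1 h3)) LinearMap.id s
    (fun α hα => by
      obtain ⟨l, hl, hmem⟩ : ∃ l : ℝ, 0 ≤ l ∧ (α : ℂ) • W.unitMat 1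
        + ((α : ℂ) • W.unitMat 1).conjTranspose + (l : ℂ) • u ∈ W.pos 1 := hα
      rw [Matrix.conjTranspose_smul, hustar] at hmem
      by_contra! hneg
      have hneg' : α < 0 := hneg
      have h1 := W.pos_add 1 _ hmem _ (W.pos_smul 1 (-2 * α) (by linarith) _ (W.unit_pos 1))
      have e : (α : ℂ) • W.unitMat 1 + star (α : ℂ) • W.unitMat 1 + (l : ℂ) • u
          + ((-2 * α : ℝ) : ℂ) • (Matrix.diagonal fun _ => W.one) = (l : ℂ) • u := by
        simp only [Complex.star_def, Complex.conj_ofReal, MOUS.unitMat]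
        push_cast
        module
      rw [e] at h1
      rcases hl.eq_or_lt with rfl | hl
      · apply hunit
        refine W.proper _ (W.unit_pos 1) ?_
        have h2 := W.pos_smul 1 (-1 / (2 * α)) (div_nonneg_of_nonpos (by norm_num)
          (by linarith)) _ hmem
        convert h2 using 1
        simp only [Complex.star_def, Complex.conj_ofReal, Complex.ofReal_zero, zero_smul, add_zero]
        rw [← add_smul, smul_smul]
        have e3 : ((-1 / (2 * α) : ℝ) : ℂ) * ((α : ℂ) + α) = -1 := by
          have : (α : ℂ) ≠ 0 := by exact_mod_cast hneg'.ne
          push_cast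
          field_simp
          norm_num
        rw [e3, neg_one_smul]
      · apply hnot
        have h2 := W.pos_smul 1 l⁻¹ (inv_nonneg.2 hl.le) _ h1
        rwa [smul_smul, Complex.ofReal_inv, inv_mul_cancel₀ (by exact_mod_cast hl.ne'),
          one_smul] at h2)
    (fun y => by
      obtain ⟨t, ht⟩ := exists_unit_add_mem_rePosCone y
      refine ⟨t, 0, le_rfl, ?_⟩
      have ht' : _ + _ ∈ W.pos 1 := ht
      simpa [J] using ht')
  obtain ⟨ψ, hψ, hre⟩ := exists_isCPMap_of_functional (fun w => g w) (fun a b => map_add g a b)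
    (fun t a => by
      have e : (t : ℂ) • a = t • a := by ext p q; simp
      rw [e, map_smul, smul_eq_mul])
    (fun w hw => hs w ⟨0, le_rfl, by simpa using hw⟩)
  simp only [Finset.univ_unique, Finset.sum_singleton] at hre
  have h1 : g (W.unitMat 1) = 1 := by
    have := hg 1
    simpa [J] using this
  have hψ1 : ψ W.one = 1 := by
    obtain ⟨-, him⟩ := hψ.one_apply_nonneg
    have h2 := hre (W.unitMat 1)
    rw [h1] at h2
    ext i k
    rw [Subsingleton.elim i 0, Subsingleton.elim k 0]
    apply Complex.ext
    · simpa [MOUS.unitMat] using h2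
    · simpa using him
  have h3 := h ψ ⟨hψ1, hψ⟩
  have h4 : 0 ≤ g (-u) := by
    refine hs _ ⟨2, by norm_num, ?_⟩
    rw [Matrix.conjTranspose_neg, hus]
    convert W.zero_mem_pos 1 using 1
    push_cast
    module
  have e5 : (t : ℂ) • W.unitMat 1 = t • W.unitMat 1 := by ext p q; simp
  rw [map_neg, hu, map_add, e5, map_smul, h1, smul_eq_mul, mul_one] at h4
  have h5 := hre v
  have h6 : (ψ (v 0 0) 0 0).re = g v := h5
  linarith

/-- The states separate points. -/
lemma eq_zero_of_states {x : W.carrier} (h : ∀ s ∈ CS W 1, s x 0 0 = 0) : x = 0 := by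
  obtain ⟨u, v, hu, hv, rfl⟩ := MOUS.exists_star_decomp x
  have real : ∀ s ∈ CS W 1, ∀ w : W.carrier, star w = w → (s w 0 0).im = 0 := by
    intro s hs w hw
    have := congrFun (congrFun (IsCPMap.map_star hs.2 w) 0) 0
    rw [hw, Matrix.conjTranspose_apply] at this
    have := congrArg Complex.im this
    simp at this
    linarith
  have key : ∀ w : W.carrier, star w = w → (∀ s ∈ CS W 1, (s w 0 0).re = 0) → w = 0 := by
    intro w hw hs
    have h1 := mem_pos_of_states (v := Matrix.of fun _ _ => w) hw (fun s h => (hs s h).ge)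
    have h2 := mem_pos_of_states (v := -Matrix.of fun _ _ => w) (by simp [hw])
      (fun s h => by simp [hs s h])
    exact congrFun (congrFun (W.proper _ h1 h2) 0) 0
  have h0 : ∀ s ∈ CS W 1, (s u 0 0).re = 0 ∧ (s v 0 0).re = 0 := by
    intro s hs
    have h1 := h s hs
    have hu' := real s hs u hu
    have hv' := real s hs v hv
    simp only [map_add, map_smul, Matrix.add_apply, Matrix.smul_apply, smul_eq_mul] at h1
    have a1 := congrArg Complex.re h1
    have a2 := congrArg Complex.im h1
    simp [hu', hv'] at a1 a2
    exact ⟨a1, a2⟩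
  simp [key u hu fun s hs => (h0 s hs).1, key v hv fun s hs => (h0 s hs).2]

end Extension

section MatrixMetric

variable {A : MOUS} {L : ∀ n : ℕ, Matrix (Fin n) (Fin n) A.carrier → ℝ} {n : ℕ}

/-- The values whose supremum defines the matrix metric. -/
def DmetSet (A : MOUS) (L : ∀ n : ℕ, Matrix (Fin n) (Fin n) A.carrier → ℝ) (n : ℕ)
    (φ ψ : MState A n) : Set ℝ :=
  {x | ∃ (r : ℕ) (a : Matrix (Fin r) (Fin r) A.carrier), L r a ≤ 1 ∧
    x = scalarOpNorm (mpair φ a - mpair ψ a)}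

/-- Finiteness of the matrix metric. -/
def FinD (A : MOUS) (L : ∀ n : ℕ, Matrix (Fin n) (Fin n) A.carrier → ℝ) : Prop :=
  ∀ n, ∀ φ ∈ CS A n, ∀ ψ ∈ CS A n, BddAbove (DmetSet A L n φ ψ)

lemma Dmet_nonneg (φ ψ : MState A n) : 0 ≤ Dmet A L n φ ψ := by
  refine Real.sSup_nonneg ?_
  rintro _ ⟨r, a, -, rfl⟩
  exact scalarOpNorm_nonneg _

lemma Dmet_le {φ ψ : MState A n} {c : ℝ} (hc : 0 ≤ c)
    (h : ∀ r (a : Matrix (Fin r) (Fin r) A.carrier), L r a ≤ 1 →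
      scalarOpNorm (mpair φ a - mpair ψ a) ≤ c) : Dmet A L n φ ψ ≤ c := by
  refine Real.sSup_le ?_ hc
  rintro _ ⟨r, a, ha, rfl⟩
  exact h r a ha

lemma Dmet_self (φ : MState A n) : Dmet A L n φ φ = 0 :=
  le_antisymm (Dmet_le le_rfl fun r a _ => by rw [sub_self, scalarOpNorm_zero]) (Dmet_nonneg _ _)

/-- Estimates on the unit ball of a seminorm scale. -/
lemma le_mul_of_unit_ball {E : Type*} [AddCommGroup E] [Module ℂ E] {p q : E → ℝ}
    (hp : ∀ x, 0 ≤ p x) (hps : ∀ (c : ℂ) x, p (c • x) = ‖c‖ * p x)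
    (hqs : ∀ (c : ℂ) x, q (c • x) = ‖c‖ * q x) {d : ℝ}
    (h : ∀ x, p x ≤ 1 → q x ≤ d) (x : E) : q x ≤ d * p x := by
  refine le_of_forall_pos_le_add fun δ hδ => ?_
  have hd : 0 ≤ d := by
    have h0 : p (0 : E) = 0 := by simpa using hps 0 0
    have h1 : q (0 : E) = 0 := by simpa using hqs 0 0
    have := h 0 (by rw [h0]; exact zero_le_one)
    rwa [h1] at this
  set η := δ / (d + 1) with hη
  have hηpos : 0 < η := by positivity
  have hx : 0 < p x + η := add_pos_of_nonneg_of_pos (hp x) hηpos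
  have hn : ‖(((p x + η)⁻¹ : ℝ) : ℂ)‖ = (p x + η)⁻¹ := by
    rw [Complex.norm_real, Real.norm_of_nonneg (inv_nonneg.2 hx.le)]
  have h1 := h ((((p x + η)⁻¹ : ℝ) : ℂ) • x) (by
    rw [hps, hn, inv_mul_le_iff₀ hx]; linarith)
  rw [hqs, hn, inv_mul_le_iff₀ hx] at h1
  have h2 : d * η ≤ δ := by
    rw [hη, mul_div_assoc', div_le_iff₀ (by positivity)]
    nlinarith
  nlinarith

lemma scalarOpNorm_le_Dmet_mul (hK : IsMatrixLipschitzSeminorm A L) (hfin : FinD A L)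
    {φ ψ : MState A n} (hφ : φ ∈ CS A n) (hψ : ψ ∈ CS A n) {r : ℕ} (a : Matrix (Fin r) (Fin r) A.carrier) :
    scalarOpNorm (mpair φ a - mpair ψ a) ≤ Dmet A L n φ ψ * L r a := by
  refine le_mul_of_unit_ball (p := L r) (q := fun a => scalarOpNorm (mpair φ a - mpair ψ a))
    (hK.nonneg r) (hK.smul_eq r) (fun c x => ?_) (fun x hx => ?_) a
  · rw [mpair_smul, mpair_smul, ← smul_sub, scalarOpNorm_smul]
  · exact le_csSup (hfin n φ hφ ψ hψ) ⟨r, x, hx, rfl⟩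

lemma scalarOpNorm_le_Dmet (hfin : FinD A L) {φ ψ : MState A n} (hφ : φ ∈ CS A n)
    (hψ : ψ ∈ CS A n) {r : ℕ} {a : Matrix (Fin r) (Fin r) A.carrier} (ha : L r a ≤ 1) :
    scalarOpNorm (mpair φ a - mpair ψ a) ≤ Dmet A L n φ ψ :=
  le_csSup (hfin n φ hφ ψ hψ) ⟨r, a, ha, rfl⟩

lemma Dmet_triangle (hfin : FinD A L) {φ ψ χ : MState A n} (hφ : φ ∈ CS A n)
    (hψ : ψ ∈ CS A n) (hχ : χ ∈ CS A n) :
    Dmet A L n φ χ ≤ Dmet A L n φ ψ + Dmet A L n ψ χ := by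
  refine Dmet_le (add_nonneg (Dmet_nonneg _ _) (Dmet_nonneg _ _)) fun r a ha => ?_
  have e : mpair φ a - mpair χ a = (mpair φ a - mpair ψ a) + (mpair ψ a - mpair χ a) := by abel
  rw [e]
  exact (scalarOpNorm_add_le _ _).trans (add_le_add (scalarOpNorm_le_Dmet hfin hφ hψ ha)
    (scalarOpNorm_le_Dmet hfin hψ hχ ha))

/-- The order unit matrix `[x]` of size one. -/
abbrev MOUS.single {A : MOUS} (x : A.carrier) : Matrix (Fin 1) (Fin 1) A.carrier :=
  Matrix.of fun _ _ => x

lemma norm_apply_sub_le (hK : IsMatrixLipschitzSeminorm A L) (hfin : FinD A L)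
    {φ ψ : MState A n} (hφ : φ ∈ CS A n) (hψ : ψ ∈ CS A n) (x : A.carrier) (i j : Fin n) :
    ‖φ x i j - ψ x i j‖ ≤ Dmet A L n φ ψ * L 1 (MOUS.single x) := by
  have h := scalarOpNorm_le_Dmet_mul hK hfin hφ hψ (MOUS.single x)
  rw [← mpair_sub_left] at h
  exact (norm_apply_le_scalarOpNorm_mpair (φ - ψ) (MOUS.single x) 0 0 i j).trans h

lemma Dmet_eq_zero (hK : IsMatrixLipschitzSeminorm A L) (hfin : FinD A L)
    {φ ψ : MState A n} (hφ : φ ∈ CS A n) (hψ : ψ ∈ CS A n) (h : Dmet A L n φ ψ = 0) : φ = ψ := by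
  ext x i j
  have := norm_apply_sub_le hK hfin hφ hψ x i j
  rw [h, zero_mul] at this
  exact sub_eq_zero.1 (norm_eq_zero.1 (le_antisymm this (norm_nonneg _)))

lemma continuous_eval_BWtop (x : A.carrier) :
    @Continuous _ _ (BWtop A n) _ (fun φ : {φ : MState A n // φ ∈ CS A n} => φ.1 x) := by
  let := BWtop A n
  let := lmTop A n
  have h1 : Continuous (Subtype.val : {φ : MState A n // φ ∈ CS A n} → MState A n) :=
    continuous_induced_dom
  have h2 : Continuous (fun φ : MState A n => (φ : A.carrier → Matrix (Fin n) (Fin n) ℂ)) :=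
    continuous_induced_dom
  exact (continuous_apply x).comp (h2.comp h1)

lemma segment_mem_CS {φ ψ : MState A n} (hφ : φ ∈ CS A n) (hψ : ψ ∈ CS A n) {t : ℝ}
    (ht : t ∈ Set.Icc (0 : ℝ) 1) :
    ((1 - t : ℝ) : ℂ) • φ + (t : ℂ) • ψ ∈ CS A n := by
  refine ⟨?_, (IsCPMap.smul hφ.2 (by linarith [ht.2])).add (IsCPMap.smul hψ.2 ht.1)⟩
  rw [LinearMap.add_apply, LinearMap.smul_apply, LinearMap.smul_apply, hφ.1, hψ.1, ← add_smul]
  simp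

/-- The matrix metric of a matrix Lip-norm is finite. -/
lemma IsMatrixLipNorm.finD (hL : IsMatrixLipNorm A L) : FinD A L := by
  intro n φ hφ ψ hψ
  by_contra hunb
  have hne : ∃ x i j, φ x i j ≠ ψ x i j := by
    by_contra! hcon
    have : φ = ψ := by ext x i j; exact hcon x i j
    apply hunb
    refine ⟨0, ?_⟩
    rintro _ ⟨r, a, -, rfl⟩
    rw [this, sub_self, scalarOpNorm_zero]
  obtain ⟨x, i, j, hx⟩ := hne
  let γ : ℝ → MState A n := fun t => ((1 - t : ℝ) : ℂ) • φ + (t : ℂ) • ψ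
  have hγ : ∀ s t r (a : Matrix (Fin r) (Fin r) A.carrier), scalarOpNorm (mpair (γ s) a -
      mpair (γ t) a) = |t - s| * scalarOpNorm (mpair φ a - mpair ψ a) := by
    intro s t r a
    have e : mpair (γ s) a - mpair (γ t) a = ((t - s : ℝ) : ℂ) • (mpair φ a - mpair ψ a) := by
      simp only [γ, mpair_add_left, mpair_smul_left]
      push_cast
      module
    rw [e, scalarOpNorm_smul, Complex.norm_real, Real.norm_eq_abs]
  have hseg : ∀ s t, s ≠ t → ∀ χ : MState A n, BddAbove (DmetSet A L n χ (γ s)) →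
      ¬ BddAbove (DmetSet A L n χ (γ t)) := by
    rintro s t hst χ ⟨B, hB⟩ ⟨C, hC⟩
    have hpos : 0 < |t - s| := abs_pos.2 (sub_ne_zero.2 hst.symm)
    apply hunb
    refine ⟨(B + C) / |t - s|, ?_⟩
    rintro _ ⟨r, a, ha, rfl⟩
    rw [le_div_iff₀ hpos, mul_comm, ← hγ]
    have e : mpair (γ s) a - mpair (γ t) a = -(mpair χ a - mpair (γ s) a)
      + (mpair χ a - mpair (γ t) a) := by abel
    rw [e]
    refine (scalarOpNorm_add_le _ _).trans ?_
    rw [scalarOpNorm_neg]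
    exact add_le_add (hB ⟨r, a, ha, rfl⟩) (hC ⟨r, a, ha, rfl⟩)
  let Γ : CofiniteTopology (Set.Icc (0 : ℝ) 1) → {φ : MState A n // φ ∈ CS A n} :=
    fun t => ⟨γ ((CofiniteTopology.of.symm t : Set.Icc (0 : ℝ) 1) : ℝ),
      segment_mem_CS hφ hψ (CofiniteTopology.of.symm t : Set.Icc (0 : ℝ) 1).2⟩
  have hΓ : @Continuous _ _ _ (Dtop A L n) Γ := by
    refine continuous_generateFrom_iff.2 ?_
    rintro _ ⟨χ, ε, hε, rfl⟩
    rw [CofiniteTopology.isOpen_iff']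
    right
    refine Set.Subsingleton.finite ?_
    have key : ∀ s : CofiniteTopology (Set.Icc (0 : ℝ) 1),
        s ∈ (Γ ⁻¹' {ψ | Dmet A L n χ.1 ψ.1 < ε})ᶜ → BddAbove (DmetSet A L n χ.1 (Γ s).1) := by
      intro s hs
      by_contra hnb
      apply hs
      show sSup (DmetSet A L n χ.1 (Γ s).1) < ε
      rw [Real.sSup_of_not_bddAbove hnb]
      exact hε
    intro s hs t ht
    by_contra hst
    refine hseg _ _ ?_ χ.1 (key s hs) (key t ht)
    intro h
    exact hst (CofiniteTopology.of.symm.injective (Subtype.ext h))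
  rw [hL.top_eq] at hΓ
  have hc : Continuous fun t => (Γ t).1 x i j := by
    have h1 : Continuous fun M : Matrix (Fin n) (Fin n) ℂ => M i j :=
      (continuous_apply j).comp (continuous_apply i)
    exact h1.comp (@Continuous.comp _ _ _ _ (BWtop A n) _ _ _ (continuous_eval_BWtop x) hΓ)
  obtain ⟨U, V, hU, hV, hxU, hxV, hUV⟩ := t2_separation hx
  have hU' := CofiniteTopology.isOpen_iff'.1 (hU.preimage hc)
  have hV' := CofiniteTopology.isOpen_iff'.1 (hV.preimage hc)
  have m0 : (CofiniteTopology.of (⟨0, by simp⟩ : Set.Icc (0 : ℝ) 1)) ∈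
      (fun t => (Γ t).1 x i j) ⁻¹' U := by
    have : φ x i j ∈ U := hxU
    simpa [Γ, γ] using this
  have m1 : (CofiniteTopology.of (⟨1, by simp⟩ : Set.Icc (0 : ℝ) 1)) ∈
      (fun t => (Γ t).1 x i j) ⁻¹' V := by
    have : ψ x i j ∈ V := hxV
    simpa [Γ, γ] using this
  have f0 := hU'.resolve_left (Set.nonempty_iff_ne_empty.1 ⟨_, m0⟩)
  have f1 := hV'.resolve_left (Set.nonempty_iff_ne_empty.1 ⟨_, m1⟩)
  have huniv : (Set.univ : Set (CofiniteTopology (Set.Icc (0 : ℝ) 1))).Finite := by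
    refine (f0.union f1).subset fun t _ => ?_
    by_contra hcon
    simp only [Set.mem_union, Set.mem_compl_iff, not_or, not_not] at hcon
    exact Set.disjoint_left.1 hUV hcon.1 hcon.2
  have hinf : (Set.Icc (0 : ℝ) 1).Infinite := Set.Icc_infinite zero_lt_one
  have hinf' : Infinite (Set.Icc (0 : ℝ) 1) := hinf.to_subtype
  have : Infinite (CofiniteTopology (Set.Icc (0 : ℝ) 1)) :=
    Infinite.of_injective CofiniteTopology.of CofiniteTopology.of.injective
  exact Set.infinite_univ huniv

end MatrixMetric

section Compactness

variable {A : MOUS} {L : ∀ n : ℕ, Matrix (Fin n) (Fin n) A.carrier → ℝ} {n : ℕ}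

lemma continuous_bilin_of {r : ℕ} (v : Matrix (Fin r) (Fin r) A.carrier)
    (y x : Fin r × Fin n → ℂ) :
    Continuous fun f : A.carrier → Matrix (Fin n) (Fin n) ℂ =>
      bilin (Matrix.of fun p q : Fin r × Fin n => f (v p.1 q.1) p.2 q.2) y x := by
  unfold bilin
  refine continuous_finsetSum _ fun p _ => continuous_finsetSum _ fun q _ => ?_
  have h : Continuous fun f : A.carrier → Matrix (Fin n) (Fin n) ℂ =>
      f (v p.1 q.1) p.2 q.2 :=
    (continuous_apply q.2).comp ((continuous_apply p.2).comp (continuous_apply (v p.1 q.1)))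
  simp only [Matrix.of_apply]
  fun_prop

/-- The matrix state spaces are compact in the BW-topology. -/
lemma compactSpace_CS : @CompactSpace {φ : MState A n // φ ∈ CS A n} (BWtop A n) := by
  let _ := BWtop A n
  choose C hC0 hC using fun x : A.carrier => exists_bound_CS x
  let e : {φ : MState A n // φ ∈ CS A n} → A.carrier → Matrix (Fin n) (Fin n) ℂ := fun φ x => φ.1 x
  have he : Topology.IsInducing e := ⟨induced_compose⟩
  refine ⟨he.isCompact_iff.2 ?_⟩
  rw [Set.image_univ]
  let K : Set (A.carrier → Matrix (Fin n) (Fin n) ℂ) :=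
    Set.pi Set.univ fun x => Set.pi Set.univ fun _ => Set.pi Set.univ fun _ =>
      Metric.closedBall (0 : ℂ) (C x)
  have hK : IsCompact K := isCompact_univ_pi fun x => isCompact_univ_pi fun _ =>
    isCompact_univ_pi fun _ => isCompact_closedBall _ _
  let Z₁ : Set (A.carrier → Matrix (Fin n) (Fin n) ℂ) := {f | ∀ x y, f (x + y) = f x + f y}
  let Z₂ : Set (A.carrier → Matrix (Fin n) (Fin n) ℂ) := {f | ∀ (c : ℂ) x, f (c • x) = c • f x}
  let Z₃ : Set (A.carrier → Matrix (Fin n) (Fin n) ℂ) := {f | f A.one = 1}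
  let Z₄ : Set (A.carrier → Matrix (Fin n) (Fin n) ℂ) :=
    {f | ∀ r, ∀ v ∈ A.pos r, ∀ ξ : Fin r × Fin n → ℂ,
        0 ≤ bilin (Matrix.of fun p q : Fin r × Fin n => f (v p.1 q.1) p.2 q.2) (star ξ) ξ}
  have hZ₁ : IsClosed Z₁ := by
    simp only [Z₁, Set.ofPred_forall]
    exact isClosed_iInter fun x => isClosed_iInter fun y => isClosed_eq (continuous_apply _)
      ((continuous_apply x).add (continuous_apply y))
  have hZ₂ : IsClosed Z₂ := by
    simp only [Z₂, Set.ofPred_forall]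
    exact isClosed_iInter fun c => isClosed_iInter fun y => isClosed_eq (continuous_apply _)
      ((continuous_apply y).const_smul c)
  have hZ₃ : IsClosed Z₃ := isClosed_eq (continuous_apply _) continuous_const
  have hZ₄ : IsClosed Z₄ := by
    simp only [Z₄, Set.ofPred_forall]
    exact isClosed_iInter fun r => isClosed_iInter fun v => isClosed_iInter fun _ =>
      isClosed_iInter fun ξ => isClosed_le continuous_const (continuous_bilin_of v _ _)
  have hr : Set.range e = K ∩ (Z₁ ∩ (Z₂ ∩ (Z₃ ∩ Z₄))) := by
    ext f
    constructor
    · rintro ⟨φ, rfl⟩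
      refine ⟨fun x _ i _ j _ => ?_, fun x y => map_add _ _ _, fun c x => map_smul _ _ _,
        φ.2.1, fun r v hv ξ => posSemidef_iff_bilin.1 (φ.2.2 r v hv) ξ⟩
      rw [mem_closedBall_zero_iff]
      exact (norm_apply_le_scalarOpNorm (φ.1 x) i j).trans (hC x n φ.1 φ.2)
    · rintro ⟨-, hadd, hsmul, h1, hpos⟩
      exact ⟨⟨{ toFun := f, map_add' := hadd, map_smul' := hsmul },
        h1, fun r v hv => posSemidef_iff_bilin.2 fun ξ => hpos r v hv ξ⟩, rfl⟩
  rw [hr]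
  exact hK.inter_right (hZ₁.inter (hZ₂.inter (hZ₃.inter hZ₄)))

/-- Matrix states admit finite nets for the metric of a matrix Lip-norm. -/
lemma IsMatrixLipNorm.exists_finite_net (hL : IsMatrixLipNorm A L) (n : ℕ) {ε : ℝ} (hε : 0 < ε) :
    ∃ F : Finset (MState A n), (∀ s ∈ F, s ∈ CS A n) ∧
      ∀ φ ∈ CS A n, ∃ s ∈ F, Dmet A L n s φ < ε := by
  classical
  have hcomp : @CompactSpace {φ : MState A n // φ ∈ CS A n} (BWtop A n) := compactSpace_CS
  rw [← hL.top_eq] at hcomp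
  let _ := Dtop A L n
  obtain ⟨t, ht⟩ := (isCompact_univ (X := {φ : MState A n // φ ∈ CS A n})).elim_finite_subcover
    (fun φ₀ : {φ : MState A n // φ ∈ CS A n} => {ψ | Dmet A L n φ₀.1 ψ.1 < ε})
    (fun φ₀ => TopologicalSpace.isOpen_generateFrom_of_mem ⟨φ₀, ε, hε, rfl⟩)
    (fun φ _ => Set.mem_iUnion.2 ⟨φ, by
      show Dmet A L n φ.1 φ.1 < ε
      rw [Dmet_self]; exact hε⟩)
  refine ⟨t.image Subtype.val, ?_, fun φ hφ => ?_⟩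
  · intro s hs
    obtain ⟨s', -, rfl⟩ := Finset.mem_image.1 hs
    exact s'.2
  · obtain ⟨s, hs, h⟩ := Set.mem_iUnion₂.1 (ht (Set.mem_univ ⟨φ, hφ⟩))
    exact ⟨s.1, Finset.mem_image_of_mem _ hs, h⟩

end Compactness

section Criterion

variable {A : MOUS} {K L : ∀ n : ℕ, Matrix (Fin n) (Fin n) A.carrier → ℝ} {n : ℕ}

lemma scalarOpNorm_row_sq_le (y : Fin n → ℂ) :
    scalarOpNorm (Matrix.of fun (_ : Fin 1) i => y i) ^ 2 ≤ normSum y := by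
  refine (scalarOpNorm_sq_le_sum _).trans ?_
  rw [Fin.sum_univ_one]
  rfl

lemma scalarOpNorm_col_sq_le (x : Fin n → ℂ) :
    scalarOpNorm (Matrix.of fun i (_ : Fin 1) => x i) ^ 2 ≤ normSum x := by
  refine (scalarOpNorm_sq_le_sum _).trans (le_of_eq ?_)
  refine Finset.sum_congr rfl fun i _ => ?_
  show ∑ _j : Fin 1, _ = _
  rw [Fin.sum_univ_one]
  rfl

/-- Entrywise Lipschitz bounds for a linear map control its matrix pairings. -/
lemma scalarOpNorm_mpair_le_of_entries (hK : IsMatrixLipschitzSeminorm A K) {k : ℕ}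
    {θ : MState A k} {η : ℝ} (hη : 0 ≤ η)
    (h : ∀ c i j, ‖θ c i j‖ ≤ η * K 1 (MOUS.single c)) {r : ℕ}
    (a : Matrix (Fin r) (Fin r) A.carrier) :
    scalarOpNorm (mpair θ a) ≤ k * η * K r a := by
  have hKa := hK.nonneg r a
  refine scalarOpNorm_le_of_norm_bilin_sq_le (by positivity) fun y x => ?_
  set Y : Fin k → ℝ := fun i => scalarOpNorm (Matrix.of fun (_ : Fin 1) p => y (p, i)) with hY
  set X : Fin k → ℝ := fun j => scalarOpNorm (Matrix.of fun q (_ : Fin 1) => x (q, j)) with hX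
  have hY0 : ∀ i, 0 ≤ Y i := fun i => scalarOpNorm_nonneg _
  have hX0 : ∀ i, 0 ≤ X i := fun i => scalarOpNorm_nonneg _
  have hb : ‖bilin (mpair θ a) y x‖ ≤ η * K r a * ((∑ i, Y i) * ∑ j, X j) := by
    rw [bilin_mpair_eq_sum_compress, Finset.sum_mul_sum, Finset.mul_sum]
    refine (norm_sum_le _ _).trans (Finset.sum_le_sum fun i _ => ?_)
    rw [Finset.mul_sum]
    refine (norm_sum_le _ _).trans (Finset.sum_le_sum fun j _ => ?_)
    refine (h _ i j).trans ?_
    have e : MOUS.single (compress (fun p => y (p, i)) a (fun q => x (q, j)) 0 0) =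
        compress (fun p => y (p, i)) a (fun q => x (q, j)) := by
      ext u v
      rw [Subsingleton.elim u 0, Subsingleton.elim v 0]
      rfl
    rw [e, mul_assoc]
    refine mul_le_mul_of_nonneg_left ?_ hη
    refine (hK.mmul_le r 1 _ _ _).trans (le_of_eq ?_)
    ring
  have hYs : (∑ i, Y i) ^ 2 ≤ k * normSum y := by
    have h1 := sq_sum_le_card_mul_sum_sq (s := (Finset.univ : Finset (Fin k))) (f := Y)
    rw [Finset.card_univ, Fintype.card_fin] at h1
    rw [normSum_prod' y]
    exact h1.trans (mul_le_mul_of_nonneg_left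
      (Finset.sum_le_sum fun i _ => scalarOpNorm_row_sq_le _) (Nat.cast_nonneg k))
  have hXs : (∑ i, X i) ^ 2 ≤ k * normSum x := by
    have h1 := sq_sum_le_card_mul_sum_sq (s := (Finset.univ : Finset (Fin k))) (f := X)
    rw [Finset.card_univ, Fintype.card_fin] at h1
    rw [normSum_prod' x]
    exact h1.trans (mul_le_mul_of_nonneg_left
      (Finset.sum_le_sum fun i _ => scalarOpNorm_col_sq_le _) (Nat.cast_nonneg k))
  calc ‖bilin (mpair θ a) y x‖ ^ 2 ≤ (η * K r a * ((∑ i, Y i) * ∑ j, X j)) ^ 2 := by gcongr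
    _ = (η * K r a) ^ 2 * ((∑ i, Y i) ^ 2 * (∑ j, X j) ^ 2) := by ring
    _ ≤ (η * K r a) ^ 2 * ((k * normSum y) * (k * normSum x)) := by
        have := normSum_nonneg y
        gcongr
    _ = (k * η * K r a) ^ 2 * (normSum y * normSum x) := by ring

/-- A finite set approximates, modulo scalars, the Lipschitz ball up to `ε`. -/
def IsLipNet (A : MOUS) (K : ∀ n : ℕ, Matrix (Fin n) (Fin n) A.carrier → ℝ) (ε : ℝ)
    (Φ : Set A.carrier) : Prop :=
  Φ.Finite ∧ ∀ c, K 1 (MOUS.single c) ≤ 1 → ∃ c₀ ∈ Φ, ∃ l : ℂ, ∀ s ∈ CS A 1,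
    ‖s (c - c₀ - l • A.one) 0 0‖ ≤ ε

lemma IsLipNet.scalarOpNorm_le (hK : IsMatrixLipschitzSeminorm A K) {ε : ℝ} (hε : 0 ≤ ε)
    {Φ : Set A.carrier} (hΦ : IsLipNet A K ε Φ) {φ ψ : MState A n} (hφ : φ ∈ CS A n)
    (hψ : ψ ∈ CS A n) {δ : ℝ} (hδ : 0 ≤ δ) (h : ∀ c ∈ Φ, scalarOpNorm (φ c - ψ c) ≤ δ)
    {r : ℕ} {a : Matrix (Fin r) (Fin r) A.carrier} (ha : K r a ≤ 1) :
    scalarOpNorm (mpair φ a - mpair ψ a) ≤ n * (δ + 4 * ε) := by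
  have key : ∀ c i j, ‖(φ - ψ) c i j‖ ≤ (δ + 4 * ε) * K 1 (MOUS.single c) := by
    intro c i j
    refine le_mul_of_unit_ball (p := fun c => K 1 (MOUS.single c))
      (q := fun c => ‖(φ - ψ) c i j‖) (fun x => hK.nonneg _ _) (fun t x => hK.smul_eq 1 t _)
      (fun t x => ?_) (fun x hx => ?_) c
    · rw [map_smul, Matrix.smul_apply, smul_eq_mul, norm_mul]
    · obtain ⟨c₀, hc₀, l, hl⟩ := hΦ.2 x hx
      refine (norm_apply_le_scalarOpNorm _ i j).trans ?_
      have e : (φ - ψ) x = (φ c₀ - ψ c₀) + (φ (x - c₀ - l • A.one) - ψ (x - c₀ - l • A.one)) := by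
        simp only [LinearMap.sub_apply, map_sub, map_smul, hφ.1, hψ.1]
        abel
      rw [e]
      have h1 := scalarOpNorm_apply_le_of_states hφ hε hl
      have h2 := scalarOpNorm_apply_le_of_states hψ hε hl
      have h3 := scalarOpNorm_add_le (φ (x - c₀ - l • A.one)) (-ψ (x - c₀ - l • A.one))
      rw [scalarOpNorm_neg, ← sub_eq_add_neg] at h3
      have h4 := scalarOpNorm_add_le (φ c₀ - ψ c₀)
        (φ (x - c₀ - l • A.one) - ψ (x - c₀ - l • A.one))
      linarith [h c₀ hc₀]
  have h1 := scalarOpNorm_mpair_le_of_entries hK (by positivity) key a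
  rw [mpair_sub_left] at h1
  refine h1.trans (mul_le_of_le_one_right (by positivity) ha)

lemma finD_of_lipNet (hK : IsMatrixLipschitzSeminorm A K)
    (h : ∀ ε > 0, ∃ Φ, IsLipNet A K ε Φ) : FinD A K := by
  intro n φ hφ ψ hψ
  obtain ⟨Φ, hΦ⟩ := h 1 one_pos
  obtain ⟨δ, hδ⟩ := (hΦ.1.image fun c => scalarOpNorm (φ c - ψ c)).bddAbove
  refine ⟨n * (max δ 0 + 4 * 1), ?_⟩
  rintro _ ⟨r, a, ha, rfl⟩
  exact hΦ.scalarOpNorm_le hK zero_le_one hφ hψ (le_max_right _ _)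
    (fun c hc => (hδ ⟨c, hc, rfl⟩).trans (le_max_left _ _)) ha

lemma continuous_eval_Dtop (hK : IsMatrixLipschitzSeminorm A K) (hfin : FinD A K) (x : A.carrier)
    (i j : Fin n) :
    @Continuous _ _ (Dtop A K n) _ (fun φ : {φ : MState A n // φ ∈ CS A n} => φ.1 x i j) := by
  let _ := Dtop A K n
  rw [continuous_iff_continuousAt]
  intro φ
  rw [ContinuousAt, Metric.tendsto_nhds]
  intro ε hε
  have hx := hK.nonneg 1 (MOUS.single x)
  have hε' : 0 < ε / (K 1 (MOUS.single x) + 1) := by positivity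
  have hopen : IsOpen {ψ : {φ : MState A n // φ ∈ CS A n} |
      Dmet A K n φ.1 ψ.1 < ε / (K 1 (MOUS.single x) + 1)} :=
    TopologicalSpace.isOpen_generateFrom_of_mem ⟨φ, _, hε', rfl⟩
  filter_upwards [hopen.mem_nhds (show Dmet A K n φ.1 φ.1 < _ by rw [Dmet_self]; exact hε')]
    with ψ hψ
  have hψ' : Dmet A K n φ.1 ψ.1 < ε / (K 1 (MOUS.single x) + 1) := hψ
  rw [dist_comm, dist_eq_norm]
  refine (norm_apply_sub_le hK hfin φ.2 ψ.2 x i j).trans_lt ?_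
  rw [lt_div_iff₀ (by positivity)] at hψ'
  have := Dmet_nonneg (A := A) (L := K) φ.1 ψ.1
  nlinarith

/-- A matrix Lipschitz seminorm with finite nets of its unit ball modulo scalars is a matrix
Lip-norm. -/
theorem isMatrixLipNorm_of_lipNet (hK : IsMatrixLipschitzSeminorm A K)
    (h : ∀ ε > 0, ∃ Φ, IsLipNet A K ε Φ) : IsMatrixLipNorm A K := by
  have hfin := finD_of_lipNet hK h
  refine ⟨hK, fun n => le_antisymm ?_ ?_⟩
  · have hc : @Continuous _ _ (Dtop A K n) _
        (fun (φ : {φ : MState A n // φ ∈ CS A n}) (x : A.carrier) => φ.1 x) := by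
      let _ := Dtop A K n
      exact continuous_pi fun x => continuous_pi fun i => continuous_pi fun j =>
        continuous_eval_Dtop hK hfin x i j
    have := continuous_iff_le_induced.1 hc
    rw [BWtop, lmTop, induced_compose]
    exact this
  · refine le_generateFrom ?_
    rintro _ ⟨φ₀, ε, hε, rfl⟩
    let _ := BWtop A n
    rw [isOpen_iff_mem_nhds]
    intro ψ hψ
    have hψ' : Dmet A K n φ₀.1 ψ.1 < ε := hψ
    set g := ε - Dmet A K n φ₀.1 ψ.1 with hg
    have hgpos : 0 < g := sub_pos.2 hψ'
    set δ := g / (5 * (n + 1)) with hδ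
    have hδpos : 0 < δ := by positivity
    obtain ⟨Φ, hΦ⟩ := h δ hδpos
    have hnhds : ∀ᶠ χ in nhds ψ, ∀ c ∈ Φ, scalarOpNorm (ψ.1 c - χ.1 c) < δ := by
      rw [Filter.eventually_all_finite hΦ.1]
      intro c _
      have hcont : Continuous fun χ : {φ : MState A n // φ ∈ CS A n} =>
          scalarOpNorm (ψ.1 c - χ.1 c) :=
        continuous_scalarOpNorm.comp (continuous_const.sub (continuous_eval_BWtop c))
      refine hcont.continuousAt.eventually_lt continuousAt_const ?_
      rw [sub_self, scalarOpNorm_zero]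
      exact hδpos
    filter_upwards [hnhds] with χ hχ
    show Dmet A K n φ₀.1 χ.1 < ε
    have h1 : Dmet A K n ψ.1 χ.1 ≤ n * (δ + 4 * δ) :=
      Dmet_le (by positivity) fun r a ha => hΦ.scalarOpNorm_le hK hδpos.le ψ.2 χ.2 hδpos.le
        (fun c hc => (hχ c hc).le) ha
    have h2 := Dmet_triangle hfin φ₀.2 ψ.2 χ.2
    have h3 : (n : ℝ) * (δ + 4 * δ) < g := by
      rw [hδ]
      have : (n : ℝ) * (g / (5 * (n + 1)) + 4 * (g / (5 * (n + 1)))) = g * (n / (n + 1)) := by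
        field_simp
        ring
      rw [this]
      refine mul_lt_of_lt_one_right hgpos ?_
      rw [div_lt_one (by positivity)]
      linarith
    linarith

/-- The unit ball of a matrix Lip-norm has finite nets modulo scalars. -/
theorem IsMatrixLipNorm.exists_lipNet (hL : IsMatrixLipNorm A L) {ε : ℝ} (hε : 0 < ε) :
    ∃ Φ, IsLipNet A L ε Φ := by
  rcases (CS A 1).eq_empty_or_nonempty with hemp | ⟨s₀, hs₀⟩
  · exact ⟨{0}, Set.finite_singleton 0, fun c _ => ⟨0, rfl, 0, fun s hs => by simp [hemp] at hs⟩⟩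
  have hfin := hL.finD
  obtain ⟨F, hF, hnet⟩ := hL.exists_finite_net 1 (show 0 < ε / 3 by positivity)
  let π : A.carrier → F → ℂ := fun c k => k.1 c 0 0 - s₀ c 0 0
  have hev : ∀ c, L 1 (MOUS.single c) ≤ 1 → ∀ s ∈ CS A 1, ∀ t ∈ CS A 1,
      ‖s c 0 0 - t c 0 0‖ ≤ Dmet A L 1 s t := fun c hc s hs t ht =>
    (norm_apply_sub_le hL.1 hfin hs ht c 0 0).trans
      (mul_le_of_le_one_right (Dmet_nonneg _ _) hc)
  set S : Set (F → ℂ) := π '' {c | L 1 (MOUS.single c) ≤ 1} with hS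
  have hbdd : Bornology.IsBounded S := by
    obtain ⟨C, hC⟩ := (F.finite_toSet.image fun s => Dmet A L 1 s s₀).bddAbove
    refine (Metric.isBounded_closedBall (x := (0 : F → ℂ)) (r := max C 0)).subset ?_
    rintro _ ⟨c, hc, rfl⟩
    rw [mem_closedBall_zero_iff, pi_norm_le_iff_of_nonneg (le_max_right _ _)]
    intro k
    exact (hev c hc k.1 (hF _ k.2) s₀ hs₀).trans ((hC ⟨k.1, k.2, rfl⟩).trans (le_max_left _ _))
  have htb : TotallyBounded S :=
    (Bornology.IsBounded.isCompact_closure hbdd).totallyBounded.subset subset_closure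
  obtain ⟨t, htS, htf, hcov⟩ := Metric.finite_approx_of_totallyBounded htb (ε / 3) (by positivity)
  have hsec : ∀ y : F → ℂ, ∃ c, y ∈ t → L 1 (MOUS.single c) ≤ 1 ∧ π c = y := by
    intro y
    by_cases hy : y ∈ t
    · obtain ⟨c, hc, hcy⟩ := htS hy
      exact ⟨c, fun _ => ⟨hc, hcy⟩⟩
    · exact ⟨0, fun h => absurd h hy⟩
  choose g hg using hsec
  refine ⟨g '' t, htf.image g, fun c hc => ?_⟩
  obtain ⟨y, hy, hyc⟩ := Set.mem_iUnion₂.1 (hcov ⟨c, hc, rfl⟩)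
  refine ⟨g y, ⟨y, hy, rfl⟩, s₀ c 0 0 - s₀ (g y) 0 0, fun s hs => ?_⟩
  obtain ⟨k, hk, hks⟩ := hnet s hs
  have h1 := (hev c hc k (hF k hk) s hs).trans_lt hks
  have h2 := (hev (g y) (hg y hy).1 k (hF k hk) s hs).trans_lt hks
  have h3 : ‖π c ⟨k, hk⟩ - π (g y) ⟨k, hk⟩‖ < ε / 3 := by
    rw [(hg y hy).2, ← dist_eq_norm]
    exact (dist_le_pi_dist _ _ _).trans_lt hyc
  have e : s (c - g y - (s₀ c 0 0 - s₀ (g y) 0 0) • A.one) 0 0 =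
      -(k c 0 0 - s c 0 0) + (k (g y) 0 0 - s (g y) 0 0) +
        (π c ⟨k, hk⟩ - π (g y) ⟨k, hk⟩) := by
    simp only [map_sub, map_smul, hs.1, π, Matrix.sub_apply, Matrix.smul_apply,
      Matrix.one_apply_eq, smul_eq_mul]
    ring
  rw [e]
  refine (norm_add₃_le).trans ?_
  rw [norm_neg]
  linarith

end Criterion

section Gram

variable {m n : ℕ}

lemma bilin_transpose {m n : Type*} [Fintype m] [Fintype n] (M : Matrix m n ℂ) (y : n → ℂ)
    (x : m → ℂ) : bilin M.transpose y x = bilin M x y := by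
  unfold bilin
  rw [Finset.sum_comm]
  refine Finset.sum_congr rfl fun i _ => Finset.sum_congr rfl fun j _ => ?_
  rw [Matrix.transpose_apply]
  ring

lemma scalarOpNorm_transpose {m n : Type*} [Fintype m] [Fintype n] [DecidableEq m] [DecidableEq n]
    (M : Matrix m n ℂ) : scalarOpNorm M.transpose = scalarOpNorm M := by
  refine le_antisymm ?_ ?_
  · refine (scalarOpNorm_le_iff (scalarOpNorm_nonneg _)).2 fun y x => ?_
    rw [bilin_transpose, add_comm]
    exact (scalarOpNorm_le_iff (scalarOpNorm_nonneg _)).1 le_rfl x y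
  · refine (scalarOpNorm_le_iff (scalarOpNorm_nonneg _)).2 fun y x => ?_
    rw [← bilin_transpose, add_comm]
    exact (scalarOpNorm_le_iff (scalarOpNorm_nonneg _)).1 le_rfl x y

/-- The Gram matrix of a finite family of vectors. -/
def gram (x : Fin m × Fin n → ℂ) : Matrix (Fin n) (Fin n) ℂ :=
  (Matrix.of fun (q : Fin m) j => x (q, j)).conjTranspose * Matrix.of fun (q : Fin m) j => x (q, j)

lemma gram_apply (x : Fin m × Fin n → ℂ) (i j : Fin n) :
    gram x i j = ∑ q, star (x (q, i)) * x (q, j) := rfl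

lemma scalarOpNorm_gram (x : Fin m × Fin n → ℂ) :
    scalarOpNorm (gram x) = scalarOpNorm (Matrix.of fun (q : Fin m) j => x (q, j)) ^ 2 := by
  rw [gram, scalarOpNorm_conjTranspose_mul_self, sq]

lemma gram_smul (c : ℝ) (x : Fin m × Fin n → ℂ) :
    gram ((c : ℂ) • x) = (c ^ 2) • gram x := by
  ext i j
  rw [Matrix.smul_apply, gram_apply, gram_apply, Finset.smul_sum]
  refine Finset.sum_congr rfl fun q _ => ?_
  simp only [Pi.smul_apply, smul_eq_mul, star_mul', Complex.star_def, Complex.conj_ofReal,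
    Complex.real_smul]
  push_cast
  ring

lemma gram_add_index {l : ℕ} (x : Fin (l + m) × Fin n → ℂ) :
    gram x = gram (fun p : Fin l × Fin n => x (Fin.castAdd m p.1, p.2)) +
      gram (fun p : Fin m × Fin n => x (Fin.natAdd l p.1, p.2)) := by
  ext i j
  rw [Matrix.add_apply, gram_apply, gram_apply, gram_apply, Fin.sum_univ_add]

lemma bilin_conjTranspose_mul_self (R : Matrix (Fin n) (Fin n) ℂ) (x : Fin n → ℂ) :
    bilin (R.conjTranspose * R) (star x) x = (normSum (R.mulVec x) : ℂ) := by
  rw [← bilin_star_mulVec, bilin_eq_dotProduct, bilin_eq_dotProduct, ← Matrix.mulVec_mulVec,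
    Matrix.dotProduct_mulVec, Matrix.star_mulVec]

lemma exists_matrix_of_functional (ℓ : Matrix (Fin n) (Fin n) ℂ →ₗ[ℝ] ℝ) :
    ∃ C : Matrix (Fin n) (Fin n) ℂ, ∀ Z, ℓ Z = (∑ i, ∑ j, Z i j * C i j).re := by
  refine ⟨Matrix.of fun i j => (ℓ (Matrix.single i j 1) : ℂ) -
    (ℓ (Matrix.single i j Complex.I) : ℂ) * Complex.I, fun Z => ?_⟩
  conv_lhs => rw [Matrix.matrix_eq_sum_single Z]
  simp only [map_sum, Complex.re_sum]
  refine Finset.sum_congr rfl fun i _ => Finset.sum_congr rfl fun j _ => ?_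
  have e : Matrix.single i j (Z i j) = (Z i j).re • Matrix.single i j (1 : ℂ) +
      (Z i j).im • Matrix.single i j Complex.I := by
    rw [Matrix.smul_single, Matrix.smul_single, ← Matrix.single_add]
    congr 1
    simp [Complex.re_add_im]
  rw [e, map_add, map_smul, map_smul]
  simp

/-- A functional which is nonnegative on Gram matrices is, up to a small perturbation, given by an
invertible matrix. -/
lemma exists_invertible_of_gram_nonneg (ℓ : Matrix (Fin n) (Fin n) ℂ →ₗ[ℝ] ℝ)
    (hℓ : ∀ m (x : Fin m × Fin n → ℂ), 0 ≤ ℓ (gram x)) {η : ℝ} (hη : 0 < η) :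
    ∃ R : Matrix (Fin n) (Fin n) ℂ, IsUnit R ∧ ∀ m (x : Fin m × Fin n → ℂ),
      ∑ q, normSum (R.mulVec fun j => x (q, j)) = ℓ (gram x) + η * normSum x := by
  obtain ⟨C, hC⟩ := exists_matrix_of_functional ℓ
  have hgram : ∀ m (x : Fin m × Fin n → ℂ), ℓ (gram x) =
      ∑ q, (bilin C (star fun j => x (q, j)) fun j => x (q, j)).re := by
    intro m x
    rw [hC, ← Complex.re_sum]
    congr 1
    simp only [gram_apply, bilin, Finset.sum_mul]
    conv_rhs => rw [Finset.sum_comm]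
    refine Finset.sum_congr rfl fun i _ => ?_
    conv_rhs => rw [Finset.sum_comm]
    refine Finset.sum_congr rfl fun j _ => Finset.sum_congr rfl fun q _ => ?_
    simp only [Pi.star_apply]
    ring
  set D : Matrix (Fin n) (Fin n) ℂ := (1 / 2 : ℂ) • (C + C.conjTranspose) with hD
  have hform : ∀ ξ : Fin n → ℂ, bilin D (star ξ) ξ = ((bilin C (star ξ) ξ).re : ℂ) := by
    intro ξ
    rw [hD, bilin_smul, bilin_add_left_arg, bilin_conjTranspose, star_star, Complex.star_def,
      Complex.add_conj]
    push_cast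
    ring
  have hform0 : ∀ ξ : Fin n → ℂ, 0 ≤ (bilin C (star ξ) ξ).re := by
    intro ξ
    have := hℓ 1 fun p => ξ p.2
    rw [hgram, Fin.sum_univ_one] at this
    exact this
  have hpsd : (D + (η : ℂ) • (1 : Matrix (Fin n) (Fin n) ℂ)).PosSemidef := by
    refine posSemidef_iff_bilin.2 fun ξ => ?_
    rw [bilin_add_left_arg, hform, bilin_smul, bilin_one]
    have h1 := hform0 ξ
    have h2 := normSum_nonneg ξ
    have h3 : 0 ≤ (bilin C (star ξ) ξ).re + η * normSum ξ := by positivity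
    exact_mod_cast h3
  obtain ⟨R, hR⟩ := posSemidef_eq_conjTranspose_mul_self hpsd
  have hRx : ∀ ξ : Fin n → ℂ, normSum (R.mulVec ξ) =
      (bilin C (star ξ) ξ).re + η * normSum ξ := by
    intro ξ
    have := bilin_conjTranspose_mul_self R ξ
    rw [← hR, bilin_add_left_arg, hform, bilin_smul, bilin_one] at this
    exact_mod_cast this.symm
  refine ⟨R, Matrix.mulVec_injective_iff_isUnit.1 ?_, fun m x => ?_⟩
  · refine (injective_iff_map_eq_zero R.mulVecLin).2 fun ξ hξ => ?_
    have h1 := hRx ξ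
    have h2 := hform0 ξ
    have h3 := normSum_nonneg ξ
    have h4 : normSum (R.mulVec ξ) = 0 := by
      rw [show R.mulVec ξ = 0 from hξ]
      simp [normSum]
    refine normSum_eq_zero (le_antisymm ?_ h3)
    by_contra hcon
    push Not at hcon
    have := mul_pos hη hcon
    linarith
  · simp only [hRx, Finset.sum_add_distrib, hgram, ← Finset.mul_sum, normSum_prod]

end Gram

section EffrosWinkler

variable {A : MOUS} {K : ∀ n : ℕ, Matrix (Fin n) (Fin n) A.carrier → ℝ} {n : ℕ}

/-- The vector implementing the trace pairing of `Mₙ(V)` with a map into `Mₙ`. -/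
def diagVec (n : ℕ) : Fin n × Fin n → ℂ := fun p => if p.1 = p.2 then 1 else 0

lemma bilin_diagVec (f : MState A n) (v : Matrix (Fin n) (Fin n) A.carrier) :
    bilin (mpair f v) (diagVec n) (diagVec n) = ∑ i, ∑ j, f (v i j) i j := by
  rw [bilin_mpair]
  refine Finset.sum_congr rfl fun p _ => Finset.sum_congr rfl fun q _ => ?_
  simp [bilin, diagVec]

lemma bilin_mpair_eq_diagVec {m : ℕ} (f : MState A n) (v : Matrix (Fin m) (Fin m) A.carrier)
    (y x : Fin m × Fin n → ℂ) :
    bilin (mpair f v) y x = bilin (mpair f (mmulMat (Matrix.of fun i p => y (p, i)) v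
      (Matrix.of fun q j => x (q, j)))) (diagVec n) (diagVec n) := by
  rw [bilin_mpair_mmulMat]
  congr 1
  · funext p
    simp [diagVec]
  · funext p
    simp [diagVec]

lemma re_bilin_mpair_le (hK : IsMatrixLipschitzSeminorm A K) {f : MState A n}
    (hf : ∀ v, (∑ i, ∑ j, f (v i j) i j).re ≤ K n v) {m : ℕ}
    {v : Matrix (Fin m) (Fin m) A.carrier} (hv : K m v ≤ 1) (y x : Fin m × Fin n → ℂ) :
    (bilin (mpair f v) y x).re ≤
      1 / 2 * (scalarOpNorm (gram y) + scalarOpNorm (gram x)) := by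
  rw [bilin_mpair_eq_diagVec, bilin_diagVec, scalarOpNorm_gram, scalarOpNorm_gram]
  refine (hf _).trans ((hK.mmul_le _ _ _ _ _).trans ?_)
  have e : scalarOpNorm (Matrix.of fun i p => y (p, i) : Matrix (Fin n) (Fin m) ℂ) =
      scalarOpNorm (Matrix.of fun (q : Fin m) j => y (q, j)) := by
    rw [← scalarOpNorm_transpose]
    rfl
  rw [e]
  set α := scalarOpNorm (Matrix.of fun (q : Fin m) j => y (q, j))
  set β := scalarOpNorm (Matrix.of fun (q : Fin m) j => x (q, j))
  have hα : 0 ≤ α := scalarOpNorm_nonneg _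
  have hβ : 0 ≤ β := scalarOpNorm_nonneg _
  calc α * K m v * β ≤ α * 1 * β := by gcongr
    _ ≤ _ := by nlinarith [sq_nonneg (α - β)]

/-- The wedge used to separate a bounded functional from its Lipschitz ball. -/
def ewCone (f : MState A n) (K : ∀ n : ℕ, Matrix (Fin n) (Fin n) A.carrier → ℝ) :
    Set ((Matrix (Fin n) (Fin n) ℂ × Matrix (Fin n) (Fin n) ℂ) × ℝ) :=
  {z | ∃ (m : ℕ) (v : Matrix (Fin m) (Fin m) A.carrier) (y x : Fin m × Fin n → ℂ), K m v ≤ 1 ∧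
    scalarOpNorm (z.1.1 + (1 / 2 : ℝ) • gram y) + scalarOpNorm (z.1.2 + (1 / 2 : ℝ) • gram x) ≤
      z.2 + (bilin (mpair f v) y x).re}

lemma scalarOpNorm_real_smul {m n : Type*} [Fintype m] [Fintype n] [DecidableEq n] {c : ℝ}
    (hc : 0 ≤ c) (γ : Matrix m n ℂ) : scalarOpNorm (c • γ) = c * scalarOpNorm γ := by
  rw [← Complex.coe_smul, scalarOpNorm_smul, Complex.norm_real, Real.norm_of_nonneg hc]

lemma ewCone_add (hK : IsMatrixLipschitzSeminorm A K) {f : MState A n}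
    {z w : (Matrix (Fin n) (Fin n) ℂ × Matrix (Fin n) (Fin n) ℂ) × ℝ}
    (hz : z ∈ ewCone f K) (hw : w ∈ ewCone f K) : z + w ∈ ewCone f K := by
  obtain ⟨m, v, y, x, hv, h⟩ := hz
  obtain ⟨m', v', y', x', hv', h'⟩ := hw
  refine ⟨m + m', dsumMat v v',
    fun p => Fin.addCases (fun i => y (i, p.2)) (fun i => y' (i, p.2)) p.1,
    fun p => Fin.addCases (fun i => x (i, p.2)) (fun i => x' (i, p.2)) p.1, ?_, ?_⟩
  · rw [hK.dsum_eq]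
    exact max_le hv hv'
  · rw [bilin_mpair_dsumMat, gram_add_index, gram_add_index]
    simp only [Fin.addCases_left, Fin.addCases_right, Prod.mk.eta, Complex.add_re]
    have h1 := scalarOpNorm_add_le (z.1.1 + (1 / 2 : ℝ) • gram y) (w.1.1 + (1 / 2 : ℝ) • gram y')
    have h2 := scalarOpNorm_add_le (z.1.2 + (1 / 2 : ℝ) • gram x) (w.1.2 + (1 / 2 : ℝ) • gram x')
    have e1 : (z + w).1.1 + (1 / 2 : ℝ) • (gram y + gram y') =
        z.1.1 + (1 / 2 : ℝ) • gram y + (w.1.1 + (1 / 2 : ℝ) • gram y') := by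
      rw [Prod.fst_add, Prod.fst_add, smul_add]
      abel
    have e2 : (z + w).1.2 + (1 / 2 : ℝ) • (gram x + gram x') =
        z.1.2 + (1 / 2 : ℝ) • gram x + (w.1.2 + (1 / 2 : ℝ) • gram x') := by
      rw [Prod.fst_add, Prod.snd_add, smul_add]
      abel
    rw [e1, e2, Prod.snd_add]
    linarith

lemma ewCone_smul {f : MState A n}
    {z : (Matrix (Fin n) (Fin n) ℂ × Matrix (Fin n) (Fin n) ℂ) × ℝ}
    (hz : z ∈ ewCone f K) {c : ℝ} (hc : 0 ≤ c) : c • z ∈ ewCone f K := by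
  obtain ⟨m, v, y, x, hv, h⟩ := hz
  refine ⟨m, v, ((Real.sqrt c : ℝ) : ℂ) • y, ((Real.sqrt c : ℝ) : ℂ) • x, hv, ?_⟩
  have hsq : ((Real.sqrt c : ℝ) : ℂ) * ((Real.sqrt c : ℝ) : ℂ) = (c : ℂ) := by
    rw [← Complex.ofReal_mul, Real.mul_self_sqrt hc]
  rw [bilin_smul_left, bilin_smul_right, ← mul_assoc, hsq, gram_smul, gram_smul,
    Real.sq_sqrt hc, Complex.re_ofReal_mul]
  have e : ∀ X Y : Matrix (Fin n) (Fin n) ℂ, c • X + (1 / 2 : ℝ) • c • Y =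
      c • (X + (1 / 2 : ℝ) • Y) := by
    intro X Y
    rw [smul_add, smul_comm]
  rw [Prod.smul_fst, Prod.smul_fst, Prod.smul_snd, Prod.smul_snd, e, e,
    scalarOpNorm_real_smul hc, scalarOpNorm_real_smul hc, smul_eq_mul, ← mul_add, ← mul_add]
  exact mul_le_mul_of_nonneg_left h hc

lemma mem_ewCone_of_le (hK : IsMatrixLipschitzSeminorm A K) {f : MState A n}
    {z : (Matrix (Fin n) (Fin n) ℂ × Matrix (Fin n) (Fin n) ℂ) × ℝ}
    (h : scalarOpNorm z.1.1 + scalarOpNorm z.1.2 ≤ z.2) : z ∈ ewCone f K := by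
  have h0 : K 1 0 = 0 := by simpa using hK.smul_eq 1 0 0
  have hg : gram (0 : Fin 1 × Fin n → ℂ) = 0 := by
    ext i j
    simp [gram_apply]
  refine ⟨1, 0, 0, 0, by rw [h0]; exact zero_le_one, ?_⟩
  rw [hg, smul_zero, add_zero, add_zero]
  simpa [bilin] using h

/-- The two functionals obtained by separation. -/
lemma exists_functionals (hK : IsMatrixLipschitzSeminorm A K) {f : MState A n}
    (hf : ∀ v, (∑ i, ∑ j, f (v i j) i j).re ≤ K n v) :
    ∃ ℓ₁ ℓ₂ : Matrix (Fin n) (Fin n) ℂ →ₗ[ℝ] ℝ, (∀ X, ℓ₁ X ≤ scalarOpNorm X) ∧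
      (∀ X, ℓ₂ X ≤ scalarOpNorm X) ∧
      ∀ m (v : Matrix (Fin m) (Fin m) A.carrier) (y x : Fin m × Fin n → ℂ), K m v ≤ 1 →
        (bilin (mpair f v) y x).re ≤ 1 / 2 * (ℓ₁ (gram y) + ℓ₂ (gram x)) := by
  let s : PointedCone ℝ ((Matrix (Fin n) (Fin n) ℂ × Matrix (Fin n) (Fin n) ℂ) × ℝ) :=
    { carrier := ewCone f K
      add_mem' := fun ha hb => ewCone_add hK ha hb
      zero_mem' := mem_ewCone_of_le hK (by
        show scalarOpNorm (0 : Matrix (Fin n) (Fin n) ℂ) +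
          scalarOpNorm (0 : Matrix (Fin n) (Fin n) ℂ) ≤ 0
        rw [scalarOpNorm_zero, add_zero])
      smul_mem' := fun c _ hz => ewCone_smul hz c.2 }
  let J : ℝ →ₗ[ℝ] (Matrix (Fin n) (Fin n) ℂ × Matrix (Fin n) (Fin n) ℂ) × ℝ :=
    LinearMap.inr ℝ _ _
  obtain ⟨g, hg, hgs⟩ := exists_nonneg_extension J LinearMap.inr_injective LinearMap.id s
    (by
      rintro τ ⟨m, v, y, x, hv, h⟩
      have h1 := re_bilin_mpair_le hK hf hv y x
      have e : ∀ Y : Matrix (Fin n) (Fin n) ℂ, scalarOpNorm (0 + (1 / 2 : ℝ) • Y) =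
          1 / 2 * scalarOpNorm Y := by
        intro Y
        rw [zero_add, scalarOpNorm_real_smul (by norm_num)]
      have h2 : scalarOpNorm (0 + (1 / 2 : ℝ) • gram y) +
        scalarOpNorm (0 + (1 / 2 : ℝ) • gram x) ≤ τ + (bilin (mpair f v) y x).re := h
      rw [e, e] at h2
      show 0 ≤ τ
      linarith)
    (by
      intro z
      refine ⟨scalarOpNorm z.1.1 + scalarOpNorm z.1.2 - z.2, mem_ewCone_of_le hK ?_⟩
      show scalarOpNorm (0 + z.1.1) + scalarOpNorm (0 + z.1.2) ≤
        scalarOpNorm z.1.1 + scalarOpNorm z.1.2 - z.2 + z.2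
      rw [zero_add, zero_add]
      linarith)
  have hg' : ∀ τ : ℝ, g (0, τ) = τ := hg
  refine ⟨-(g ∘ₗ LinearMap.inl ℝ _ _ ∘ₗ LinearMap.inl ℝ _ _),
    -(g ∘ₗ LinearMap.inl ℝ _ _ ∘ₗ LinearMap.inr ℝ _ _), fun X => ?_, fun X => ?_,
    fun m v y x hv => ?_⟩
  · have h : 0 ≤ g ((X, 0), scalarOpNorm X) := hgs _ (mem_ewCone_of_le hK (by
      show scalarOpNorm X + scalarOpNorm (0 : Matrix (Fin n) (Fin n) ℂ) ≤ scalarOpNorm X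
      rw [scalarOpNorm_zero, add_zero]))
    have e : g ((X, 0), scalarOpNorm X) = g ((X, 0), 0) + g (0, scalarOpNorm X) := by
      rw [← map_add]; simp
    rw [e, hg'] at h
    show -g ((X, 0), 0) ≤ _
    linarith
  · have h : 0 ≤ g ((0, X), scalarOpNorm X) := hgs _ (mem_ewCone_of_le hK (by
      show scalarOpNorm (0 : Matrix (Fin n) (Fin n) ℂ) + scalarOpNorm X ≤ scalarOpNorm X
      rw [scalarOpNorm_zero, zero_add]))
    have e : g ((0, X), scalarOpNorm X) = g ((0, X), 0) + g (0, scalarOpNorm X) := by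
      rw [← map_add]; simp
    rw [e, hg'] at h
    show -g ((0, X), 0) ≤ _
    linarith
  · set t := (bilin (mpair f v) y x).re with ht
    have h : 0 ≤ g ((-((1 / 2 : ℝ) • gram y), -((1 / 2 : ℝ) • gram x)), -t) := by
      refine hgs _ ⟨m, v, y, x, hv, ?_⟩
      show scalarOpNorm (-((1 / 2 : ℝ) • gram y) + (1 / 2 : ℝ) • gram y) +
        scalarOpNorm (-((1 / 2 : ℝ) • gram x) + (1 / 2 : ℝ) • gram x) ≤ -t + t
      rw [neg_add_cancel, neg_add_cancel, scalarOpNorm_zero, add_zero, neg_add_cancel]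
    have e : ((-((1 / 2 : ℝ) • gram y), -((1 / 2 : ℝ) • gram x)), -t) =
        (-(1 / 2 : ℝ)) • (((gram y, 0), (0 : ℝ)) :
          (Matrix (Fin n) (Fin n) ℂ × Matrix (Fin n) (Fin n) ℂ) × ℝ) +
        (-(1 / 2 : ℝ)) • (((0, gram x), (0 : ℝ)) :
          (Matrix (Fin n) (Fin n) ℂ × Matrix (Fin n) (Fin n) ℂ) × ℝ) + (0, -t) := by
      simp
    rw [e, map_add, map_add, map_smul, map_smul, hg', smul_eq_mul, smul_eq_mul] at h
    show t ≤ 1 / 2 * (-g ((gram y, 0), 0) + -g ((0, gram x), 0))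
    linarith

/-- Effros–Winkler type Hahn–Banach theorem: a functional dominated by a matrix Lipschitz seminorm
factors, up to a small perturbation, through a completely contractive map. -/
theorem exists_twist_of_re_le (hK : IsMatrixLipschitzSeminorm A K) {f : MState A n}
    (hf : ∀ v, (∑ i, ∑ j, f (v i j) i j).re ≤ K n v) {η : ℝ} (hη : 0 < η) :
    ∃ P Q : Matrix (Fin n) (Fin n) ℂ,
      (∀ r (v : Matrix (Fin r) (Fin r) A.carrier), K r v ≤ 1 →
        scalarOpNorm (mpair (twist P f Q) v) ≤ 1) ∧
      ∀ a : Matrix (Fin n) (Fin n) A.carrier, ‖∑ i, ∑ j, f (a i j) i j‖ ≤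
        (1 + n * η) * scalarOpNorm (mpair (twist P f Q) a) := by
  obtain ⟨ℓ₁, ℓ₂, h₁, h₂, hℓ⟩ := exists_functionals hK hf
  have hz : ∀ m, K m 0 ≤ 1 := by
    intro m
    have : K m 0 = 0 := by simpa using hK.smul_eq m 0 0
    rw [this]; exact zero_le_one
  have hg0 : ∀ m, gram (0 : Fin m × Fin n → ℂ) = 0 := by
    intro m
    ext i j
    simp [gram_apply]
  have p₁ : ∀ m (x : Fin m × Fin n → ℂ), 0 ≤ ℓ₁ (gram x) := by
    intro m x
    have := hℓ m 0 x 0 (hz m)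
    rw [hg0, map_zero] at this
    simp only [bilin, Pi.zero_apply, mul_zero, Finset.sum_const_zero, Complex.zero_re] at this
    linarith
  have p₂ : ∀ m (x : Fin m × Fin n → ℂ), 0 ≤ ℓ₂ (gram x) := by
    intro m x
    have := hℓ m 0 0 x (hz m)
    rw [hg0, map_zero] at this
    simp only [bilin, Pi.zero_apply, zero_mul, Finset.sum_const_zero, Complex.zero_re] at this
    linarith
  obtain ⟨R, hR, hRx⟩ := exists_invertible_of_gram_nonneg ℓ₁ p₁ hη
  obtain ⟨S, hS, hSx⟩ := exists_invertible_of_gram_nonneg ℓ₂ p₂ hη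
  have hRd := (Matrix.isUnit_iff_isUnit_det R).1 hR
  have hSd := (Matrix.isUnit_iff_isUnit_det S).1 hS
  have hbil : ∀ r (v : Matrix (Fin r) (Fin r) A.carrier) (y x : Fin r × Fin n → ℂ),
      bilin (mpair (twist R⁻¹.transpose f S⁻¹) v) y x = bilin (mpair f v)
        (fun p => R⁻¹.mulVec (fun i => y (p.1, i)) p.2)
        (fun q => S⁻¹.mulVec (fun i => x (q.1, i)) q.2) := by
    intro r v y x
    rw [bilin_mpair_twist]
    simp only [Matrix.vecMul_transpose]
  have hdiag : gram (diagVec n) = 1 := by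
    ext i j
    simp [gram_apply, diagVec, Matrix.one_apply, eq_comm]
  have hone : scalarOpNorm (1 : Matrix (Fin n) (Fin n) ℂ) ≤ 1 := by
    refine scalarOpNorm_le_of_norm_bilin_sq_le zero_le_one fun y x => ?_
    rw [one_pow, one_mul, bilin_eq_dotProduct, Matrix.one_mulVec]
    exact norm_dotProduct_sq_le y x
  have hnd : normSum (diagVec n) = n := by
    rw [normSum_prod]
    simp [normSum, diagVec, apply_ite]
  refine ⟨R⁻¹.transpose, S⁻¹, fun r v hv => ?_, fun a => ?_⟩
  · refine (scalarOpNorm_le_iff zero_le_one).2 fun y x => ?_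
    rw [hbil]
    refine (hℓ r v _ _ hv).trans ?_
    have hy := hRx r fun p => R⁻¹.mulVec (fun i => y (p.1, i)) p.2
    have hx := hSx r fun p => S⁻¹.mulVec (fun i => x (p.1, i)) p.2
    simp only [Matrix.mulVec_mulVec, Matrix.mul_nonsing_inv _ hRd, Matrix.mul_nonsing_inv _ hSd,
      Matrix.one_mulVec, ← normSum_prod] at hy hx
    have ny := normSum_nonneg fun p : Fin r × Fin n => R⁻¹.mulVec (fun i => y (p.1, i)) p.2
    have nx := normSum_nonneg fun p : Fin r × Fin n => S⁻¹.mulVec (fun i => x (p.1, i)) p.2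
    have := mul_nonneg hη.le ny
    have := mul_nonneg hη.le nx
    linarith
  · have e := hbil n a (fun p => R.mulVec (fun i => diagVec n (p.1, i)) p.2)
      (fun p => S.mulVec (fun i => diagVec n (p.1, i)) p.2)
    simp only [Matrix.mulVec_mulVec, Matrix.nonsing_inv_mul _ hRd, Matrix.nonsing_inv_mul _ hSd,
      Matrix.one_mulVec, Prod.mk.eta] at e
    rw [← bilin_diagVec]
    have e' : bilin (mpair f a) (diagVec n) (diagVec n) = _ := e.symm
    rw [e']
    refine (norm_bilin_le _ _ _).trans ?_
    have hy := hRx n (diagVec n)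
    have hx := hSx n (diagVec n)
    rw [hdiag, hnd] at hy hx
    rw [normSum_prod fun p => R.mulVec (fun i => diagVec n (p.1, i)) p.2,
      normSum_prod fun p => S.mulVec (fun i => diagVec n (p.1, i)) p.2]
    change scalarOpNorm _ / 2 * ((∑ q, normSum (R.mulVec fun j => diagVec n (q, j))) +
      ∑ q, normSum (S.mulVec fun j => diagVec n (q, j))) ≤ _
    rw [hy, hx]
    have a1 := (h₁ 1).trans hone
    have a2 := (h₂ 1).trans hone
    have := scalarOpNorm_nonneg (mpair (twist R⁻¹.transpose f S⁻¹) a)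
    nlinarith

end EffrosWinkler

section Tensor

variable {A : MOUS} {n : ℕ}

lemma IsCPMap.zero : IsCPMap (0 : MState A n) := by
  intro r v _
  have : mpair (0 : MState A n) v = 0 := by
    ext p q
    rfl
  rw [this]
  exact Matrix.PosSemidef.zero

lemma IsCPMap.sum {ι : Type*} (s : Finset ι) (f : ι → MState A n) (h : ∀ i ∈ s, IsCPMap (f i)) :
    IsCPMap (∑ i ∈ s, f i) := by
  classical
  induction s using Finset.induction_on with
  | empty => exact IsCPMap.zero
  | insert i s hi ih =>
    rw [Finset.sum_insert hi]
    exact (h i (Finset.mem_insert_self i s)).add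
      (ih fun j hj => h j (Finset.mem_insert_of_mem hj))

/-- The map `x ↦ s(x) C` for a scalar-valued map `s`. -/
def tensorState (s : MState A 1) (C : Matrix (Fin n) (Fin n) ℂ) : MState A n where
  toFun x := s x 0 0 • C
  map_add' x y := by rw [map_add, Matrix.add_apply, add_smul]
  map_smul' c x := by rw [map_smul, Matrix.smul_apply, smul_assoc, RingHom.id_apply]

lemma tensorState_apply (s : MState A 1) (C : Matrix (Fin n) (Fin n) ℂ) (x : A.carrier) :
    tensorState s C x = s x 0 0 • C := rfl

lemma IsCPMap.tensorState {s : MState A 1} (hs : IsCPMap s) {C : Matrix (Fin n) (Fin n) ℂ}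
    (hC : C.PosSemidef) : IsCPMap (tensorState s C) := by
  obtain ⟨B, rfl⟩ := posSemidef_eq_conjTranspose_mul_self hC
  have e : _root_.tensorState s (B.conjTranspose * B) = ∑ l, _root_.twist
      (Matrix.of fun (_ : Fin 1) j => B l j).conjTranspose s (Matrix.of fun _ j => B l j) := by
    ext x i j
    rw [tensorState_apply, LinearMap.sum_apply, Matrix.sum_apply]
    simp only [twist_apply, Matrix.mul_apply, Fin.sum_univ_one, Matrix.smul_apply,
      Matrix.conjTranspose_apply, Matrix.of_apply, smul_eq_mul, Finset.mul_sum]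
    refine Finset.sum_congr rfl fun l _ => ?_
    ring
  rw [e]
  exact IsCPMap.sum _ _ fun l _ => hs.twist _

/-- The self-adjoint off-diagonal dilation of a map. -/
def offDiag (θ : MState A n) : MState A (n + n) where
  toFun c := Matrix.reindex finSumFinEquiv finSumFinEquiv
    (Matrix.fromBlocks 0 (θ c) (θ (star c)).conjTranspose 0)
  map_add' x y := by
    rw [star_add, map_add, map_add, Matrix.conjTranspose_add]
    ext i j
    refine Fin.addCases (fun i => ?_) (fun i => ?_) i <;>
      refine Fin.addCases (fun j => ?_) (fun j => ?_) j <;> simp [-Fin.natAdd_eq_addNat]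
  map_smul' c x := by
    rw [star_smul, map_smul, map_smul, Matrix.conjTranspose_smul, star_star]
    ext i j
    refine Fin.addCases (fun i => ?_) (fun i => ?_) i <;>
      refine Fin.addCases (fun j => ?_) (fun j => ?_) j <;> simp [-Fin.natAdd_eq_addNat]

lemma offDiag_apply (θ : MState A n) (c : A.carrier) :
    offDiag θ c = Matrix.reindex finSumFinEquiv finSumFinEquiv
      (Matrix.fromBlocks 0 (θ c) (θ (star c)).conjTranspose 0) := rfl

lemma bilin_mpair_offDiag (θ : MState A n) {r : ℕ} (v : Matrix (Fin r) (Fin r) A.carrier)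
    (y x : Fin r × Fin (n + n) → ℂ) :
    bilin (mpair (offDiag θ) v) y x =
      bilin (mpair θ v) (fun p => y (p.1, Fin.castAdd n p.2)) (fun p => x (p.1, Fin.natAdd n p.2)) +
      bilin (mpair θ v.conjTranspose).conjTranspose (fun p => y (p.1, Fin.natAdd n p.2))
        (fun p => x (p.1, Fin.castAdd n p.2)) := by
  have e : bilin (mpair θ v.conjTranspose).conjTranspose (fun p => y (p.1, Fin.natAdd n p.2))
      (fun p => x (p.1, Fin.castAdd n p.2)) = ∑ p, ∑ q, bilin (θ (star (v p q))).conjTranspose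
        (fun i => y (p, Fin.natAdd n i)) (fun i => x (q, Fin.castAdd n i)) := by
    simp only [bilin, Fintype.sum_prod_type]
    refine Finset.sum_congr rfl fun p _ => ?_
    rw [Finset.sum_comm]
    rfl
  rw [e, bilin_mpair, bilin_mpair, ← Finset.sum_add_distrib]
  refine Finset.sum_congr rfl fun p _ => ?_
  rw [← Finset.sum_add_distrib]
  refine Finset.sum_congr rfl fun q _ => ?_
  rw [offDiag_apply]
  simp [bilin, Fin.sum_univ_add, -Fin.natAdd_eq_addNat]

lemma normSum_prod_add {r : ℕ} (x : Fin r × Fin (n + n) → ℂ) :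
    normSum x = normSum (fun p : Fin r × Fin n => x (p.1, Fin.castAdd n p.2)) +
      normSum (fun p : Fin r × Fin n => x (p.1, Fin.natAdd n p.2)) := by
  rw [normSum_prod, normSum_prod, normSum_prod, ← Finset.sum_add_distrib]
  refine Finset.sum_congr rfl fun p _ => ?_
  simp [normSum, Fin.sum_univ_add]

lemma scalarOpNorm_mpair_offDiag_le {θ : MState A n} {r : ℕ}
    {v : Matrix (Fin r) (Fin r) A.carrier} {c : ℝ} (hc : 0 ≤ c)
    (h : scalarOpNorm (mpair θ v) ≤ c) (h' : scalarOpNorm (mpair θ v.conjTranspose) ≤ c) :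
    scalarOpNorm (mpair (offDiag θ) v) ≤ c := by
  refine (scalarOpNorm_le_iff hc).2 fun y x => ?_
  rw [bilin_mpair_offDiag, Complex.add_re, normSum_prod_add y, normSum_prod_add x]
  rw [← scalarOpNorm_conjTranspose] at h'
  have h1 := (scalarOpNorm_le_iff hc).1 h (fun p => y (p.1, Fin.castAdd n p.2))
    (fun p => x (p.1, Fin.natAdd n p.2))
  have h2 := (scalarOpNorm_le_iff hc).1 h' (fun p => y (p.1, Fin.natAdd n p.2))
    (fun p => x (p.1, Fin.castAdd n p.2))
  linarith

lemma le_scalarOpNorm_mpair_offDiag (θ : MState A n) {r : ℕ}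
    (v : Matrix (Fin r) (Fin r) A.carrier) :
    scalarOpNorm (mpair θ v) ≤ scalarOpNorm (mpair (offDiag θ) v) := by
  refine (scalarOpNorm_le_iff (scalarOpNorm_nonneg _)).2 fun y x => ?_
  have h := (scalarOpNorm_le_iff (scalarOpNorm_nonneg (mpair (offDiag θ) v))).1 le_rfl
    (fun p => Fin.addCases (fun i => y (p.1, i)) (fun _ => 0) p.2)
    (fun p => Fin.addCases (fun _ => 0) (fun i => x (p.1, i)) p.2)
  rw [bilin_mpair_offDiag, normSum_prod_add, normSum_prod_add] at h
  simpa [bilin, normSum, -Fin.natAdd_eq_addNat] using h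

end Tensor

section Recovered

variable {A : MOUS} {L : ∀ n : ℕ, Matrix (Fin n) (Fin n) A.carrier → ℝ}

/-- The normalized differences of distinct matrix states. -/
def stateSlopes (A : MOUS) (L : ∀ n : ℕ, Matrix (Fin n) (Fin n) A.carrier → ℝ) (k : ℕ) :
    Set (MState A k) :=
  {θ | ∃ φ ∈ CS A k, ∃ ψ ∈ CS A k, φ ≠ ψ ∧
    θ = (((Dmet A L k φ ψ)⁻¹ : ℝ) : ℂ) • (φ - ψ)}

lemma scalarOpNorm_mpair_slope {k n : ℕ} (φ ψ : MState A k)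
    (a : Matrix (Fin n) (Fin n) A.carrier) :
    scalarOpNorm (mpair ((((Dmet A L k φ ψ)⁻¹ : ℝ) : ℂ) • (φ - ψ)) a) =
      scalarOpNorm (mpair φ a - mpair ψ a) / Dmet A L k φ ψ := by
  rw [mpair_smul_left, mpair_sub_left, scalarOpNorm_smul, Complex.norm_real, Real.norm_eq_abs,
    abs_of_nonneg (inv_nonneg.2 (Dmet_nonneg φ ψ)), div_eq_inv_mul]

lemma LfromD_eq_supNorm (n : ℕ) (a : Matrix (Fin n) (Fin n) A.carrier) :
    LfromD A L n a = supNorm (stateSlopes A L) n a := by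
  unfold LfromD supNorm
  congr 1
  ext x
  constructor
  · rintro ⟨r, φ, ψ, hφ, hψ, hne, rfl⟩
    exact ⟨r, _, ⟨φ, hφ, ψ, hψ, hne, rfl⟩, (scalarOpNorm_mpair_slope φ ψ a).symm⟩
  · rintro ⟨r, _, ⟨φ, hφ, ψ, hψ, hne, rfl⟩, rfl⟩
    exact ⟨r, φ, ψ, hφ, hψ, hne, scalarOpNorm_mpair_slope φ ψ a⟩

lemma IsMatrixLipNorm.Dmet_pos (hL : IsMatrixLipNorm A L) {k : ℕ} {φ ψ : MState A k}
    (hφ : φ ∈ CS A k) (hψ : ψ ∈ CS A k) (hne : φ ≠ ψ) : 0 < Dmet A L k φ ψ :=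
  lt_of_le_of_ne (Dmet_nonneg φ ψ) fun h =>
    hne (Dmet_eq_zero hL.toIsMatrixLipschitzSeminorm hL.finD hφ hψ h.symm)

lemma IsMatrixLipNorm.scalarOpNorm_slope_le (hL : IsMatrixLipNorm A L) {n k : ℕ}
    (a : Matrix (Fin n) (Fin n) A.carrier) {θ : MState A k} (hθ : θ ∈ stateSlopes A L k) :
    scalarOpNorm (mpair θ a) ≤ L n a := by
  obtain ⟨φ, hφ, ψ, hψ, hne, rfl⟩ := hθ
  rw [scalarOpNorm_mpair_slope, div_le_iff₀ (hL.Dmet_pos hφ hψ hne), mul_comm]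
  exact scalarOpNorm_le_Dmet_mul hL.toIsMatrixLipschitzSeminorm hL.finD hφ hψ a

lemma IsMatrixLipNorm.ptBdd_stateSlopes (hL : IsMatrixLipNorm A L) : PtBdd (stateSlopes A L) := by
  intro n a
  refine ⟨L n a, ?_⟩
  rintro x ⟨k, θ, hθ, rfl⟩
  exact hL.scalarOpNorm_slope_le a hθ

lemma IsMatrixLipNorm.LfromD_le (hL : IsMatrixLipNorm A L) {n : ℕ}
    (a : Matrix (Fin n) (Fin n) A.carrier) : LfromD A L n a ≤ L n a := by
  rw [LfromD_eq_supNorm]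
  exact supNorm_le (hL.nonneg n a) fun k θ hθ => hL.scalarOpNorm_slope_le a hθ

lemma IsMatrixLipNorm.le_LfromD_mul (hL : IsMatrixLipNorm A L) {n k : ℕ} {φ ψ : MState A k}
    (hφ : φ ∈ CS A k) (hψ : ψ ∈ CS A k) (a : Matrix (Fin n) (Fin n) A.carrier) :
    scalarOpNorm (mpair φ a - mpair ψ a) ≤ LfromD A L n a * Dmet A L k φ ψ := by
  by_cases hne : φ = ψ
  · rw [hne, sub_self, scalarOpNorm_zero, Dmet_self, mul_zero]
  · rw [← div_le_iff₀ (hL.Dmet_pos hφ hψ hne), ← scalarOpNorm_mpair_slope, LfromD_eq_supNorm]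
    exact le_supNorm hL.ptBdd_stateSlopes a ⟨φ, hφ, ψ, hψ, hne, rfl⟩

lemma sum_weights_eq_zero (hK : IsMatrixLipschitzSeminorm A L) {ι : Type*} [Fintype ι] {n : ℕ}
    {s : ι → MState A 1} (hs : ∀ k, s k ∈ CS A 1) {w : ι → Matrix (Fin n) (Fin n) ℂ}
    (hle : ∀ v : Matrix (Fin n) (Fin n) A.carrier,
      (∑ i, ∑ j, ∑ k, w k i j * s k (v i j) 0 0).re ≤ L n v) : ∑ k, w k = 0 := by
  set μ := ∑ k, w k with hμ
  have h := hle (Matrix.of fun i j => star (μ i j) • A.one)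
  rw [(hK.null_iff n (Matrix.of fun i j => star (μ i j) • A.one)).2
    ⟨Matrix.of fun i j => star (μ i j), rfl⟩] at h
  have e : ∀ i j, ∑ k, w k i j * s k ((Matrix.of fun i j => star (μ i j) • A.one :
      Matrix (Fin n) (Fin n) A.carrier) i j) 0 0 = ((‖μ i j‖ ^ 2 : ℝ) : ℂ) := by
    intro i j
    have : ∀ k, w k i j * s k ((Matrix.of fun i j => star (μ i j) • A.one :
        Matrix (Fin n) (Fin n) A.carrier) i j) 0 0 = w k i j * star (μ i j) := by
      intro k
      rw [Matrix.of_apply, map_smul, (hs k).1]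
      simp
    simp only [this]
    rw [← Finset.sum_mul, ← Matrix.sum_apply, ← hμ, ← Complex.normSq_eq_norm_sq,
      ← Complex.mul_conj]
    rfl
  simp only [e] at h
  rw [Complex.re_sum] at h
  simp only [Complex.re_sum, Complex.ofReal_re] at h
  ext i j
  have h1 : ‖μ i j‖ ^ 2 ≤ 0 :=
    ((Finset.single_le_sum (f := fun j => ‖μ i j‖ ^ 2) (fun _ _ => by positivity)
      (Finset.mem_univ j)).trans (Finset.single_le_sum (f := fun i => ∑ j, ‖μ i j‖ ^ 2)
      (fun _ _ => Finset.sum_nonneg fun _ _ => by positivity) (Finset.mem_univ i))).trans h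
  have h2 : ‖μ i j‖ = 0 := by
    have := sq_nonneg ‖μ i j‖
    exact pow_eq_zero_iff (two_ne_zero) |>.1 (le_antisymm h1 this)
  simpa using h2

lemma state_star {s : MState A 1} (hs : s ∈ CS A 1) (c : A.carrier) :
    s (star c) 0 0 = star (s c 0 0) := by
  rw [(mem_CS_iff.1 hs).2.map_star]
  rfl

lemma offDiag_sum_tensorState {ι : Type*} [Fintype ι] {n : ℕ} {s : ι → MState A 1}
    (hs : ∀ k, s k ∈ CS A 1) (C : ι → Matrix (Fin n) (Fin n) ℂ) :
    offDiag (∑ k, tensorState (s k) (C k)) = ∑ k, tensorState (s k)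
      (Matrix.reindex finSumFinEquiv finSumFinEquiv
        (Matrix.fromBlocks 0 (C k) (C k).conjTranspose 0)) := by
  ext c i j
  rw [offDiag_apply]
  simp only [LinearMap.sum_apply, tensorState_apply, state_star (hs _), Matrix.sum_apply]
  refine Fin.addCases (fun i => ?_) (fun i => ?_) i <;>
    refine Fin.addCases (fun j => ?_) (fun j => ?_) j <;>
    simp [-Fin.natAdd_eq_addNat, Matrix.sum_apply]

lemma isHermitian_offDiagBlocks {n : ℕ} (C : Matrix (Fin n) (Fin n) ℂ) :
    (Matrix.reindex finSumFinEquiv finSumFinEquiv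
      (Matrix.fromBlocks 0 C C.conjTranspose 0)).IsHermitian := by
  unfold Matrix.IsHermitian
  rw [Matrix.conjTranspose_reindex, Matrix.fromBlocks_conjTranspose]
  simp

lemma twist_sum_tensorState {ι : Type*} [Fintype ι] {n : ℕ} (s : ι → MState A 1)
    (w : ι → Matrix (Fin n) (Fin n) ℂ) (P Q : Matrix (Fin n) (Fin n) ℂ) :
    twist P (∑ k, tensorState (s k) (w k)) Q = ∑ k, tensorState (s k) (P * w k * Q) := by
  ext c : 1
  rw [twist_apply, LinearMap.sum_apply, LinearMap.sum_apply, Finset.mul_sum, Finset.sum_mul]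
  refine Finset.sum_congr rfl fun k _ => ?_
  rw [tensorState_apply, tensorState_apply, Matrix.mul_smul, Matrix.smul_mul]

/-- A self-adjoint functional built from states which vanishes at the unit is a multiple of a
difference of two matrix states. -/
lemma exists_CS_sub_eq {ι : Type*} [Fintype ι] [Nonempty ι] {m : ℕ} {s : ι → MState A 1}
    (hs : ∀ k, s k ∈ CS A 1) {H : ι → Matrix (Fin m) (Fin m) ℂ} (hH : ∀ k, (H k).IsHermitian)
    (h0 : ∑ k, H k = 0) : ∃ c : ℝ, 0 < c ∧ ∃ φ ∈ CS A m, ∃ ψ ∈ CS A m,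
      ∑ k, tensorState (s k) (H k) = (c : ℂ) • (φ - ψ) := by
  set c : ℝ := 1 + ∑ k, scalarOpNorm (H k) with hc
  have hsum : 0 ≤ ∑ k, scalarOpNorm (H k) := Finset.sum_nonneg fun k _ => scalarOpNorm_nonneg _
  have hc0 : 0 < c := by linarith
  have hHc : ∀ k, scalarOpNorm (H k) ≤ c := fun k => by
    have := Finset.single_le_sum (f := fun k => scalarOpNorm (H k))
      (fun k _ => scalarOpNorm_nonneg _) (Finset.mem_univ k)
    linarith
  have hcard : (0 : ℝ) < Fintype.card ι := by exact_mod_cast Fintype.card_pos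
  have hd0 : 0 < (Fintype.card ι : ℝ) * c := mul_pos hcard hc0
  have key : ∀ G : ι → Matrix (Fin m) (Fin m) ℂ, (∀ k, ((c : ℂ) • 1 + G k).PosSemidef) →
      ∑ k, G k = 0 → ((((Fintype.card ι : ℝ) * c)⁻¹ : ℝ) : ℂ) •
        ∑ k, tensorState (s k) ((c : ℂ) • 1 + G k) ∈ CS A m := by
    intro G hG hG0
    refine mem_CS_iff.2 ⟨?_, (IsCPMap.sum _ _ fun k _ =>
      (mem_CS_iff.1 (hs k)).2.tensorState (hG k)).smul (inv_nonneg.2 hd0.le)⟩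
    have e : ∀ k, tensorState (s k) ((c : ℂ) • 1 + G k) A.one = (c : ℂ) • 1 + G k := by
      intro k
      rw [tensorState_apply, (hs k).1, Matrix.one_apply_eq, one_smul]
    rw [LinearMap.smul_apply, LinearMap.sum_apply, Finset.sum_congr rfl fun k _ => e k,
      Finset.sum_add_distrib, hG0, add_zero, Finset.sum_const, Finset.card_univ,
      ← Nat.cast_smul_eq_nsmul ℂ, smul_smul, smul_smul]
    have : ((((Fintype.card ι : ℝ) * c)⁻¹ : ℝ) : ℂ) * ((Fintype.card ι : ℂ) * (c : ℂ)) = 1 := by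
      rw [Complex.ofReal_inv, Complex.ofReal_mul, Complex.ofReal_natCast]
      refine inv_mul_cancel₀ ?_
      exact_mod_cast hd0.ne'
    rw [mul_assoc, this, one_smul]
  refine ⟨(Fintype.card ι : ℝ) * c, hd0, _, key H (fun k => posSemidef_smul_one_add (hH k) (hHc k))
    h0, _, key (fun _ => 0) (fun k => posSemidef_smul_one_add Matrix.isHermitian_zero
      (by rw [scalarOpNorm_zero]; exact hc0.le)) (by simp), ?_⟩
  have hne : (((Fintype.card ι : ℝ) * c : ℝ) : ℂ) ≠ 0 := by exact_mod_cast hd0.ne'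
  rw [smul_sub, Complex.ofReal_inv, smul_smul, smul_smul, mul_inv_cancel₀ hne, one_smul,
    one_smul, ← Finset.sum_sub_distrib]
  refine Finset.sum_congr rfl fun k _ => ?_
  ext x : 1
  rw [LinearMap.sub_apply, tensorState_apply, tensorState_apply, tensorState_apply, ← smul_sub]
  simp

lemma IsMatrixLipNorm.re_sum_le_one (hL : IsMatrixLipNorm A L) {ι : Type*} [Fintype ι] {n : ℕ}
    {s : ι → MState A 1} (hs : ∀ k, s k ∈ CS A 1) {w : ι → Matrix (Fin n) (Fin n) ℂ}
    (hle : ∀ v : Matrix (Fin n) (Fin n) A.carrier,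
      (∑ i, ∑ j, ∑ k, w k i j * s k (v i j) 0 0).re ≤ L n v)
    {a : Matrix (Fin n) (Fin n) A.carrier} (ha : LfromD A L n a ≤ 1) :
    (∑ i, ∑ j, ∑ k, w k i j * s k (a i j) 0 0).re ≤ 1 := by
  cases isEmpty_or_nonempty ι
  · simp
  have hK := hL.toIsMatrixLipschitzSeminorm
  have hw := sum_weights_eq_zero hK hs hle
  have hf : ∀ v : Matrix (Fin n) (Fin n) A.carrier,
      ∑ i, ∑ j, (∑ k, tensorState (s k) (w k)) (v i j) i j =
        ∑ i, ∑ j, ∑ k, w k i j * s k (v i j) 0 0 := by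
    intro v
    refine Finset.sum_congr rfl fun i _ => Finset.sum_congr rfl fun j _ => ?_
    rw [LinearMap.sum_apply, Matrix.sum_apply]
    refine Finset.sum_congr rfl fun k _ => ?_
    rw [tensorState_apply, Matrix.smul_apply, smul_eq_mul, mul_comm]
  have bound : ∀ η : ℝ, 0 < η → (∑ i, ∑ j, ∑ k, w k i j * s k (a i j) 0 0).re ≤ 1 + n * η := by
    intro η hη
    obtain ⟨P, Q, h1, h2⟩ := exists_twist_of_re_le hK
      (fun v => (congrArg Complex.re (hf v)).trans_le (hle v)) hη
    have h3 := h2 a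
    rw [hf] at h3
    rw [twist_sum_tensorState] at h1 h3
    set θ := ∑ k, tensorState (s k) (P * w k * Q) with hθ
    have hH0 : ∑ k, Matrix.reindex finSumFinEquiv finSumFinEquiv
        (Matrix.fromBlocks 0 (P * w k * Q) (P * w k * Q).conjTranspose 0) = 0 := by
      have h0 : ∑ k, P * w k * Q = 0 := by
        rw [← Finset.sum_mul, ← Finset.mul_sum, hw, mul_zero, zero_mul]
      have h0' : ∑ k, (P * w k * Q).conjTranspose = 0 := by
        rw [← Matrix.conjTranspose_sum, h0, Matrix.conjTranspose_zero]
      ext i j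
      have e1 : ∀ i j, ∑ k, (P * w k * Q) i j = 0 := fun i j => by
        rw [← Matrix.sum_apply, h0]; rfl
      have e2 : ∀ i j, ∑ k, (P * w k * Q).conjTranspose i j = 0 := fun i j => by
        rw [← Matrix.sum_apply, h0']; rfl
      rw [Matrix.sum_apply]
      refine Fin.addCases (fun i => ?_) (fun i => ?_) i <;>
        refine Fin.addCases (fun j => ?_) (fun j => ?_) j <;>
        simp [-Fin.natAdd_eq_addNat, -Matrix.conjTranspose_apply, -Matrix.conjTranspose_mul, e1, e2]
    obtain ⟨c, hc, φ, hφ, ψ, hψ, e⟩ := exists_CS_sub_eq hs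
      (fun k => isHermitian_offDiagBlocks (P * w k * Q)) hH0
    rw [← offDiag_sum_tensorState hs, ← hθ] at e
    have hnorm : ∀ {r : ℕ} (v : Matrix (Fin r) (Fin r) A.carrier),
        scalarOpNorm (mpair (offDiag θ) v) = c * scalarOpNorm (mpair φ v - mpair ψ v) := by
      intro r v
      rw [e, mpair_smul_left, mpair_sub_left, scalarOpNorm_smul, Complex.norm_real,
        Real.norm_eq_abs, abs_of_pos hc]
    have hD : Dmet A L (n + n) φ ψ ≤ 1 / c := by
      refine Dmet_le (by positivity) fun r v hv => ?_
      rw [le_div_iff₀ hc, mul_comm, ← hnorm]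
      exact scalarOpNorm_mpair_offDiag_le zero_le_one (h1 r v hv)
        (h1 r _ ((hK.star_eq r v).trans_le hv))
    have h4 : scalarOpNorm (mpair θ a) ≤ 1 := by
      refine (le_scalarOpNorm_mpair_offDiag θ a).trans ?_
      rw [hnorm]
      have h5 := hL.le_LfromD_mul hφ hψ a
      have h6 : LfromD A L n a * Dmet A L (n + n) φ ψ ≤ 1 * (1 / c) :=
        mul_le_mul ha hD (Dmet_nonneg _ _) zero_le_one
      calc c * scalarOpNorm (mpair φ a - mpair ψ a) ≤ c * (1 * (1 / c)) :=
            mul_le_mul_of_nonneg_left (h5.trans h6) hc.le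
        _ = 1 := by field_simp
    have h7 : (0 : ℝ) ≤ 1 + n * η := by positivity
    calc (∑ i, ∑ j, ∑ k, w k i j * s k (a i j) 0 0).re
        ≤ ‖∑ i, ∑ j, ∑ k, w k i j * s k (a i j) 0 0‖ := Complex.re_le_norm _
      _ ≤ (1 + n * η) * scalarOpNorm (mpair θ a) := h3
      _ ≤ (1 + n * η) * 1 := mul_le_mul_of_nonneg_left h4 h7
      _ = 1 + n * η := mul_one _
  refine le_of_forall_pos_le_add fun ε hε => ?_
  have := bound (ε / (n + 1)) (by positivity)
  have h8 : (n : ℝ) * (ε / (n + 1)) ≤ ε := by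
    rw [mul_div_assoc', div_le_iff₀ (by positivity)]
    nlinarith
  linarith

end Recovered

section Approximation

variable {A : MOUS} {L : ∀ n : ℕ, Matrix (Fin n) (Fin n) A.carrier → ℝ}

lemma IsMatrixLipschitzSeminorm.real_smul (hK : IsMatrixLipschitzSeminorm A L) {n : ℕ} {c : ℝ}
    (hc : 0 ≤ c) (v : Matrix (Fin n) (Fin n) A.carrier) : L n ((c : ℂ) • v) = c * L n v := by
  rw [hK.smul_eq, Complex.norm_real, Real.norm_eq_abs, abs_of_nonneg hc]

lemma IsMatrixLipNorm.exists_approx_finite (hL : IsMatrixLipNorm A L) {ι : Type} [Fintype ι]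
    {n : ℕ} {s : ι → MState A 1} (hs : ∀ k, s k ∈ CS A 1)
    {a : Matrix (Fin n) (Fin n) A.carrier} (ha : LfromD A L n a ≤ 1) {ε : ℝ} (hε : 0 < ε) :
    ∃ v : Matrix (Fin n) (Fin n) A.carrier, L n v ≤ 1 ∧
      ∀ k i j, ‖s k (a i j) 0 0 - s k (v i j) 0 0‖ ≤ ε := by
  classical
  have hK := hL.toIsMatrixLipschitzSeminorm
  let π : Matrix (Fin n) (Fin n) A.carrier → (Fin n × Fin n × ι → ℂ) :=
    fun v p => s p.2.2 (v p.1 p.2.1) 0 0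
  have hadd : ∀ v w, π (v + w) = π v + π w := by
    intro v w
    funext p
    show s p.2.2 (v p.1 p.2.1 + w p.1 p.2.1) 0 0 = _
    rw [map_add]
    rfl
  have hsmul : ∀ (c : ℝ) v, π ((c : ℂ) • v) = c • π v := by
    intro c v
    funext p
    show s p.2.2 ((c : ℂ) • v p.1 p.2.1) 0 0 = _
    rw [map_smul]
    show (c : ℂ) * _ = c • _
    rw [Complex.real_smul]
  let B : Set (Fin n × Fin n × ι → ℂ) := π '' {v | L n v ≤ 1}
  have hconv : Convex ℝ B := by
    rintro _ ⟨v, hv, rfl⟩ _ ⟨w, hw, rfl⟩ t u ht hu htu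
    refine ⟨(t : ℂ) • v + (u : ℂ) • w, ?_, by rw [hadd, hsmul, hsmul]⟩
    show L n _ ≤ 1
    refine (hK.add_le n _ _).trans ?_
    rw [hK.real_smul ht, hK.real_smul hu]
    have h1 : t * L n v ≤ t * 1 := mul_le_mul_of_nonneg_left hv ht
    have h2 : u * L n w ≤ u * 1 := mul_le_mul_of_nonneg_left hw hu
    linarith
  by_cases hmem : π a ∈ closure B
  · obtain ⟨_, ⟨v, hv, rfl⟩, hd⟩ := Metric.mem_closure_iff.1 hmem ε hε
    refine ⟨v, hv, fun k i j => ?_⟩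
    have := (dist_le_pi_dist (π a) (π v) (i, j, k)).trans hd.le
    rwa [dist_eq_norm] at this
  exfalso
  obtain ⟨g, u, hg, hu⟩ := RCLike.geometric_hahn_banach_closed_point (𝕜 := ℂ) hconv.closure
    isClosed_closure hmem
  have hg' : ∀ v, L n v ≤ 1 → (g (π v)).re < u := fun v hv => hg _ (subset_closure ⟨v, hv, rfl⟩)
  have hπ0 : π 0 = 0 := by
    have := hsmul 0 0
    simpa using this
  have hu0 : 0 < u := by
    have h0 : L n 0 = 0 := by
      have := hK.real_smul (n := n) le_rfl 0
      simpa using this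
    have := hg' 0 (h0.trans_le zero_le_one)
    rw [hπ0, map_zero] at this
    simpa using this
  have hgle : ∀ v, (g (π v)).re ≤ u * L n v := by
    intro v
    refine le_of_forall_pos_le_add fun δ hδ => ?_
    have hp : 0 < L n v + δ / u := add_pos_of_nonneg_of_pos (hK.nonneg n v) (by positivity)
    have h1 := hg' ((((L n v + δ / u)⁻¹ : ℝ) : ℂ) • v) (by
      rw [hK.real_smul (inv_nonneg.2 hp.le), inv_mul_le_iff₀ hp, mul_one]
      have : 0 < δ / u := by positivity
      linarith)
    rw [hsmul] at h1
    have h2 : (g ((L n v + δ / u)⁻¹ • π v)).re = (L n v + δ / u)⁻¹ * (g (π v)).re := by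
      have : (L n v + δ / u)⁻¹ • π v = (((L n v + δ / u)⁻¹ : ℝ) : ℂ) • π v := by
        funext p
        simp
      rw [this, map_smul, smul_eq_mul, Complex.re_ofReal_mul]
    rw [h2, inv_mul_lt_iff₀ hp] at h1
    have h3 : (L n v + δ / u) * u = u * L n v + δ := by field_simp
    linarith
  let w : ι → Matrix (Fin n) (Fin n) ℂ := fun k => Matrix.of fun i j =>
    ((u⁻¹ : ℝ) : ℂ) * g (fun q => if (i, j, k) = q then 1 else 0)
  have hsum : ∀ v : Matrix (Fin n) (Fin n) A.carrier,
      (∑ i, ∑ j, ∑ k, w k i j * s k (v i j) 0 0).re = u⁻¹ * (g (π v)).re := by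
    intro v
    have h1 : g (π v) = ∑ i, ∑ j, ∑ k, s k (v i j) 0 0 *
        g (fun q => if (i, j, k) = q then 1 else 0) := by
      have := LinearMap.pi_apply_eq_sum_univ g.toLinearMap (π v)
      rw [Fintype.sum_prod_type] at this
      simp only [Fintype.sum_prod_type] at this
      exact this
    rw [← Complex.re_ofReal_mul, h1, Finset.mul_sum]
    simp only [Finset.mul_sum]
    refine congrArg Complex.re (Finset.sum_congr rfl fun i _ => Finset.sum_congr rfl fun j _ =>
      Finset.sum_congr rfl fun k _ => ?_)
    show ((u⁻¹ : ℝ) : ℂ) * _ * _ = _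
    ring
  have hfin := hL.re_sum_le_one hs (w := w) (fun v => by
    rw [hsum, inv_mul_le_iff₀ hu0]
    exact hgle v) ha
  rw [hsum, inv_mul_le_iff₀ hu0, mul_one] at hfin
  exact absurd hu (not_lt.2 hfin)

lemma IsMatrixLipNorm.norm_state_sub_le (hL : IsMatrixLipNorm A L) {s t : MState A 1}
    (hs : s ∈ CS A 1) (ht : t ∈ CS A 1) {n : ℕ} (v : Matrix (Fin n) (Fin n) A.carrier)
    (i j : Fin n) : ‖s (v i j) 0 0 - t (v i j) 0 0‖ ≤ Dmet A L 1 s t * L n v := by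
  have h1 := norm_apply_le_scalarOpNorm_mpair (s - t) v i j 0 0
  rw [mpair_sub_left] at h1
  exact h1.trans (scalarOpNorm_le_Dmet_mul hL.toIsMatrixLipschitzSeminorm hL.finD hs ht v)

/-- The unit ball of a matrix Lip-norm is uniformly dense in the unit ball of the Lip-norm
recovered from its matrix metric. -/
lemma IsMatrixLipNorm.exists_approx (hL : IsMatrixLipNorm A L) {n : ℕ}
    {a : Matrix (Fin n) (Fin n) A.carrier} (ha : LfromD A L n a ≤ 1) {ε : ℝ} (hε : 0 < ε) :
    ∃ v : Matrix (Fin n) (Fin n) A.carrier, L n v ≤ 1 ∧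
      ∀ s ∈ CS A 1, ∀ i j, ‖s (a i j - v i j) 0 0‖ ≤ ε := by
  have hLa := hL.nonneg n a
  obtain ⟨F, hF, hnet⟩ := hL.exists_finite_net 1 (ε := ε / (3 * (L n a + 1))) (by positivity)
  obtain ⟨v, hv, h⟩ := hL.exists_approx_finite (ι := F) (s := fun k => k.1)
    (fun k => hF _ k.2) ha (ε := ε / 3) (by positivity)
  refine ⟨v, hv, fun s hs i j => ?_⟩
  obtain ⟨t, htF, hts⟩ := hnet s hs
  have h1 := hL.norm_state_sub_le (hF t htF) hs a i j
  have h2 := hL.norm_state_sub_le (hF t htF) hs v i j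
  have h3 := h ⟨t, htF⟩ i j
  have hD := Dmet_nonneg (L := L) t s
  have h4 : ε / (3 * (L n a + 1)) * (L n a + 1) = ε / 3 := by field_simp
  have h5 : Dmet A L 1 t s * L n a ≤ ε / 3 := by
    rw [← h4]
    exact mul_le_mul hts.le (by linarith) hLa (by positivity)
  have h6 : Dmet A L 1 t s * L n v ≤ ε / 3 := by
    rw [← h4]
    exact mul_le_mul hts.le (by linarith) (hL.nonneg n v) (by positivity)
  have e : s (a i j - v i j) 0 0 = -(t (a i j) 0 0 - s (a i j) 0 0) +
      (t (a i j) 0 0 - t (v i j) 0 0) + (t (v i j) 0 0 - s (v i j) 0 0) := by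
    rw [map_sub, Matrix.sub_apply]
    ring
  rw [e]
  refine (norm_add₃_le).trans ?_
  rw [norm_neg]
  have h3' : ‖t (a i j) 0 0 - t (v i j) 0 0‖ ≤ ε / 3 := h3
  linarith

lemma IsMatrixLipNorm.exists_approx_of_le (hL : IsMatrixLipNorm A L) {n : ℕ}
    {a : Matrix (Fin n) (Fin n) A.carrier} {κ : ℝ} (hκ : 0 < κ) (ha : LfromD A L n a ≤ κ)
    {ε : ℝ} (hε : 0 < ε) : ∃ v : Matrix (Fin n) (Fin n) A.carrier, L n v ≤ κ ∧
      ∀ s ∈ CS A 1, ∀ i j, ‖s (a i j - v i j) 0 0‖ ≤ ε := by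
  have hsm : LfromD A L n (((κ⁻¹ : ℝ) : ℂ) • a) ≤ 1 := by
    rw [LfromD_eq_supNorm, supNorm_smul hL.ptBdd_stateSlopes, ← LfromD_eq_supNorm,
      Complex.norm_real, Real.norm_eq_abs, abs_of_pos (inv_pos.2 hκ), inv_mul_le_iff₀ hκ, mul_one]
    exact ha
  obtain ⟨v, hv, h⟩ := hL.exists_approx hsm (ε := ε / κ) (by positivity)
  refine ⟨(κ : ℂ) • v, ?_, fun s hs i j => ?_⟩
  · rw [hL.toIsMatrixLipschitzSeminorm.real_smul hκ.le]
    exact mul_le_of_le_one_right hκ.le hv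
  · have h1 := h s hs i j
    have hκ' : (κ : ℂ) ≠ 0 := by exact_mod_cast hκ.ne'
    have e : a i j - ((κ : ℂ) • v) i j = (κ : ℂ) • ((((κ⁻¹ : ℝ) : ℂ) • a) i j - v i j) := by
      rw [Matrix.smul_apply, Matrix.smul_apply, smul_sub, smul_smul, Complex.ofReal_inv,
        mul_inv_cancel₀ hκ', one_smul]
    rw [e, map_smul, Matrix.smul_apply, norm_smul, Complex.norm_real, Real.norm_eq_abs,
      abs_of_pos hκ]
    rwa [le_div_iff₀ hκ, mul_comm] at h1

end Approximation

section RecoveredLipNorm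

variable {A : MOUS} {L : ∀ n : ℕ, Matrix (Fin n) (Fin n) A.carrier → ℝ}

/-- An element on which all states agree is a multiple of the unit. -/
lemma exists_smul_one_of_states {x : A.carrier}
    (h : ∀ s ∈ CS A 1, ∀ t ∈ CS A 1, s x 0 0 = t x 0 0) : ∃ l : ℂ, x = l • A.one := by
  by_cases hne : ∃ t, t ∈ CS A 1
  · obtain ⟨t, ht⟩ := hne
    refine ⟨t x 0 0, sub_eq_zero.1 (eq_zero_of_states fun s hs => ?_)⟩
    rw [map_sub, map_smul, hs.1, Matrix.sub_apply, Matrix.smul_apply, Matrix.one_apply_eq,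
      smul_eq_mul, mul_one, h s hs t ht, sub_self]
  · refine ⟨0, ?_⟩
    rw [zero_smul]
    exact eq_zero_of_states fun s hs => (hne ⟨s, hs⟩).elim

lemma mpair_scalar_eq {k n : ℕ} {φ ψ : MState A k} (hφ : φ ∈ CS A k) (hψ : ψ ∈ CS A k)
    (lam : Matrix (Fin n) (Fin n) ℂ) :
    mpair φ (Matrix.of fun i j => lam i j • A.one) =
      mpair ψ (Matrix.of fun i j => lam i j • A.one) := by
  ext p q
  show φ (lam p.1 q.1 • A.one) p.2 q.2 = ψ (lam p.1 q.1 • A.one) p.2 q.2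
  rw [map_smul, map_smul, hφ.1, hψ.1]

lemma IsMatrixLipNorm.LfromD_isMatrixLipschitzSeminorm (hL : IsMatrixLipNorm A L) :
    IsMatrixLipschitzSeminorm A (LfromD A L) where
  nonneg n v := by
    rw [LfromD_eq_supNorm]
    exact supNorm_nonneg _ _
  add_le n v w := by
    simp only [LfromD_eq_supNorm]
    exact supNorm_add_le hL.ptBdd_stateSlopes n v w
  smul_eq n c v := by
    simp only [LfromD_eq_supNorm]
    exact supNorm_smul hL.ptBdd_stateSlopes n c v
  null_iff n v := by
    constructor
    · intro h0
      have h : ∀ i j, ∃ l : ℂ, v i j = l • A.one := fun i j =>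
        exists_smul_one_of_states fun s hs t ht => by
          have h1 := norm_apply_le_scalarOpNorm_mpair (s - t) v i j 0 0
          rw [mpair_sub_left] at h1
          have h2 := h1.trans (hL.le_LfromD_mul hs ht v)
          rw [h0, zero_mul] at h2
          exact sub_eq_zero.1 (norm_le_zero_iff.1 h2)
      choose lam hlam using h
      exact ⟨lam, Matrix.ext hlam⟩
    · rintro ⟨lam, rfl⟩
      rw [LfromD_eq_supNorm]
      refine le_antisymm (supNorm_le le_rfl fun k θ hθ => ?_) (supNorm_nonneg _ _)
      obtain ⟨φ, hφ, ψ, hψ, -, rfl⟩ := hθ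
      rw [scalarOpNorm_mpair_slope, mpair_scalar_eq hφ hψ, sub_self, scalarOpNorm_zero, zero_div]
  dsum_eq m n v w := by
    simp only [LfromD_eq_supNorm]
    exact supNorm_dsumMat hL.ptBdd_stateSlopes m n v w
  mmul_le m n α v β := by
    simp only [LfromD_eq_supNorm]
    exact supNorm_mmulMat_le hL.ptBdd_stateSlopes m n α v β
  star_eq n v := by
    simp only [LfromD_eq_supNorm]
    refine supNorm_conjTranspose ?_ n v
    rintro k _ ⟨φ, hφ, ψ, hψ, -, rfl⟩ x
    rw [LinearMap.smul_apply, LinearMap.smul_apply, LinearMap.sub_apply, LinearMap.sub_apply,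
      (mem_CS_iff.1 hφ).2.map_star, (mem_CS_iff.1 hψ).2.map_star, Matrix.conjTranspose_smul,
      Matrix.conjTranspose_sub]
    congr 1
    exact (Complex.conj_ofReal _).symm

lemma IsMatrixLipNorm.Dmet_LfromD (hL : IsMatrixLipNorm A L) {k : ℕ} {φ ψ : MState A k}
    (hφ : φ ∈ CS A k) (hψ : ψ ∈ CS A k) : Dmet A (LfromD A L) k φ ψ = Dmet A L k φ ψ := by
  have hle : ∀ (r : ℕ) (a : Matrix (Fin r) (Fin r) A.carrier), LfromD A L r a ≤ 1 →
      scalarOpNorm (mpair φ a - mpair ψ a) ≤ Dmet A L k φ ψ := fun r a ha =>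
    (hL.le_LfromD_mul hφ hψ a).trans (mul_le_of_le_one_left (Dmet_nonneg φ ψ) ha)
  refine le_antisymm (Dmet_le (Dmet_nonneg φ ψ) hle) (Dmet_le (Dmet_nonneg φ ψ) fun r a ha => ?_)
  refine le_csSup ⟨Dmet A L k φ ψ, ?_⟩ ⟨r, a, (hL.LfromD_le a).trans ha, rfl⟩
  rintro x ⟨r, a, ha, rfl⟩
  exact hle r a ha

lemma IsMatrixLipNorm.LfromD (hL : IsMatrixLipNorm A L) : IsMatrixLipNorm A (LfromD A L) where
  toIsMatrixLipschitzSeminorm := hL.LfromD_isMatrixLipschitzSeminorm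
  top_eq n := by
    rw [← hL.top_eq n]
    unfold Dtop
    congr 1
    ext U
    have h : ∀ (φ₀ : {φ : MState A n // φ ∈ CS A n}) (ε : ℝ),
        {ψ : {φ : MState A n // φ ∈ CS A n} | Dmet A (_root_.LfromD A L) n φ₀.1 ψ.1 < ε} =
          {ψ | Dmet A L n φ₀.1 ψ.1 < ε} := by
      intro φ₀ ε
      ext ψ
      show Dmet A (_root_.LfromD A L) n φ₀.1 ψ.1 < ε ↔ Dmet A L n φ₀.1 ψ.1 < ε
      rw [hL.Dmet_LfromD φ₀.2 ψ.2]
    constructor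
    · rintro ⟨φ₀, ε, hε, rfl⟩
      exact ⟨φ₀, ε, hε, h φ₀ ε⟩
    · rintro ⟨φ₀, ε, hε, rfl⟩
      exact ⟨φ₀, ε, hε, (h φ₀ ε).symm⟩

end RecoveredLipNorm

section Hausdorff

lemma hDist_le {X : Type} {d : X → X → ℝ} (hd : ∀ x y, 0 ≤ d x y) {s t : Set X} {ε : ℝ}
    (hε : 0 ≤ ε) (h1 : ∀ x ∈ s, ∃ y ∈ t, d x y ≤ ε) (h2 : ∀ y ∈ t, ∃ x ∈ s, d x y ≤ ε) :
    hDist d s t ≤ ε := by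
  refine max_le (Real.sSup_le ?_ hε) (Real.sSup_le ?_ hε)
  · rintro _ ⟨x, hx, rfl⟩
    obtain ⟨y, hy, hxy⟩ := h1 x hx
    refine le_trans (csInf_le ⟨0, ?_⟩ ⟨y, hy, rfl⟩) hxy
    rintro _ ⟨z, -, rfl⟩
    exact hd x z
  · rintro _ ⟨y, hy, rfl⟩
    obtain ⟨x, hx, hxy⟩ := h2 y hy
    refine le_trans (csInf_le ⟨0, ?_⟩ ⟨x, hx, rfl⟩) hxy
    rintro _ ⟨z, -, rfl⟩
    exact hd z y

lemma hDist_nonneg {X : Type} {d : X → X → ℝ} (hd : ∀ x y, 0 ≤ d x y) (s t : Set X) :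
    0 ≤ hDist d s t := by
  refine le_max_of_le_left (Real.sSup_nonneg ?_)
  rintro _ ⟨x, -, rfl⟩
  refine Real.sInf_nonneg ?_
  rintro _ ⟨y, -, rfl⟩
  exact hd x y

variable {A W : MOUS} {L : ∀ n : ℕ, Matrix (Fin n) (Fin n) A.carrier → ℝ}
  {M : ∀ n : ℕ, Matrix (Fin n) (Fin n) W.carrier → ℝ}

lemma iSup_hDist_nonneg (K : ∀ n : ℕ, Matrix (Fin n) (Fin n) (A.prod W).carrier → ℝ) :
    0 ≤ ⨆ n : ℕ, ((n : ℝ) ^ 2)⁻¹ * hDist (Dmet (A.prod W) K n)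
      ((fun φ : MState A n => φ.comp (fstL A W)) '' CS A n)
      ((fun φ : MState W n => φ.comp (sndL A W)) '' CS W n) :=
  Real.iSup_nonneg fun _ => mul_nonneg (by positivity) (hDist_nonneg Dmet_nonneg _ _)

lemma distNC_nonneg : 0 ≤ distNC A L W M := by
  refine Real.sInf_nonneg ?_
  rintro _ ⟨K, -, rfl⟩
  exact iSup_hDist_nonneg K

lemma distNC_le {K : ∀ n : ℕ, Matrix (Fin n) (Fin n) (A.prod W).carrier → ℝ}
    (hK : K ∈ MSet A L W M) {ε : ℝ} (hε : 0 ≤ ε)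
    (h1 : ∀ n, ∀ φ ∈ CS A n, ∃ ψ ∈ CS W n,
      Dmet (A.prod W) K n (φ.comp (fstL A W)) (ψ.comp (sndL A W)) ≤ ε)
    (h2 : ∀ n, ∀ ψ ∈ CS W n, ∃ φ ∈ CS A n,
      Dmet (A.prod W) K n (φ.comp (fstL A W)) (ψ.comp (sndL A W)) ≤ ε) :
    distNC A L W M ≤ ε := by
  have hle : (⨆ n : ℕ, ((n : ℝ) ^ 2)⁻¹ * hDist (Dmet (A.prod W) K n)
      ((fun φ : MState A n => φ.comp (fstL A W)) '' CS A n)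
      ((fun φ : MState W n => φ.comp (sndL A W)) '' CS W n)) ≤ ε := by
    refine Real.iSup_le (fun n => ?_) hε
    have hH : hDist (Dmet (A.prod W) K n)
        ((fun φ : MState A n => φ.comp (fstL A W)) '' CS A n)
        ((fun φ : MState W n => φ.comp (sndL A W)) '' CS W n) ≤ ε := by
      refine hDist_le Dmet_nonneg hε ?_ ?_
      · rintro _ ⟨φ, hφ, rfl⟩
        obtain ⟨ψ, hψ, h⟩ := h1 n φ hφ
        exact ⟨_, ⟨ψ, hψ, rfl⟩, h⟩
      · rintro _ ⟨ψ, hψ, rfl⟩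
        obtain ⟨φ, hφ, h⟩ := h2 n ψ hψ
        exact ⟨_, ⟨φ, hφ, rfl⟩, h⟩
    have hn : ((n : ℝ) ^ 2)⁻¹ ≤ 1 := by
      rcases Nat.eq_zero_or_pos n with rfl | hn
      · simp
      · refine inv_le_one_of_one_le₀ (one_le_pow₀ ?_)
        exact_mod_cast hn
    exact (mul_le_mul_of_nonneg_left hH (by positivity)).trans (mul_le_of_le_one_left hε hn)
  refine le_trans (csInf_le ⟨0, ?_⟩ ⟨K, hK, rfl⟩) hle
  rintro _ ⟨K, -, rfl⟩
  exact iSup_hDist_nonneg K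

end Hausdorff

section Bridge

variable {A W : MOUS} {L : ∀ n : ℕ, Matrix (Fin n) (Fin n) A.carrier → ℝ}
  {M : ∀ n : ℕ, Matrix (Fin n) (Fin n) W.carrier → ℝ} {j : A.carrier →ₗ[ℂ] W.carrier}

lemma IsUCP.comp_mem_CS (hj : IsUCP A W j) {n : ℕ} {φ : MState W n} (hφ : φ ∈ CS W n) :
    φ.comp j ∈ CS A n := by
  refine ⟨?_, fun r v hv => hφ.2 r _ (hj.cp r v hv)⟩
  rw [LinearMap.comp_apply, hj.unital, hφ.1]

/-- The maps `(a, b) ↦ ε⁻¹ φ(j a - b)` for matrix states `φ`. -/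
def gapMaps (j : A.carrier →ₗ[ℂ] W.carrier) (ε : ℝ) (k : ℕ) : Set (MState (A.prod W) k) :=
  {θ | ∃ φ ∈ CS W k, θ = ((ε⁻¹ : ℝ) : ℂ) • (φ.comp j).comp (fstL A W) -
    ((ε⁻¹ : ℝ) : ℂ) • φ.comp (sndL A W)}

lemma gap_apply (ε : ℝ) {k : ℕ} (φ : MState W k) (x : (A.prod W).carrier) :
    (((ε⁻¹ : ℝ) : ℂ) • (φ.comp j).comp (fstL A W) - ((ε⁻¹ : ℝ) : ℂ) • φ.comp (sndL A W)) x =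
      ((ε⁻¹ : ℝ) : ℂ) • φ (j x.1 - x.2) := by
  rw [map_sub, smul_sub]
  rfl

lemma scalarOpNorm_mpair_gap {ε : ℝ} (hε : 0 < ε) {n k : ℕ} (φ : MState W k)
    (v : Matrix (Fin n) (Fin n) (A.prod W).carrier) :
    scalarOpNorm (mpair (((ε⁻¹ : ℝ) : ℂ) • (φ.comp j).comp (fstL A W) -
      ((ε⁻¹ : ℝ) : ℂ) • φ.comp (sndL A W)) v) = ε⁻¹ *
      scalarOpNorm (mpair φ (mapMat j (mapMat (fstL A W) v) - mapMat (sndL A W) v)) := by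
  have e : mpair (((ε⁻¹ : ℝ) : ℂ) • (φ.comp j).comp (fstL A W) -
      ((ε⁻¹ : ℝ) : ℂ) • φ.comp (sndL A W)) v = ((ε⁻¹ : ℝ) : ℂ) •
        mpair φ (mapMat j (mapMat (fstL A W) v) - mapMat (sndL A W) v) := by
    ext p q
    show (((ε⁻¹ : ℝ) : ℂ) • (φ.comp j).comp (fstL A W) -
      ((ε⁻¹ : ℝ) : ℂ) • φ.comp (sndL A W)) (v p.1 q.1) p.2 q.2 = _
    rw [gap_apply]
    rfl
  rw [e, scalarOpNorm_smul, Complex.norm_real, Real.norm_eq_abs, abs_of_pos (inv_pos.2 hε)]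

lemma ptBdd_gapMaps {ε : ℝ} (hε : 0 < ε) : PtBdd (gapMaps j ε) := by
  refine ptBdd_of_forall fun x => ?_
  obtain ⟨C, -, h⟩ := exists_bound_CS (j x.1 - x.2)
  refine ⟨ε⁻¹ * C, ?_⟩
  rintro k _ ⟨φ, hφ, rfl⟩
  rw [gap_apply, scalarOpNorm_smul, Complex.norm_real, Real.norm_eq_abs,
    abs_of_pos (inv_pos.2 hε)]
  exact mul_le_mul_of_nonneg_left (h k φ hφ) (inv_pos.2 hε).le

/-- The seminorms `max (L a) (M b) (ε⁻¹ ‖j a - b‖)` on a direct sum. -/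
def bridgeNorm (L : ∀ n : ℕ, Matrix (Fin n) (Fin n) A.carrier → ℝ)
    (M : ∀ n : ℕ, Matrix (Fin n) (Fin n) W.carrier → ℝ) (j : A.carrier →ₗ[ℂ] W.carrier) (ε : ℝ)
    (n : ℕ) (v : Matrix (Fin n) (Fin n) (A.prod W).carrier) : ℝ :=
  max (max (L n (mapMat (fstL A W) v)) (M n (mapMat (sndL A W) v))) (supNorm (gapMaps j ε) n v)

lemma mapMat_dsumMat {V U : Type} [AddCommGroup V] [AddCommGroup U] [Module ℂ V] [Module ℂ U]
    (φ : V →ₗ[ℂ] U) {m n : ℕ} (v : Matrix (Fin m) (Fin m) V) (w : Matrix (Fin n) (Fin n) V) :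
    mapMat φ (dsumMat v w) = dsumMat (mapMat φ v) (mapMat φ w) := by
  ext i j
  refine Fin.addCases (fun i => ?_) (fun i => ?_) i <;>
    refine Fin.addCases (fun j => ?_) (fun j => ?_) j <;>
    simp [mapMat, dsumMat, -Fin.natAdd_eq_addNat]

lemma mapMat_mmulMat {V U : Type} [AddCommGroup V] [AddCommGroup U] [Module ℂ V] [Module ℂ U]
    (φ : V →ₗ[ℂ] U) {m n : ℕ} (α : Matrix (Fin n) (Fin m) ℂ) (v : Matrix (Fin m) (Fin m) V)
    (β : Matrix (Fin m) (Fin n) ℂ) :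
    mapMat φ (mmulMat α v β) = mmulMat α (mapMat φ v) β := by
  ext i j
  simp [mapMat, mmulMat, map_sum]

lemma mapMat_add {V U : Type} [AddCommGroup V] [AddCommGroup U] [Module ℂ V] [Module ℂ U]
    (φ : V →ₗ[ℂ] U) {n : ℕ} (v w : Matrix (Fin n) (Fin n) V) :
    mapMat φ (v + w) = mapMat φ v + mapMat φ w :=
  Matrix.ext fun i j => map_add φ (v i j) (w i j)

lemma mapMat_smul {V U : Type} [AddCommGroup V] [AddCommGroup U] [Module ℂ V] [Module ℂ U]
    (φ : V →ₗ[ℂ] U) {n : ℕ} (c : ℂ) (v : Matrix (Fin n) (Fin n) V) :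
    mapMat φ (c • v) = c • mapMat φ v :=
  Matrix.ext fun i j => map_smul φ c (v i j)

/-- The graph embedding of matrices into the direct sum. -/
def pairMat {n : ℕ} (a : Matrix (Fin n) (Fin n) A.carrier) (b : Matrix (Fin n) (Fin n) W.carrier) :
    Matrix (Fin n) (Fin n) (A.prod W).carrier :=
  Matrix.of fun i k => ((a i k, b i k) : A.carrier × W.carrier)

lemma mapMat_fst_pairMat {n : ℕ} (a : Matrix (Fin n) (Fin n) A.carrier)
    (b : Matrix (Fin n) (Fin n) W.carrier) : mapMat (fstL A W) (pairMat a b) = a := rfl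

lemma mapMat_snd_pairMat {n : ℕ} (a : Matrix (Fin n) (Fin n) A.carrier)
    (b : Matrix (Fin n) (Fin n) W.carrier) : mapMat (sndL A W) (pairMat a b) = b := rfl

lemma isMatrixLipschitzSeminorm_bridgeNorm (hL : IsMatrixLipschitzSeminorm A L)
    (hM : IsMatrixLipschitzSeminorm W M) (hj : IsUCP A W j) {ε : ℝ} (hε : 0 < ε) :
    IsMatrixLipschitzSeminorm (A.prod W) (bridgeNorm L M j ε) where
  nonneg n v := le_max_of_le_right (supNorm_nonneg _ _)
  add_le n v w := by
    unfold bridgeNorm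
    rw [mapMat_add, mapMat_add]
    refine max_le (max_le ?_ ?_) ?_
    · exact (hL.add_le n _ _).trans (add_le_add (le_max_of_le_left (le_max_left _ _))
        (le_max_of_le_left (le_max_left _ _)))
    · exact (hM.add_le n _ _).trans (add_le_add (le_max_of_le_left (le_max_right _ _))
        (le_max_of_le_left (le_max_right _ _)))
    · exact (supNorm_add_le (ptBdd_gapMaps hε) n v w).trans
        (add_le_add (le_max_right _ _) (le_max_right _ _))
  smul_eq n c v := by
    unfold bridgeNorm
    rw [mapMat_smul, mapMat_smul, hL.smul_eq, hM.smul_eq, supNorm_smul (ptBdd_gapMaps hε),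
      mul_max_of_nonneg _ _ (norm_nonneg c), mul_max_of_nonneg _ _ (norm_nonneg c)]
  null_iff n v := by
    constructor
    · intro h
      have h1 : L n (mapMat (fstL A W) v) = 0 :=
        le_antisymm ((le_max_of_le_left (le_max_left _ _)).trans_eq h) (hL.nonneg n _)
      have h2 : supNorm (gapMaps j ε) n v ≤ 0 := (le_max_right _ _).trans_eq h
      obtain ⟨lam, hlam⟩ := (hL.null_iff n _).1 h1
      have h3 : ∀ p q, (v p q).1 = lam p q • A.one := fun p q => congrFun (congrFun hlam p) q
      refine ⟨lam, ?_⟩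
      ext p q
      have h4 : j (v p q).1 - (v p q).2 = 0 := by
        refine eq_zero_of_states fun s hs => ?_
        have h5 := (le_supNorm (ptBdd_gapMaps hε) v ⟨s, hs, rfl⟩).trans h2
        rw [scalarOpNorm_mpair_gap hε] at h5
        have h6 := norm_apply_le_scalarOpNorm_mpair s
          (mapMat j (mapMat (fstL A W) v) - mapMat (sndL A W) v) p q 0 0
        have h7 : scalarOpNorm (mpair s
            (mapMat j (mapMat (fstL A W) v) - mapMat (sndL A W) v)) ≤ 0 := by
          by_contra hcon
          exact absurd h5 (not_le.2 (mul_pos (inv_pos.2 hε) (not_le.1 hcon)))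
        exact norm_le_zero_iff.1 (h6.trans h7)
      have h5 : (v p q).2 = lam p q • W.one := by
        rw [← sub_eq_zero.1 h4, h3, map_smul, hj.unital]
      exact Prod.ext (h3 p q) h5
    · rintro ⟨lam, rfl⟩
      refine le_antisymm (max_le (max_le ?_ ?_) ?_) (le_max_of_le_right (supNorm_nonneg _ _))
      · exact ((hL.null_iff n _).2 ⟨lam, rfl⟩).le
      · exact ((hM.null_iff n _).2 ⟨lam, rfl⟩).le
      · refine supNorm_le le_rfl ?_
        rintro k _ ⟨φ, hφ, rfl⟩
        rw [scalarOpNorm_mpair_gap hε]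
        have e : mapMat j (mapMat (fstL A W) (Matrix.of fun p q => lam p q • (A.prod W).one)) -
            mapMat (sndL A W) (Matrix.of fun p q => lam p q • (A.prod W).one) = 0 := by
          ext p q
          show j (lam p q • A.one) - lam p q • W.one = 0
          rw [map_smul, hj.unital, sub_self]
        have e0 : mpair φ (0 : Matrix (Fin n) (Fin n) W.carrier) = 0 := by
          ext p q
          show φ 0 p.2 q.2 = 0
          rw [map_zero]
          rfl
        rw [e, e0, scalarOpNorm_zero, mul_zero]
  dsum_eq m n v w := by
    unfold bridgeNorm
    rw [mapMat_dsumMat, mapMat_dsumMat, hL.dsum_eq, hM.dsum_eq,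
      supNorm_dsumMat (ptBdd_gapMaps hε), max_max_max_comm (L m _), max_max_max_comm]
  mmul_le m n α v β := by
    have hα := scalarOpNorm_nonneg α
    have hβ := scalarOpNorm_nonneg β
    unfold bridgeNorm
    rw [mapMat_mmulMat, mapMat_mmulMat]
    refine max_le (max_le ?_ ?_) ?_
    · refine (hL.mmul_le m n α _ β).trans ?_
      gcongr
      exact le_max_of_le_left (le_max_left _ _)
    · refine (hM.mmul_le m n α _ β).trans ?_
      gcongr
      exact le_max_of_le_left (le_max_right _ _)
    · refine (supNorm_mmulMat_le (ptBdd_gapMaps hε) m n α _ β).trans ?_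
      gcongr
      exact le_max_right _ _
  star_eq n v := by
    have h : supNorm (gapMaps j ε) n v.conjTranspose = supNorm (gapMaps j ε) n v := by
      refine supNorm_conjTranspose ?_ n v
      rintro k _ ⟨φ, hφ, rfl⟩ x
      rw [gap_apply, gap_apply]
      have e : j (star x).1 - (star x).2 = star (j x.1 - x.2) := by
        rw [star_sub, ← hj.map_star]
        rfl
      rw [e, (mem_CS_iff.1 hφ).2.map_star, Matrix.conjTranspose_smul]
      congr 1
      exact (Complex.conj_ofReal _).symm
    unfold bridgeNorm
    rw [h]
    congr 2
    · exact hL.star_eq n _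
    · exact hM.star_eq n _

end Bridge

section BridgeLipNorm

variable {A W : MOUS} {L : ∀ n : ℕ, Matrix (Fin n) (Fin n) A.carrier → ℝ}
  {M : ∀ n : ℕ, Matrix (Fin n) (Fin n) W.carrier → ℝ} {j : A.carrier →ₗ[ℂ] W.carrier}

/-- States of a direct sum split into positive functionals on the summands. -/
lemma norm_state_prod_le {s : MState (A.prod W) 1} (hs : s ∈ CS (A.prod W) 1) {x : A.carrier}
    {y : W.carrier} {ε : ℝ} (hx : ∀ t ∈ CS A 1, ‖t x 0 0‖ ≤ ε)
    (hy : ∀ t ∈ CS W 1, ‖t y 0 0‖ ≤ ε) :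
    ‖s ((x, y) : A.carrier × W.carrier) 0 0‖ ≤ ε := by
  let f : MState A 1 := s.comp (LinearMap.inl ℂ A.carrier W.carrier)
  let g : MState W 1 := s.comp (LinearMap.inr ℂ A.carrier W.carrier)
  have hf : IsCPMap f := fun r v hv =>
    hs.2 r (pairMat v 0) ⟨hv, W.zero_mem_pos r⟩
  have hg : IsCPMap g := fun r v hv =>
    hs.2 r (pairMat 0 v) ⟨A.zero_mem_pos r, hv⟩
  have hsplit : ∀ (a : A.carrier) (b : W.carrier),
      s ((a, b) : A.carrier × W.carrier) 0 0 = f a 0 0 + g b 0 0 := by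
    intro a b
    have e : ((a, b) : A.carrier × W.carrier) = LinearMap.inl ℂ A.carrier W.carrier a +
        LinearMap.inr ℂ A.carrier W.carrier b := by simp
    have e' : s ((a, b) : A.carrier × W.carrier) = f a + g b :=
      (congrArg s e).trans (map_add s _ _)
    rw [e', Matrix.add_apply]
  have h1 : (f A.one 0 0).re + (g W.one 0 0).re = 1 := by
    rw [← Complex.add_re, ← hsplit]
    have : s ((A.one, W.one) : A.carrier × W.carrier) = 1 := hs.1
    rw [this]
    simp
  rw [hsplit]
  calc ‖f x 0 0 + g y 0 0‖ ≤ ‖f x 0 0‖ + ‖g y 0 0‖ := norm_add_le _ _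
    _ ≤ ε * (f A.one 0 0).re + ε * (g W.one 0 0).re :=
        add_le_add (hf.norm_apply_le hx) (hg.norm_apply_le hy)
    _ = ε := by rw [← mul_add, h1, mul_one]

lemma exists_lipNet_bridgeNorm (hL : IsMatrixLipNorm A L) (hM : IsMatrixLipNorm W M)
    (hj : IsUCP A W j) (hinj : Function.Injective j) {ε : ℝ} (hε : 0 < ε) {δ : ℝ} (hδ : 0 < δ) :
    ∃ Φ, IsLipNet (A.prod W) (bridgeNorm L M j ε) δ Φ := by
  by_cases hne : ∃ t, t ∈ CS W 1
  swap
  · have hW : ∀ b : W.carrier, b = 0 := fun b =>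
      eq_zero_of_states fun s hs => (hne ⟨s, hs⟩).elim
    have hA : ∀ a : A.carrier, a = 0 := fun a => hinj (by rw [hW (j a), hW (j 0)])
    refine ⟨{0}, Set.finite_singleton 0, fun c _ => ⟨0, rfl, 0, fun s hs => ?_⟩⟩
    have h0 : c - 0 - (0 : ℂ) • (A.prod W).one = 0 := Prod.ext (hA _) (hW _)
    rw [h0, map_zero, Matrix.zero_apply, norm_zero]
    exact hδ.le
  obtain ⟨t, ht⟩ := hne
  have hδ3 : 0 < δ / 3 := by positivity
  obtain ⟨Φ₁, hΦ₁, h1⟩ := hL.exists_lipNet hδ3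
  obtain ⟨Φ₂, hΦ₂, h2⟩ := hM.exists_lipNet hδ3
  have hball : ∀ R : ℝ, ∃ Z : Set ℂ, Z.Finite ∧ ∀ z : ℂ, ‖z‖ ≤ R → ∃ y ∈ Z, ‖z - y‖ ≤ δ / 3 := by
    intro R
    obtain ⟨Z, -, hZ, hcov⟩ := Metric.finite_approx_of_totallyBounded
      (isCompact_closedBall (0 : ℂ) R).totallyBounded (δ / 3) hδ3
    refine ⟨Z, hZ, fun z hz => ?_⟩
    have hz' : z ∈ Metric.closedBall (0 : ℂ) R := by simpa using hz
    obtain ⟨y, hy, hzy⟩ := Set.mem_iUnion₂.1 (hcov hz')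
    exact ⟨y, hy, by rw [← dist_eq_norm]; exact (Metric.mem_ball.1 hzy).le⟩
  choose Z hZ hZapprox using hball
  let Φ : Set (A.prod W).carrier := ⋃ p ∈ Φ₁ ×ˢ Φ₂,
    (fun z : ℂ => ((p.1, p.2 + z • W.one) : A.carrier × W.carrier)) ''
      Z (ε + δ + ‖t (j p.1 - p.2) 0 0‖)
  refine ⟨Φ, (hΦ₁.prod hΦ₂).biUnion fun p _ => (hZ _).image _, fun c hc => ?_⟩
  have hLc : L 1 (MOUS.single c.1) ≤ 1 := (le_max_of_le_left (le_max_left _ _)).trans hc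
  have hMc : M 1 (MOUS.single c.2) ≤ 1 := (le_max_of_le_left (le_max_right _ _)).trans hc
  obtain ⟨a₀, ha₀, l, hl⟩ := h1 c.1 hLc
  obtain ⟨b₀, hb₀, m, hm⟩ := h2 c.2 hMc
  have hgap : ‖t (j c.1 - c.2) 0 0‖ ≤ ε := by
    have h3 := (le_supNorm (ptBdd_gapMaps hε) (MOUS.single c) ⟨t, ht, rfl⟩).trans
      ((le_max_right _ _).trans hc)
    rw [scalarOpNorm_mpair_gap hε, inv_mul_le_iff₀ hε, mul_one] at h3
    exact (norm_apply_le_scalarOpNorm_mpair t _ 0 0 0 0).trans h3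
  have hml : ‖m - l‖ ≤ ε + δ + ‖t (j a₀ - b₀) 0 0‖ := by
    have h4 : ‖t (j (c.1 - a₀ - l • A.one)) 0 0‖ ≤ δ / 3 := hl _ (hj.comp_mem_CS ht)
    have h5 : ‖t (c.2 - b₀ - m • W.one) 0 0‖ ≤ δ / 3 := hm t ht
    have e : m - l = t (j (c.1 - a₀ - l • A.one)) 0 0 - t (c.2 - b₀ - m • W.one) 0 0 -
        t (j c.1 - c.2) 0 0 + t (j a₀ - b₀) 0 0 := by
      simp only [map_sub, map_smul, hj.unital, ht.1, Matrix.sub_apply, Matrix.smul_apply,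
        Matrix.one_apply_eq, smul_eq_mul]
      ring
    rw [e]
    have h6 := norm_add_le (t (j (c.1 - a₀ - l • A.one)) 0 0 - t (c.2 - b₀ - m • W.one) 0 0 -
      t (j c.1 - c.2) 0 0) (t (j a₀ - b₀) 0 0)
    have h7 := norm_sub_le (t (j (c.1 - a₀ - l • A.one)) 0 0 - t (c.2 - b₀ - m • W.one) 0 0)
      (t (j c.1 - c.2) 0 0)
    have h8 := norm_sub_le (t (j (c.1 - a₀ - l • A.one)) 0 0) (t (c.2 - b₀ - m • W.one) 0 0)
    linarith
  obtain ⟨z, hz, hzm⟩ := hZapprox _ _ hml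
  refine ⟨((a₀, b₀ + z • W.one) : A.carrier × W.carrier),
    Set.mem_iUnion₂.2 ⟨(a₀, b₀), ⟨ha₀, hb₀⟩, z, hz, rfl⟩, l, fun s hs => ?_⟩
  refine norm_state_prod_le (x := c.1 - a₀ - l • A.one) (y := c.2 - (b₀ + z • W.one) - l • W.one)
    hs (fun u hu => (hl u hu).trans (by linarith)) fun u hu => ?_
  have e : u (c.2 - (b₀ + z • W.one) - l • W.one) 0 0 =
      u (c.2 - b₀ - m • W.one) 0 0 + (m - l - z) := by
    simp only [map_sub, map_add, map_smul, hu.1, Matrix.sub_apply, Matrix.add_apply,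
      Matrix.smul_apply, Matrix.one_apply_eq, smul_eq_mul]
    ring
  rw [e]
  refine (norm_add_le _ _).trans ?_
  have := hm u hu
  linarith

lemma isMatrixLipNorm_bridgeNorm (hL : IsMatrixLipNorm A L) (hM : IsMatrixLipNorm W M)
    (hj : IsUCP A W j) (hinj : Function.Injective j) {ε : ℝ} (hε : 0 < ε) :
    IsMatrixLipNorm (A.prod W) (bridgeNorm L M j ε) :=
  isMatrixLipNorm_of_lipNet (isMatrixLipschitzSeminorm_bridgeNorm hL.toIsMatrixLipschitzSeminorm
    hM.toIsMatrixLipschitzSeminorm hj hε)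
    fun _ hδ => exists_lipNet_bridgeNorm hL hM hj hinj hε hδ

lemma bridgeNorm_mem_MSet (hL : IsMatrixLipNorm A L) (hM : IsMatrixLipNorm W M)
    (hj : IsUCP A W j) (hinj : Function.Injective j)
    (h1 : ∀ n (a : Matrix (Fin n) (Fin n) A.carrier), M n (mapMat j a) ≤ L n a)
    (h2 : ∀ n (b : Matrix (Fin n) (Fin n) W.carrier) (δ : ℝ), 0 < δ → ∃ a, L n a ≤ M n b + δ ∧
      ∀ t ∈ CS W 1, ∀ p q, ‖t (b p q - j (a p q)) 0 0‖ ≤ δ) {ε : ℝ} (hε : 0 < ε) :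
    bridgeNorm L M j ε ∈ MSet A L W M := by
  refine ⟨isMatrixLipNorm_bridgeNorm hL hM hj hinj hε, fun n a => ?_, fun n b => ?_⟩
  · suffices h : IsLeast {x | ∃ v, mapMat (fstL A W) v = a ∧ x = bridgeNorm L M j ε n v}
        (L n a) from h.csInf_eq.symm
    refine ⟨⟨pairMat a (mapMat j a), mapMat_fst_pairMat _ _, ?_⟩, ?_⟩
    · have h0 : supNorm (gapMaps j ε) n (pairMat a (mapMat j a)) ≤ 0 := by
        refine supNorm_le le_rfl ?_
        rintro k _ ⟨φ, hφ, rfl⟩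
        rw [scalarOpNorm_mpair_gap hε, mapMat_fst_pairMat, mapMat_snd_pairMat, sub_self]
        have e0 : mpair φ (0 : Matrix (Fin n) (Fin n) W.carrier) = 0 := by
          ext p q
          show φ 0 p.2 q.2 = 0
          rw [map_zero]
          rfl
        rw [e0, scalarOpNorm_zero, mul_zero]
      refine le_antisymm (le_max_of_le_left (le_max_left _ _))
        (max_le (max_le le_rfl (h1 n a)) (h0.trans (hL.nonneg n a)))
    · rintro x ⟨v, rfl, rfl⟩
      exact le_max_of_le_left (le_max_left _ _)
  · refine le_antisymm (le_csInf ⟨_, pairMat 0 b, mapMat_snd_pairMat _ _, rfl⟩ ?_)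
      (le_of_forall_pos_le_add fun δ hδ => ?_)
    · rintro x ⟨v, rfl, rfl⟩
      exact le_max_of_le_left (le_max_right _ _)
    · have hη : 0 < min δ (ε * δ / (2 * n ^ 2 + 1)) := lt_min hδ (by positivity)
      obtain ⟨a, ha, hab⟩ := h2 n b _ hη
      set η := min δ (ε * δ / (2 * n ^ 2 + 1))
      have hηδ : η ≤ δ := min_le_left _ _
      have hη2 : η * (2 * n ^ 2 + 1) ≤ ε * δ := by
        rw [← le_div_iff₀ (by positivity)]
        exact min_le_right _ _
      have hMb := hM.nonneg n b
      refine le_trans (csInf_le ⟨0, ?_⟩ ⟨pairMat a b, mapMat_snd_pairMat _ _, rfl⟩)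
        (max_le (max_le ?_ ?_) ?_)
      · rintro x ⟨v, -, rfl⟩
        exact le_max_of_le_right (supNorm_nonneg _ _)
      · rw [mapMat_fst_pairMat]
        linarith
      · rw [mapMat_snd_pairMat]
        linarith
      · refine le_trans (supNorm_le hδ.le ?_) (le_add_of_nonneg_left hMb)
        rintro k _ ⟨φ, hφ, rfl⟩
        rw [scalarOpNorm_mpair_gap hε, mapMat_fst_pairMat, mapMat_snd_pairMat,
          inv_mul_le_iff₀ hε]
        have h3 := scalarOpNorm_mpair_le_of_states hφ (v := mapMat j a - b) hη.le
          (fun s hs p q => by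
            have h4 := hab s hs p q
            rw [← neg_sub, map_neg, Matrix.neg_apply, norm_neg] at h4
            exact h4)
        refine h3.trans ?_
        nlinarith

/-- A quantized metric space is at distance zero from one in which it embeds densely with
controlled Lip-norms. -/
lemma distNC_eq_zero_of_dense (hL : IsMatrixLipNorm A L) (hM : IsMatrixLipNorm W M)
    (hj : IsUCP A W j) (hinj : Function.Injective j)
    (hord : ∀ (n : ℕ) (a : Matrix (Fin n) (Fin n) A.carrier), mapMat j a ∈ W.pos n → a ∈ A.pos n)
    (h1 : ∀ n (a : Matrix (Fin n) (Fin n) A.carrier), M n (mapMat j a) ≤ L n a)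
    (h2 : ∀ n (b : Matrix (Fin n) (Fin n) W.carrier) (δ : ℝ), 0 < δ → ∃ a, L n a ≤ M n b + δ ∧
      ∀ t ∈ CS W 1, ∀ p q, ‖t (b p q - j (a p q)) 0 0‖ ≤ δ) :
    distNC A L W M = 0 := by
  refine le_antisymm (le_of_forall_pos_le_add fun ε hε => ?_) distNC_nonneg
  rw [zero_add]
  have hD : ∀ n, ∀ ψ ∈ CS W n, Dmet (A.prod W) (bridgeNorm L M j ε) n
      ((ψ.comp j).comp (fstL A W)) (ψ.comp (sndL A W)) ≤ ε := by
    intro n ψ hψ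
    refine Dmet_le hε.le fun r v hv => ?_
    have h3 := (le_supNorm (ptBdd_gapMaps hε) v ⟨ψ, hψ, rfl⟩).trans ((le_max_right _ _).trans hv)
    rw [scalarOpNorm_mpair_gap hε, inv_mul_le_iff₀ hε, mul_one, mpair_sub] at h3
    exact h3
  refine distNC_le (bridgeNorm_mem_MSet hL hM hj hinj h1 h2 hε) hε.le (fun n φ hφ => ?_)
    fun n ψ hψ => ⟨ψ.comp j, hj.comp_mem_CS hψ, hD n ψ hψ⟩
  obtain ⟨ψ, hψ, rfl⟩ := exists_CS_extension hj hinj hord hφ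
  exact ⟨ψ, hψ, hD n ψ hψ⟩

end BridgeLipNorm

/-- Lemma 5.2 of the paper.  Let `(V, L)` be a quantized metric space.
Then `dist_NC(V, Vᶜ) = 0`, where `(Vᶜ, Lᶜ)` is the closed quantized metric space obtained
by extending `L_{D_L}` to the closure, and also `dist_NC((V, L), (V, L_{D_L})) = 0`. -/
theorem distNC_closure_eq_zero (A : MOUS)
    (L : ∀ n : ℕ, Matrix (Fin n) (Fin n) A.carrier → ℝ)
    (hL : IsMatrixLipNorm A L)
    (W : MOUS) (Lc : ∀ n : ℕ, Matrix (Fin n) (Fin n) W.carrier → ℝ)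
    (j : A.carrier →ₗ[ℂ] W.carrier)
    (hclos : IsClosureOf A L W Lc j) :
    distNC A L W Lc = 0 ∧ distNC A L A (LfromD A L) = 0 := by
  constructor
  · refine distNC_eq_zero_of_dense hL hclos.lip hclos.ucp hclos.inj
      (fun n a h => (hclos.ordEmb n a).1 h)
      (fun n a => (hclos.extends_eq n a).trans_le (hL.LfromD_le a)) fun n b δ hδ => ?_
    have hδ2 : 0 < δ / 2 := by positivity
    obtain ⟨a₁, ha₁, hb⟩ := hclos.dense n b (δ / 2) hδ2
    have hb0 := hclos.lip.nonneg n b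
    have hκ : 0 < Lc n b + δ := by linarith
    rw [hclos.extends_eq] at ha₁
    obtain ⟨a, ha, h⟩ := hL.exists_approx_of_le hκ (ha₁.trans (by linarith)) hδ2
    refine ⟨a, ha, fun t ht p q => ?_⟩
    have h3 : ‖t (b p q - j (a₁ p q)) 0 0‖ ≤ δ / 2 :=
      (norm_apply_le_scalarOpNorm_mpair t (b - mapMat j a₁) p q 0 0).trans
        (scalarOpNorm_mpair_le_of_matNorm_lt ht hδ2.le hb)
    have h4 : ‖t (j (a₁ p q - a p q)) 0 0‖ ≤ δ / 2 := h _ (hclos.ucp.comp_mem_CS ht) p q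
    have e : b p q - j (a p q) = (b p q - j (a₁ p q)) + j (a₁ p q - a p q) := by
      rw [map_sub]
      abel
    rw [e, map_add, Matrix.add_apply]
    refine (norm_add_le _ _).trans ?_
    linarith
  · refine distNC_eq_zero_of_dense (j := LinearMap.id) hL hL.LfromD ⟨rfl, fun n v hv => hv⟩
      Function.injective_id (fun n a h => h) (fun n a => hL.LfromD_le a) fun n b δ hδ => ?_
    have hκ : 0 < LfromD A L n b + δ := add_pos_of_nonneg_of_pos (hL.LfromD.nonneg n b) hδ
    obtain ⟨a, ha, h⟩ := hL.exists_approx_of_le hκ (le_add_of_nonneg_right hδ.le) hδ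
    exact ⟨a, ha, h⟩

end
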